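/- Let Ω_β (β > π/2) be a worm domain. Then the following are equivalent: (1) 1/2 < DF(Ω_β) < 1; (2) S(Ω_β) exists (S(Ω_β) < ∞); (3) cl(Ω_β) has a strong Stein neighborhood basis; and each is equivalent to π/2 < β < π. Moreover, if these conditions hold, then 1/DF(Ω_β) + 1/S(Ω_β) = 2. -/

import Mathlib

noncomputable section

open Complex Topology
open scoped ENNReal

/-- Wirtinger derivative `∂f/∂z_j`. -/
def dz {n : ℕ} (j : Fin n) (f : (Fin n → ℂ) → ℂ) (z : Fin n → ℂ) : ℂ :=
  (fderiv ℝ f z (Pi.single j 1) - Complex.I * fderiv ℝ f z (Pi.single j Complex.I)) / 2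

/-- Wirtinger derivative `∂f/∂z̄_j`. -/
def dzbar {n : ℕ} (j : Fin n) (f : (Fin n → ℂ) → ℂ) (z : Fin n → ℂ) : ℂ :=
  (fderiv ℝ f z (Pi.single j 1) + Complex.I * fderiv ℝ f z (Pi.single j Complex.I)) / 2

/-- Complexification of a real-valued function. -/
def cplx {n : ℕ} (ρ : (Fin n → ℂ) → ℝ) : (Fin n → ℂ) → ℂ := fun z => (ρ z : ℂ)

/-- The Levi form `L_ρ(X,Y)(z) = Σ_{j,k} ∂²ρ/∂z_j∂z̄_k (z) X_j conj(Y_k)`. -/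
def levi {n : ℕ} (ρ : (Fin n → ℂ) → ℝ) (X Y : Fin n → ℂ) (z : Fin n → ℂ) : ℂ :=
  ∑ j, ∑ k, dz j (fun w => dzbar k (cplx ρ) w) z * X j * (starRingEnd ℂ) (Y k)

/-- `Xf = Σ_j X_j ∂f/∂z_j` for a (1,0) vector `X`. -/
def dirDeriv {n : ℕ} (X : Fin n → ℂ) (f : (Fin n → ℂ) → ℂ) (z : Fin n → ℂ) : ℂ :=
  ∑ j, X j * dz j f z

/-- `X̄f = Σ_j conj(X_j) ∂f/∂z̄_j`. -/
def dirDerivBar {n : ℕ} (X : Fin n → ℂ) (f : (Fin n → ℂ) → ℂ) (z : Fin n → ℂ) : ℂ :=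
  ∑ j, (starRingEnd ℂ) (X j) * dzbar j f z

/-- Derivative of `f` along the (1,0) vector field `X`. -/
def fieldDeriv {n : ℕ} (X : (Fin n → ℂ) → (Fin n → ℂ)) (f : (Fin n → ℂ) → ℂ)
    (z : Fin n → ℂ) : ℂ :=
  dirDeriv (X z) f z

/-- Euclidean norm of the real gradient of `ρ`. -/
def gradNorm {n : ℕ} (ρ : (Fin n → ℂ) → ℝ) (z : Fin n → ℂ) : ℝ :=
  Real.sqrt (∑ j, ((fderiv ℝ ρ z (Pi.single j 1)) ^ 2 +
    (fderiv ℝ ρ z (Pi.single j Complex.I)) ^ 2))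

/-- The complex normal field `N_ρ`. -/
def nfield {n : ℕ} (ρ : (Fin n → ℂ) → ℝ) (z : Fin n → ℂ) : Fin n → ℂ := fun j =>
  ((Real.sqrt (∑ k, Complex.normSq (dz k (cplx ρ) z)) : ℝ) : ℂ)⁻¹ * dzbar j (cplx ρ) z

/-- Squared Euclidean norm of a vector in ℂⁿ. -/
def enormSq {n : ℕ} (X : Fin n → ℂ) : ℝ := ∑ j, Complex.normSq (X j)

/-- `f` is strictly plurisubharmonic on `S`. -/
def StrictPSHOn {n : ℕ} (f : (Fin n → ℂ) → ℝ) (S : Set (Fin n → ℂ)) : Prop :=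
  ∀ z ∈ S, ∀ X : Fin n → ℂ, X ≠ 0 → 0 < (levi f X X z).re

/-- `ρ` is a (global smooth) defining function of `Ω` on the neighborhood `V` of `cl Ω`. -/
structure IsDefFn {n : ℕ} (Ω V : Set (Fin n → ℂ)) (ρ : (Fin n → ℂ) → ℝ) : Prop where
  isOpen : IsOpen V
  subset : closure Ω ⊆ V
  smooth : ContDiffOn ℝ (⊤ : ℕ∞) ρ V
  eq : Ω = {z ∈ V | ρ z < 0}
  grad_ne : ∀ z ∈ frontier Ω, fderiv ℝ ρ z ≠ 0

/-- The Levi form of `ρ` is positive semidefinite on complex tangent vectors at `z`. -/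
def LeviPseudoconvexAt {n : ℕ} (ρ : (Fin n → ℂ) → ℝ) (z : Fin n → ℂ) : Prop :=
  ∀ X : Fin n → ℂ, dirDeriv X (cplx ρ) z = 0 → 0 ≤ (levi ρ X X z).re

/-- `Ω` is a (smoothly bounded, Levi) pseudoconvex domain. -/
def IsPseudoconvex {n : ℕ} (Ω : Set (Fin n → ℂ)) : Prop :=
  ∃ (V : Set (Fin n → ℂ)) (ρ : (Fin n → ℂ) → ℝ), IsDefFn Ω V ρ ∧
    ∀ p ∈ frontier Ω, LeviPseudoconvexAt ρ p

/-- The set of Steinness exponents of `ρ`. -/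
def steinExpSet {n : ℕ} (Ω : Set (Fin n → ℂ)) (ρ : (Fin n → ℂ) → ℝ) : Set ℝ :=
  {η : ℝ | 1 < η ∧ ∃ W : Set (Fin n → ℂ), IsOpen W ∧ frontier Ω ⊆ W ∧
    StrictPSHOn (fun z => ρ z ^ η) ((closure Ω)ᶜ ∩ W)}

/-- The Steinness exponent `η̃_ρ` of a defining function `ρ` (`∞` if none exists). -/
def steinExp {n : ℕ} (Ω : Set (Fin n → ℂ)) (ρ : (Fin n → ℂ) → ℝ) : ℝ≥0∞ :=
  sInf (ENNReal.ofReal '' steinExpSet Ω ρ)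

/-- The Steinness index `S(Ω)`. -/
def steinIndex {n : ℕ} (Ω : Set (Fin n → ℂ)) : ℝ≥0∞ :=
  ⨅ (V : Set (Fin n → ℂ)) (ρ : (Fin n → ℂ) → ℝ) (_ : IsDefFn Ω V ρ), steinExp Ω ρ

/-- The set of Diederich–Fornæss exponents of `ρ`. -/
def dfExpSet {n : ℕ} (Ω : Set (Fin n → ℂ)) (ρ : (Fin n → ℂ) → ℝ) : Set ℝ :=
  {η : ℝ | 0 < η ∧ η < 1 ∧ StrictPSHOn (fun z => -((-ρ z) ^ η)) Ω}

/-- The Diederich–Fornæss exponent of `ρ` (`0` if no exponent exists). -/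
def dfExp {n : ℕ} (Ω : Set (Fin n → ℂ)) (ρ : (Fin n → ℂ) → ℝ) : ℝ :=
  sSup (insert 0 (dfExpSet Ω ρ))

/-- The Diederich–Fornæss index `DF(Ω)`. -/
def dfIndex {n : ℕ} (Ω : Set (Fin n → ℂ)) : ℝ :=
  sSup {t : ℝ | ∃ V ρ, IsDefFn Ω V ρ ∧ t = dfExp Ω ρ}

/-- `L` is a smooth (1,0) tangent vector field for `ρ` on `A`. -/
def IsTangentField {n : ℕ} (ρ : (Fin n → ℂ) → ℝ) (L : (Fin n → ℂ) → (Fin n → ℂ))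
    (A : Set (Fin n → ℂ)) : Prop :=
  ContDiffOn ℝ (⊤ : ℕ∞) L A ∧ ∀ z ∈ A, dirDeriv (L z) (cplx ρ) z = 0

/-- The key differential inequality
`(1/(η₂−1))|L_ρ(L,N)|²/‖∇ρ‖² − (1/2)(N L_ρ(L,L))/‖∇ρ‖ ≤ 0` at `p`. -/
def keyIneqAt {n : ℕ} (ρ : (Fin n → ℂ) → ℝ) (L : (Fin n → ℂ) → (Fin n → ℂ)) (η₂ : ℝ)
    (p : Fin n → ℂ) : Prop :=
  1 / (η₂ - 1) * Complex.normSq (levi ρ (L p) (nfield ρ p) p) / (gradNorm ρ p) ^ 2 -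
    1 / 2 * (fieldDeriv (nfield ρ) (fun w => levi ρ (L w) (L w) w) p).re / gradNorm ρ p ≤ 0

/-- The strict version of the key differential inequality. -/
def strictKeyIneqAt {n : ℕ} (ρ : (Fin n → ℂ) → ℝ) (L : (Fin n → ℂ) → (Fin n → ℂ)) (η₂ : ℝ)
    (p : Fin n → ℂ) : Prop :=
  1 / (η₂ - 1) * Complex.normSq (levi ρ (L p) (nfield ρ p) p) / (gradNorm ρ p) ^ 2 -
    1 / 2 * (fieldDeriv (nfield ρ) (fun w => levi ρ (L w) (L w) w) p).re / gradNorm ρ p < 0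

/-- `cl Ω` has a strong Stein neighborhood basis. -/
def HasStrongSteinBasis {n : ℕ} (Ω : Set (Fin n → ℂ)) : Prop :=
  ∃ (V : Set (Fin n → ℂ)) (ρ : (Fin n → ℂ) → ℝ), IsDefFn Ω V ρ ∧ ∃ ε₀ : ℝ, 0 < ε₀ ∧
    (∀ z ∈ V, 0 ≤ ρ z → ρ z < ε₀ → fderiv ℝ ρ z ≠ 0) ∧
    ∀ ε : ℝ, 0 ≤ ε → ε < ε₀ → ∀ z ∈ V, ρ z = ε → LeviPseudoconvexAt ρ z

/-- Vanishing order at `0` of a holomorphic function `ℂ → ℂ` (`∞` if all derivatives vanish). -/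
def orderC (h : ℂ → ℂ) : ℕ∞ :=
  sInf ((fun k : ℕ => (k : ℕ∞)) '' {k : ℕ | iteratedDeriv k h 0 ≠ 0})

/-- Vanishing order at `0` of a real-valued function on `ℂ`. -/
def orderR (g : ℂ → ℝ) : ℕ∞ :=
  sInf ((fun k : ℕ => (k : ℕ∞)) '' {k : ℕ | iteratedFDeriv ℝ k g 0 ≠ 0})

/-- `ν(γ)`: minimal vanishing order at `0` of the components of `γ − p`. -/
def curveOrder {n : ℕ} (γ : ℂ → Fin n → ℂ) (p : Fin n → ℂ) : ℕ∞ :=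
  ⨅ j, orderC (fun t => γ t j - p j)

/-- `p` is a boundary point of finite D'Angelo 1-type (w.r.t. the defining function `ρ`). -/
def FiniteTypePt {n : ℕ} (ρ : (Fin n → ℂ) → ℝ) (p : Fin n → ℂ) : Prop :=
  ∃ M : ℕ, ∀ γ : ℂ → Fin n → ℂ, (∀ j, AnalyticAt ℂ (fun t => γ t j) 0) → γ 0 = p →
    ¬ (∀ᶠ t in nhds (0 : ℂ), γ t = p) →
    orderR (fun t => ρ (γ t)) ≤ (M : ℕ∞) * curveOrder γ p

/-- The defining function of the worm domain:
`ρ(z,w) = |z − e^{i log|w|²}|² − (1 − φ(log|w|²))`. -/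
def wormRho (φ : ℝ → ℝ) (p : Fin 2 → ℂ) : ℝ :=
  Complex.normSq (p 0 - Complex.exp (Complex.I * (Real.log (Complex.normSq (p 1)) : ℂ))) -
    (1 - φ (Real.log (Complex.normSq (p 1))))

/-- The Diederich–Fornæss worm domain `Ω_β` (associated to the cut-off `φ`). -/
def wormDomain (φ : ℝ → ℝ) : Set (Fin 2 → ℂ) :=
  {p : Fin 2 → ℂ | p 1 ≠ 0 ∧ wormRho φ p < 0}

/-- The properties of the cut-off function `φ` in the definition of the worm domain. -/
structure IsWormFunction (φ : ℝ → ℝ) (β : ℝ) : Prop where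
  smooth : ContDiff ℝ (⊤ : ℕ∞) φ
  nonneg : ∀ x, 0 ≤ φ x
  even : ∀ x, φ (-x) = φ x
  convex : ConvexOn ℝ Set.univ φ
  zeroSet : φ ⁻¹' {0} = Set.Icc (-(β - Real.pi / 2)) (β - Real.pi / 2)
  large : ∃ a > 0, ∀ x : ℝ, a < |x| → 1 < φ x
  deriv_ne : ∀ x, φ x = 1 → deriv φ x ≠ 0

/-- `f` has the second-order jet `(a, b, c)` at `x`. -/
def HasJet (f : ℝ → ℝ) (x a b c : ℝ) : Prop :=
  f x = a ∧ ∃ f' : ℝ → ℝ, (∀ᶠ y in 𝓝 x, HasDerivAt f (f' y) y) ∧ f' x = b ∧ HasDerivAt f' c x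

namespace HasJet

variable {f g : ℝ → ℝ} {x a b c a' b' c' : ℝ}

lemma unique_snd (h : HasJet f x a b c) (h' : HasJet f x a' b' c') : c = c' := by
  obtain ⟨_, f1, h1, _, h2⟩ := h
  obtain ⟨_, g1, k1, _, k2⟩ := h'
  have : f1 =ᶠ[𝓝 x] g1 := by
    filter_upwards [h1, k1] with y hy ky using hy.unique ky
  exact (this.hasDerivAt_iff.mp h2).unique k2

lemma unique_fst (h : HasJet f x a b c) (h' : HasJet f x a' b' c') : b = b' := by
  obtain ⟨_, f1, h1, rfl, h2⟩ := h
  obtain ⟨_, g1, k1, rfl, k2⟩ := h'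
  exact h1.self_of_nhds.unique k1.self_of_nhds

lemma hasDerivAt (h : HasJet f x a b c) : HasDerivAt f b x := by
  obtain ⟨_, f1, h1, rfl, h2⟩ := h
  exact h1.self_of_nhds

lemma congr (h : HasJet f x a b c) (hfg : f =ᶠ[𝓝 x] g) : HasJet g x a b c := by
  obtain ⟨h0, f1, h1, h2, h3⟩ := h
  refine ⟨by rw [← h0, hfg.self_of_nhds], f1, ?_, h2, h3⟩
  filter_upwards [h1, hfg.eventuallyEq_nhds] with y hy hy'
  exact hy'.hasDerivAt_iff.mp hy

lemma congr_vals (h : HasJet f x a b c) (ha : a = a') (hb : b = b') (hc : c = c') :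
    HasJet f x a' b' c' := by
  subst ha hb hc; exact h

lemma const (k x : ℝ) : HasJet (fun _ => k) x k 0 0 :=
  ⟨rfl, fun _ => 0, Filter.Eventually.of_forall fun y => hasDerivAt_const y k, rfl,
    hasDerivAt_const x 0⟩

lemma linear (k m x : ℝ) : HasJet (fun s => k + m * s) x (k + m * x) m 0 :=
  ⟨rfl, fun _ => m, Filter.Eventually.of_forall fun y => by
    simpa using ((hasDerivAt_id y).const_mul m).const_add k, rfl, hasDerivAt_const x m⟩

lemma add (h : HasJet f x a b c) (h' : HasJet g x a' b' c') :
    HasJet (fun s => f s + g s) x (a + a') (b + b') (c + c') := by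
  obtain ⟨h0, f1, h1, h2, h3⟩ := h
  obtain ⟨k0, g1, k1, k2, k3⟩ := h'
  refine ⟨by simp only [h0, k0], fun s => f1 s + g1 s, ?_, by simp only [h2, k2], h3.add k3⟩
  filter_upwards [h1, k1] with y hy ky using hy.add ky

lemma mul (h : HasJet f x a b c) (h' : HasJet g x a' b' c') :
    HasJet (fun s => f s * g s) x (a * a') (b * a' + a * b') (c * a' + 2 * b * b' + a * c') := by
  obtain ⟨h0, f1, h1, h2, h3⟩ := h
  obtain ⟨k0, g1, k1, k2, k3⟩ := h'
  have hf := h1.self_of_nhds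
  have hg := k1.self_of_nhds
  subst h0 k0 h2 k2
  refine ⟨rfl, fun s => f1 s * g s + f s * g1 s, ?_, rfl, ?_⟩
  · filter_upwards [h1, k1] with y hy ky using hy.mul ky
  · refine ((h3.mul hg).add (hf.mul k3)).congr_deriv ?_
    ring

lemma const_mul (k : ℝ) (h : HasJet f x a b c) :
    HasJet (fun s => k * f s) x (k * a) (k * b) (k * c) :=
  ((const k x).mul h).congr_vals rfl (by ring) (by ring)

lemma neg (h : HasJet f x a b c) : HasJet (fun s => - f s) x (-a) (-b) (-c) := by
  have := h.const_mul (-1)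
  simpa using this

lemma sub (h : HasJet f x a b c) (h' : HasJet g x a' b' c') :
    HasJet (fun s => f s - g s) x (a - a') (b - b') (c - c') := by
  simpa [sub_eq_add_neg] using h.add h'.neg

lemma comp {χ : ℝ → ℝ} {p q r : ℝ} (hχ : HasJet χ a p q r) (h : HasJet f x a b c) :
    HasJet (fun s => χ (f s)) x p (q * b) (r * b ^ 2 + q * c) := by
  obtain ⟨h0, f1, h1, h2, h3⟩ := h
  obtain ⟨k0, g1, k1, k2, k3⟩ := hχ
  have hf := h1.self_of_nhds
  subst h0 h2 k2
  refine ⟨k0, fun s => g1 (f s) * f1 s, ?_, rfl, ?_⟩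
  · filter_upwards [h1, hf.continuousAt.eventually k1] with y hy ky using ky.comp y hy
  · refine ((k3.comp x hf).mul h3).congr_deriv ?_
    simp only [Function.comp]
    ring

lemma exp (h : HasJet f x a b c) :
    HasJet (fun s => Real.exp (f s)) x (Real.exp a) (Real.exp a * b)
      (Real.exp a * b ^ 2 + Real.exp a * c) :=
  HasJet.comp ⟨rfl, Real.exp, Filter.Eventually.of_forall fun y => Real.hasDerivAt_exp y, rfl,
    Real.hasDerivAt_exp a⟩ h

lemma rpow (h : HasJet f x a b c) (ha : 0 < a) (p : ℝ) :
    HasJet (fun s => f s ^ p) x (a ^ p) (p * a ^ (p - 1) * b)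
      (p * (p - 1) * a ^ (p - 2) * b ^ 2 + p * a ^ (p - 1) * c) := by
  refine HasJet.comp (χ := fun y => y ^ p) ⟨rfl, fun y => p * y ^ (p - 1), ?_, rfl, ?_⟩ h
  · filter_upwards [lt_mem_nhds ha] with y hy
    exact Real.hasDerivAt_rpow_const (Or.inl hy.ne')
  · refine ((Real.hasDerivAt_rpow_const (p := p - 1) (Or.inl ha.ne')).const_mul p).congr_deriv ?_
    rw [show p - 1 - 1 = p - 2 by ring]; ring

lemma of_contDiffAt (h : ContDiffAt ℝ 2 f x) :
    HasJet f x (f x) (deriv f x) (deriv (deriv f) x) := by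
  refine ⟨rfl, deriv f, ?_, rfl, ?_⟩
  · filter_upwards [h.eventually (by simp)] with y hy
    exact (hy.differentiableAt (by simp)).hasDerivAt
  · have : ContDiffAt ℝ 1 (fun y => fderiv ℝ f y 1) x :=
      (h.fderiv_right (m := 1) (by norm_num)).clm_apply contDiffAt_const
    exact (this.differentiableAt (by simp)).hasDerivAt

lemma deriv_eq (h : HasJet f x a b c) : deriv f x = b := h.hasDerivAt.deriv

lemma deriv_deriv_eq (h : HasJet f x a b c) : deriv (deriv f) x = c := by
  obtain ⟨_, f1, h1, _, h2⟩ := h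
  have : deriv f =ᶠ[𝓝 x] f1 := by
    filter_upwards [h1] with y hy using hy.deriv
  rw [this.deriv_eq, h2.deriv]

lemma nonneg_of_isLocalMin (h : HasJet f x a b c) (hm : IsLocalMin f x) : 0 ≤ c := by
  by_contra! hc
  have hd : deriv f x = 0 := hm.deriv_eq_zero
  have hmax := isLocalMax_of_deriv_deriv_neg (by rw [h.deriv_deriv_eq]; exact hc) hd
    h.hasDerivAt.continuousAt
  have : (fun _ => f x) =ᶠ[𝓝 x] f := by
    filter_upwards [hm, hmax] with y h1 h2 using le_antisymm h1 h2
  have := ((const (f x) x).congr this).unique_snd h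
  linarith

end HasJet

section ComplexHessian

variable {E F : Type*} [NormedAddCommGroup E] [NormedSpace ℂ E]
  [NormedAddCommGroup F] [NormedSpace ℂ F]

/-- Four times the Levi form of `f` at `z` in the direction `X`. -/
def complexHessian (f : E → ℝ) (z X : E) : ℝ :=
  fderiv ℝ (fderiv ℝ f) z X X + fderiv ℝ (fderiv ℝ f) z (Complex.I • X) (Complex.I • X)

lemma fderiv_fderiv_apply {E G : Type*} [NormedAddCommGroup E] [NormedSpace ℝ E]
    [NormedAddCommGroup G] [NormedSpace ℝ G] {f : E → G} {p : E}
    (hf : ContDiffAt ℝ 2 f p) (v w : E) :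
    fderiv ℝ (fun x => fderiv ℝ f x w) p v = fderiv ℝ (fderiv ℝ f) p v w := by
  have h : DifferentiableAt ℝ (fderiv ℝ f) p :=
    (hf.fderiv_right (m := 1) (by norm_num)).differentiableAt (by simp)
  rw [fderiv_clm_apply h (differentiableAt_const w)]
  simp

lemma hasJet_line {E : Type*} [NormedAddCommGroup E] [NormedSpace ℝ E] {f : E → ℝ} {p : E}
    (hf : ContDiffAt ℝ 2 f p) (X : E) :
    HasJet (fun s : ℝ => f (p + s • X)) 0 (f p) (fderiv ℝ f p X)
      (fderiv ℝ (fderiv ℝ f) p X X) := by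
  have hline : ∀ s : ℝ, HasDerivAt (fun s : ℝ => p + s • X) X s := fun s => by
    simpa using ((hasDerivAt_id s).smul_const X).const_add p
  have hcont : Filter.Tendsto (fun s : ℝ => p + s • X) (𝓝 0) (𝓝 p) := by
    have := (hline 0).continuousAt.tendsto
    simpa using this
  refine ⟨by simp, fun s => fderiv ℝ f (p + s • X) X, ?_, by simp, ?_⟩
  · filter_upwards [hcont.eventually (hf.eventually (by simp))] with s hs
    exact (hs.differentiableAt (by simp)).hasFDerivAt.comp_hasDerivAt s (hline s)
  · have h2 : ContDiffAt ℝ 1 (fun x => fderiv ℝ f x X) p :=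
      (hf.fderiv_right (m := 1) (by norm_num)).clm_apply contDiffAt_const
    have h3 : HasFDerivAt (fun x => fderiv ℝ f x X) (fderiv ℝ (fun x => fderiv ℝ f x X) p)
        (p + (0 : ℝ) • X) := by
      simpa using (h2.differentiableAt (by simp)).hasFDerivAt
    have := h3.comp_hasDerivAt 0 (hline 0)
    rw [fderiv_fderiv_apply hf] at this
    exact this

lemma complexHessian_eq_of_hasJet {f : E → ℝ} {p X : E} {a b c a' b' c' : ℝ}
    (hf : ContDiffAt ℝ 2 f p) (h : HasJet (fun s : ℝ => f (p + s • X)) 0 a b c)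
    (h' : HasJet (fun s : ℝ => f (p + s • (Complex.I • X))) 0 a' b' c') :
    complexHessian f p X = c + c' := by
  rw [complexHessian, (hasJet_line hf X).unique_snd h, (hasJet_line hf _).unique_snd h']

lemma fderiv_comp_holomorphic {f : E → ℝ} {Φ : F → E} {p : F}
    (hΦ : DifferentiableAt ℂ Φ p) (hf : DifferentiableAt ℝ f (Φ p)) (Y : F) :
    fderiv ℝ (fun x => f (Φ x)) p Y = fderiv ℝ f (Φ p) (fderiv ℂ Φ p Y) := by
  have h1 : HasFDerivAt Φ ((fderiv ℂ Φ p).restrictScalars ℝ) p :=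
    hΦ.hasFDerivAt.restrictScalars ℝ
  have := (hf.hasFDerivAt.comp p h1).fderiv
  simp only [Function.comp_def] at this
  rw [this]; rfl

lemma complexHessian_comp_holomorphic {f : E → ℝ} {Φ : F → E} {p : F}
    (hΦ : ContDiffAt ℂ 2 Φ p) (hf : ContDiffAt ℝ 2 f (Φ p)) (Y : F) :
    complexHessian (fun x => f (Φ x)) p Y = complexHessian f (Φ p) (fderiv ℂ Φ p Y) := by
  have hΦr : ContDiffAt ℝ 2 Φ p := hΦ.restrict_scalars ℝ
  have hcomp : ContDiffAt ℝ 2 (fun x => f (Φ x)) p := hf.comp p hΦr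
  have hΨ : ∀ Y, DifferentiableAt ℂ (fun x => fderiv ℂ Φ x Y) p := fun Y =>
    ((hΦ.fderiv_right (m := 1) (by norm_num)).clm_apply contDiffAt_const).differentiableAt
      (by simp)
  have hdf : DifferentiableAt ℝ (fderiv ℝ f) (Φ p) :=
    (hf.fderiv_right (m := 1) (by norm_num)).differentiableAt (by simp)
  have key : ∀ Y, fderiv ℝ (fderiv ℝ (fun x => f (Φ x))) p Y Y =
      fderiv ℝ (fderiv ℝ f) (Φ p) (fderiv ℂ Φ p Y) (fderiv ℂ Φ p Y) +
      fderiv ℝ f (Φ p) (fderiv ℂ (fun x => fderiv ℂ Φ x Y) p Y) := by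
    intro Y
    rw [← fderiv_fderiv_apply hcomp]
    have hev : (fun x => fderiv ℝ (fun x => f (Φ x)) x Y) =ᶠ[𝓝 p]
        fun x => fderiv ℝ f (Φ x) (fderiv ℂ Φ x Y) := by
      filter_upwards [hΦ.eventually (by simp),
        hΦ.continuousAt.eventually (hf.eventually (by simp))] with x hx hx'
      exact fderiv_comp_holomorphic (hx.differentiableAt (by simp))
        (hx'.differentiableAt (by simp)) Y
    rw [hev.fderiv_eq]
    have h1 : HasFDerivAt Φ ((fderiv ℂ Φ p).restrictScalars ℝ) p :=
      (hΦ.differentiableAt (by simp)).hasFDerivAt.restrictScalars ℝ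
    have h2 : HasFDerivAt (fun x => fderiv ℂ Φ x Y)
        ((fderiv ℂ (fun x => fderiv ℂ Φ x Y) p).restrictScalars ℝ) p :=
      (hΨ Y).hasFDerivAt.restrictScalars ℝ
    have h3 := (hdf.hasFDerivAt.comp p h1).clm_apply h2
    simp only [Function.comp_def] at h3
    rw [h3.fderiv]
    simp [add_comm]
  have hI : fderiv ℂ (fun x => fderiv ℂ Φ x (Complex.I • Y)) p (Complex.I • Y) =
      - fderiv ℂ (fun x => fderiv ℂ Φ x Y) p Y := by
    have : (fun x => fderiv ℂ Φ x (Complex.I • Y)) = fun x => Complex.I • fderiv ℂ Φ x Y := by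
      funext x; simp
    rw [this, fderiv_fun_const_smul (hΨ Y)]
    simp [smul_smul]
  rw [complexHessian, complexHessian, key, key, hI, map_smul, map_neg]
  ring

lemma complexHessian_curve {f : E → ℝ} {γ : ℂ → E} {X : E} {a b c a' b' c' : ℝ}
    (hγ : ContDiffAt ℂ 2 γ 0) (hX : HasDerivAt γ X 0) (hf : ContDiffAt ℝ 2 f (γ 0))
    (h : HasJet (fun s : ℝ => f (γ s)) 0 a b c)
    (h' : HasJet (fun s : ℝ => f (γ (s * Complex.I))) 0 a' b' c') :
    complexHessian f (γ 0) X = c + c' ∧ fderiv ℝ f (γ 0) X = b ∧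
      fderiv ℝ f (γ 0) (Complex.I • X) = b' := by
  have hfd : fderiv ℂ γ 0 1 = X := by rw [fderiv_apply_one_eq_deriv, hX.deriv]
  have hfd' : fderiv ℂ γ 0 Complex.I = Complex.I • X := by
    rw [← hfd, ← map_smul]; simp
  have hcomp : ContDiffAt ℝ 2 (fun x => f (γ x)) 0 := hf.comp 0 (hγ.restrict_scalars ℝ)
  have h1 := hasJet_line hcomp 1
  have h2 := hasJet_line hcomp Complex.I
  simp only [zero_add, Complex.real_smul, mul_one] at h1 h2
  have hd := fun Y => fderiv_comp_holomorphic (p := 0) (hγ.differentiableAt (by simp))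
    (hf.differentiableAt (by simp)) Y
  refine ⟨?_, ?_, ?_⟩
  · rw [← hfd, ← complexHessian_comp_holomorphic hγ hf, complexHessian]
    simp only [smul_eq_mul, mul_one]
    rw [h1.unique_snd h, h2.unique_snd h']
  · rw [← hfd, ← hd, h1.unique_fst h]
  · rw [← hfd', ← hd, h2.unique_fst h']

end ComplexHessian

lemma fderiv_cplx {n : ℕ} {f : (Fin n → ℂ) → ℝ} {z : Fin n → ℂ}
    (hf : DifferentiableAt ℝ f z) (v : Fin n → ℂ) :
    fderiv ℝ (cplx f) z v = (fderiv ℝ f z v : ℂ) := by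
  have := (Complex.ofRealCLM.hasFDerivAt.comp z hf.hasFDerivAt).fderiv
  change fderiv ℝ (fun z => (f z : ℂ)) z v = _
  simp only [Function.comp_def, Complex.ofRealCLM_apply] at this
  rw [this]; rfl

lemma eq_sum_single {n : ℕ} (X : Fin n → ℂ) :
    X = ∑ j, ((X j).re • (Pi.single j 1 : Fin n → ℂ) + (X j).im • (Pi.single j Complex.I : Fin n → ℂ)) := by
  funext k
  simp only [Finset.sum_apply, Pi.add_apply, Pi.smul_apply, Pi.single_apply]
  rw [Finset.sum_eq_single k]
  · simp [Complex.re_add_im]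
  · intro b _ hb; simp [hb.symm]
  · simp

lemma I_smul_eq_sum_single {n : ℕ} (X : Fin n → ℂ) :
    Complex.I • X =
      ∑ j, (-(X j).im • (Pi.single j 1 : Fin n → ℂ) + (X j).re • (Pi.single j Complex.I : Fin n → ℂ)) := by
  rw [eq_sum_single (Complex.I • X)]
  simp

lemma dirDeriv_cplx {n : ℕ} {f : (Fin n → ℂ) → ℝ} {z : Fin n → ℂ}
    (hf : DifferentiableAt ℝ f z) (X : Fin n → ℂ) :
    dirDeriv X (cplx f) z =
      ((fderiv ℝ f z X : ℝ) - Complex.I * (fderiv ℝ f z (Complex.I • X) : ℝ)) / 2 := by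
  have h1 : fderiv ℝ f z X = ∑ j, ((X j).re * fderiv ℝ f z (Pi.single j 1) +
      (X j).im * fderiv ℝ f z (Pi.single j Complex.I)) := by
    conv_lhs => rw [eq_sum_single X]
    simp only [map_sum, map_add, map_smul, smul_eq_mul]
  rw [h1, I_smul_eq_sum_single X]
  simp only [dirDeriv, dz, fderiv_cplx hf, map_sum, map_add, map_smul, smul_eq_mul]
  push_cast
  rw [Finset.mul_sum, ← Finset.sum_sub_distrib, Finset.sum_div]
  refine Finset.sum_congr rfl fun j _ => ?_
  conv_lhs => rw [← Complex.re_add_im (X j)]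
  ring_nf
  simp only [Complex.I_sq]
  ring

lemma dirDeriv_cplx_eq_zero_iff {n : ℕ} {f : (Fin n → ℂ) → ℝ} {z : Fin n → ℂ}
    (hf : DifferentiableAt ℝ f z) (X : Fin n → ℂ) :
    dirDeriv X (cplx f) z = 0 ↔
      fderiv ℝ f z X = 0 ∧ fderiv ℝ f z (Complex.I • X) = 0 := by
  rw [dirDeriv_cplx hf, Complex.ext_iff]
  simp

lemma levi_re_eq {n : ℕ} {f : (Fin n → ℂ) → ℝ} {z : Fin n → ℂ} (hf : ContDiffAt ℝ 2 f z)
    (X : Fin n → ℂ) : (levi f X X z).re = complexHessian f z X / 4 := by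
  have hdf : ∀ v, DifferentiableAt ℝ (fun w => fderiv ℝ f w v) z := fun v =>
    ((hf.fderiv_right (m := 1) (by norm_num)).clm_apply contDiffAt_const).differentiableAt
      (by simp)
  have hdfc : ∀ v, HasFDerivAt (fun w => (fderiv ℝ f w v : ℂ))
      (Complex.ofRealCLM.comp (fderiv ℝ (fun w => fderiv ℝ f w v) z)) z := fun v =>
    Complex.ofRealCLM.hasFDerivAt.comp z (hdf v).hasFDerivAt
  have hbar : ∀ k, (fun w => dzbar k (cplx f) w) =ᶠ[𝓝 z] fun w =>
      ((fderiv ℝ f w (Pi.single k 1) : ℂ) + Complex.I * (fderiv ℝ f w (Pi.single k Complex.I) : ℂ))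
        * (1 / 2) := by
    intro k
    filter_upwards [hf.eventually (by simp)] with w hw
    simp only [dzbar, fderiv_cplx (hw.differentiableAt (by simp))]
    ring
  have hd : ∀ k v, fderiv ℝ (fun w => dzbar k (cplx f) w) z v =
      ((fderiv ℝ (fderiv ℝ f) z v (Pi.single k 1) : ℂ) +
        Complex.I * (fderiv ℝ (fderiv ℝ f) z v (Pi.single k Complex.I) : ℂ)) * (1 / 2) := by
    intro k v
    have h := (((hdfc (Pi.single k 1)).add
      ((hdfc (Pi.single k Complex.I)).const_mul Complex.I)).mul_const (1 / 2 : ℂ)).fderiv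
    simp only [Pi.add_apply] at h
    rw [(hbar k).fderiv_eq, h]
    simp [fderiv_fderiv_apply hf, mul_comm, mul_left_comm]
    ring
  rw [complexHessian, I_smul_eq_sum_single X]
  conv_rhs => enter [1, 1]; rw [eq_sum_single X]
  simp only [levi, dz, hd, map_sum, map_add, map_smul, smul_eq_mul, Complex.re_sum,
    _root_.sum_apply, _root_.add_apply, _root_.smul_apply]
  rw [← Finset.sum_add_distrib, Finset.sum_comm, Finset.sum_div]
  refine Finset.sum_congr rfl fun j _ => ?_
  simp only [Finset.mul_sum, ← Finset.sum_add_distrib, Finset.sum_div]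
  refine Finset.sum_congr rfl fun k _ => ?_
  simp
  ring

lemma supersolution_touching_false {M : ℂ → ℝ} {e q ε : ℝ} {ζ : ℂ} (he : e ≠ 0) (hq : 0 < q)
    (hε : 0 < ε) (hsm : ContDiffAt ℝ 2 M ζ) (hpos : 0 < M ζ)
    (hineq : e * (M ζ * complexHessian M ζ 1 +
      (e - 1) * (fderiv ℝ M ζ 1 ^ 2 + fderiv ℝ M ζ Complex.I ^ 2)) ≤ 0)
    (hmin : IsLocalMin (fun ξ => M ξ ^ e -
      q * (Real.cos (e * ξ.re) + ε) * Real.exp (-e * ξ.im)) ζ) : False := by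
  have hA := fun X : ℂ => (hasJet_line hsm X).rpow hpos e
  have h1 : HasJet (fun s : ℝ => e * ζ.re + e * s) 0 (e * ζ.re) e 0 :=
    (HasJet.linear (e * ζ.re) e 0).congr_vals (by ring) rfl rfl
  have h2 : HasJet Real.cos (e * ζ.re) (Real.cos (e * ζ.re)) (-Real.sin (e * ζ.re))
      (-Real.cos (e * ζ.re)) :=
    ⟨rfl, fun y => -Real.sin y, Filter.Eventually.of_forall Real.hasDerivAt_cos, rfl,
      (Real.hasDerivAt_sin _).neg⟩
  have h3 : HasJet (fun s : ℝ => -e * ζ.im + -e * s) 0 (-e * ζ.im) (-e) 0 :=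
    (HasJet.linear (-e * ζ.im) (-e) 0).congr_vals (by ring) rfl rfl
  have hcos := (((h2.comp h1).add (HasJet.const ε 0)).const_mul q).mul
    (HasJet.const (Real.exp (-e * ζ.im)) 0)
  have hexp := h3.exp.const_mul (q * (Real.cos (e * ζ.re) + ε))
  have hline : ∀ X : ℂ, IsLocalMin (fun s : ℝ => M (ζ + s • X) ^ e -
      q * (Real.cos (e * (ζ + s • X).re) + ε) * Real.exp (-e * (ζ + s • X).im)) 0 := by
    intro X
    have hc : Filter.Tendsto (fun s : ℝ => ζ + s • X) (𝓝 0) (𝓝 ζ) := by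
      have : Continuous (fun s : ℝ => ζ + s • X) := by fun_prop
      simpa using this.tendsto 0
    filter_upwards [hc.eventually hmin] with s hs
    simpa using hs
  have k1 := (((hA 1).sub hcos).congr (Filter.Eventually.of_forall fun s => by
    simp [mul_add])).nonneg_of_isLocalMin (hline 1)
  have k2 := (((hA Complex.I).sub hexp).congr (Filter.Eventually.of_forall fun s => by
    simp [mul_add])).nonneg_of_isLocalMin (hline Complex.I)
  have hM : M ζ ^ (e - 1) = M ζ ^ (e - 2) * M ζ := by
    rw [← Real.rpow_add_one hpos.ne']; ring_nf
  have hM2 : 0 < M ζ ^ (e - 2) := Real.rpow_pos_of_pos hpos _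
  have hE : 0 < Real.exp (-e * ζ.im) := Real.exp_pos _
  rw [hM] at k1 k2
  rw [complexHessian, smul_eq_mul, mul_one] at hineq
  have hneg := mul_nonpos_of_nonneg_of_nonpos hM2.le hineq
  have hlast : 0 < q * ε * e ^ 2 * Real.exp (-e * ζ.im) := by positivity
  linarith

lemma no_supersolution_on_strip {M : ℂ → ℝ} {e c : ℝ} (he : e ≠ 0)
    (hc : Real.pi / (2 * |e|) ≤ c)
    (hsm : ∀ ζ : ℂ, |ζ.re| ≤ c → ContDiffAt ℝ 2 M ζ) (hpos : ∀ ζ : ℂ, |ζ.re| ≤ c → 0 < M ζ)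
    (hper : ∀ ζ : ℂ, |ζ.re| ≤ c → Real.exp (ζ + (4 * Real.pi : ℝ) * Complex.I).im *
      M (ζ + (4 * Real.pi : ℝ) * Complex.I) = Real.exp ζ.im * M ζ)
    (hineq : ∀ ζ : ℂ, |ζ.re| < c → e * (M ζ * complexHessian M ζ 1 +
      (e - 1) * (fderiv ℝ M ζ 1 ^ 2 + fderiv ℝ M ζ Complex.I ^ 2)) ≤ 0) : False := by
  have he' : 0 < |e| := abs_pos.mpr he
  set l := Real.pi / (2 * |e|) with hl
  have hl0 : 0 < l := by positivity
  have hel : |e| * l = Real.pi / 2 := by rw [hl]; field_simp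
  set α : ℂ → ℝ := fun ζ => (Real.exp ζ.im * M ζ) ^ e with hα
  have hαpos : ∀ ζ : ℂ, |ζ.re| ≤ c → 0 < α ζ := fun ζ h =>
    Real.rpow_pos_of_pos (mul_pos (Real.exp_pos _) (hpos ζ h)) _
  have hαc : ∀ ζ : ℂ, |ζ.re| ≤ c → ContinuousAt α ζ := by
    intro ζ h
    refine ContinuousAt.rpow_const ?_ (Or.inl (mul_pos (Real.exp_pos _) (hpos ζ h)).ne')
    exact (by fun_prop : ContinuousAt (fun ζ : ℂ => Real.exp ζ.im) ζ).mul (hsm ζ h).continuousAt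
  set K : Set ℂ := (Set.Icc (-l) l) ×ℂ (Set.Icc 0 (8 * Real.pi)) with hK
  have hKc : IsCompact K := isCompact_Icc.reProdIm isCompact_Icc
  have hmemK : ∀ ζ : ℂ, ζ ∈ K ↔ |ζ.re| ≤ l ∧ 0 ≤ ζ.im ∧ ζ.im ≤ 8 * Real.pi := by
    intro ζ; simp [hK, Complex.mem_reProdIm, abs_le]
  have hKc' : ∀ ζ ∈ K, |ζ.re| ≤ c := fun ζ h => ((hmemK ζ).mp h).1.trans hc
  have h0K : (0 : ℂ) ∈ K := by
    rw [hmemK]; simp only [Complex.zero_re, abs_zero, Complex.zero_im]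
    exact ⟨hl0.le, le_rfl, by positivity⟩
  obtain ⟨ζ₀, hζ₀, hmin₀⟩ := hKc.exists_isMinOn ⟨0, h0K⟩
    (fun ζ h => (hαc ζ (hKc' ζ h)).continuousWithinAt)
  set m := α ζ₀
  have hm : 0 < m := hαpos _ (hKc' _ hζ₀)
  have hA0 : 0 < α 0 := hαpos _ (hKc' _ h0K)
  set ε := m / (2 * α 0) with hε
  have hε0 : 0 < ε := by positivity
  have hcosnn : ∀ ζ : ℂ, |ζ.re| ≤ l → 0 ≤ Real.cos (e * ζ.re) := by
    intro ζ h
    have : |e * ζ.re| ≤ Real.pi / 2 := by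
      rw [abs_mul, ← hel]; gcongr
    exact Real.cos_nonneg_of_mem_Icc (abs_le.mp this)
  set τ : ℂ → ℝ := fun ζ => Real.cos (e * ζ.re) + ε with hτ
  have hτpos : ∀ ζ : ℂ, |ζ.re| ≤ l → 0 < τ ζ := fun ζ h => by
    have := hcosnn ζ h; simp only [hτ]; linarith
  have hτc : Continuous τ := by fun_prop
  obtain ⟨ζ₁, hζ₁, hmin₁⟩ := hKc.exists_isMinOn (f := fun ζ => α ζ / τ ζ) ⟨0, h0K⟩
    (fun ζ h => ((hαc ζ (hKc' ζ h)).div hτc.continuousAt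
      (hτpos ζ ((hmemK ζ).mp h).1).ne').continuousWithinAt)
  have hre : |ζ₁.re| < l := by
    refine lt_of_le_of_ne ((hmemK ζ₁).mp hζ₁).1 fun h => ?_
    have hcos0 : Real.cos (e * ζ₁.re) = 0 := by
      rw [← Real.cos_abs, abs_mul, h, hel, Real.cos_pi_div_two]
    have h1 : α ζ₁ / τ ζ₁ ≤ α 0 / τ 0 := hmin₁ h0K
    have h2 : τ ζ₁ = ε := by simp [hτ, hcos0]
    have h3 : τ 0 = 1 + ε := by simp [hτ]
    have h4 : m ≤ α ζ₁ := hmin₀ hζ₁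
    rw [h2, h3, div_le_div_iff₀ hε0 (by positivity)] at h1
    have h5 : α 0 * ε = m / 2 := by rw [hε]; field_simp
    nlinarith
  have hperα : ∀ ζ : ℂ, |ζ.re| ≤ c → α (ζ + (4 * Real.pi : ℝ) * Complex.I) = α ζ :=
    fun ζ h => by simp only [hα]; rw [hper ζ h]
  have hperτ : ∀ ζ : ℂ, τ (ζ + (4 * Real.pi : ℝ) * Complex.I) = τ ζ := fun ζ => by
    simp only [hτ]; simp
  obtain ⟨ζ₂, hre₂, him₂, him₂', hmin₂⟩ : ∃ ζ₂ : ℂ, |ζ₂.re| < l ∧ 0 < ζ₂.im ∧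
      ζ₂.im < 8 * Real.pi ∧ ∀ ζ ∈ K, α ζ₂ / τ ζ₂ ≤ α ζ / τ ζ := by
    have hpi := Real.pi_pos
    obtain ⟨-, h1, h2⟩ := (hmemK ζ₁).mp hζ₁
    rcases h1.lt_or_eq with h1 | h1
    · rcases h2.lt_or_eq with h2 | h2
      · exact ⟨ζ₁, hre, h1, h2, fun ζ h => hmin₁ h⟩
      · have hr : |(ζ₁ - (4 * Real.pi : ℝ) * Complex.I).re| < l := by simpa using hre
        refine ⟨ζ₁ - (4 * Real.pi : ℝ) * Complex.I, hr, ?_, ?_, fun ζ h => ?_⟩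
        · simp [h2]; linarith
        · simp [h2, hpi]
        · have e1 := hperα (ζ₁ - (4 * Real.pi : ℝ) * Complex.I) (hr.le.trans hc)
          have e2 := hperτ (ζ₁ - (4 * Real.pi : ℝ) * Complex.I)
          rw [sub_add_cancel] at e1 e2
          rw [← e1, ← e2]; exact hmin₁ h
    · refine ⟨ζ₁ + (4 * Real.pi : ℝ) * Complex.I, by simpa using hre, ?_, ?_, fun ζ h => ?_⟩
      · simp [← h1, hpi]
      · simp [← h1]; linarith
      · rw [hperα _ (hKc' _ hζ₁), hperτ]; exact hmin₁ h
  have hK₂ : K ∈ 𝓝 ζ₂ := by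
    have hopen : IsOpen {ζ : ℂ | |ζ.re| < l ∧ 0 < ζ.im ∧ ζ.im < 8 * Real.pi} := by
      exact (isOpen_lt (continuous_abs.comp Complex.continuous_re) continuous_const).inter
        ((isOpen_lt continuous_const Complex.continuous_im).inter
          (isOpen_lt Complex.continuous_im continuous_const))
    filter_upwards [hopen.mem_nhds ⟨hre₂, him₂, him₂'⟩] with ζ h
    exact (hmemK ζ).mpr ⟨h.1.le, h.2.1.le, h.2.2.le⟩
  have hq : 0 < α ζ₂ / τ ζ₂ := div_pos (hαpos _ (hre₂.le.trans hc)) (hτpos _ hre₂.le)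
  have hαM : ∀ ζ : ℂ, |ζ.re| ≤ c → M ζ ^ e = α ζ * Real.exp (-e * ζ.im) := by
    intro ζ h
    simp only [hα]
    rw [Real.mul_rpow (Real.exp_pos _).le (hpos ζ h).le, ← Real.exp_mul, mul_right_comm,
      ← Real.exp_add]
    ring_nf; simp
  refine supersolution_touching_false he hq hε0 (hsm ζ₂ (hre₂.le.trans hc))
    (hpos ζ₂ (hre₂.le.trans hc)) (hineq ζ₂ (hre₂.trans_le hc)) ?_
  filter_upwards [hK₂] with ζ h
  have h1 := hmin₂ ζ h
  have hζl := ((hmemK ζ).mp h).1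
  rw [hαM _ (hre₂.le.trans hc), hαM _ (hζl.trans hc)]
  have h2 : α ζ₂ / τ ζ₂ * τ ζ₂ = α ζ₂ := div_mul_cancel₀ _ (hτpos _ hre₂.le).ne'
  have h3 : α ζ₂ / τ ζ₂ * τ ζ ≤ α ζ := by
    rwa [← le_div_iff₀ (hτpos _ hζl)]
  change α ζ₂ * _ - α ζ₂ / τ ζ₂ * τ ζ₂ * _ ≤ _ - α ζ₂ / τ ζ₂ * τ ζ * _
  rw [h2, sub_self, ← sub_mul]
  exact mul_nonneg (by linarith) (Real.exp_pos _).le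

lemma complexHessian_rpow {E : Type*} [NormedAddCommGroup E] [NormedSpace ℂ E] {f : E → ℝ} {p : E}
    (hf : ContDiffAt ℝ 2 f p) (hp : 0 < f p) (η : ℝ) (X : E) :
    complexHessian (fun x => f x ^ η) p X = η * f p ^ (η - 2) *
      (f p * complexHessian f p X +
        (η - 1) * (fderiv ℝ f p X ^ 2 + fderiv ℝ f p (Complex.I • X) ^ 2)) := by
  have hη : ContDiffAt ℝ 2 (fun x => f x ^ η) p := hf.rpow_const_of_ne hp.ne'
  rw [complexHessian_eq_of_hasJet hη ((hasJet_line hf X).rpow hp η)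
    ((hasJet_line hf (Complex.I • X)).rpow hp η), complexHessian]
  have : f p ^ (η - 1) = f p ^ (η - 2) * f p := by
    rw [← Real.rpow_add_one hp.ne']; ring_nf
  rw [this]; ring

lemma complexHessian_neg {E : Type*} [NormedAddCommGroup E] [NormedSpace ℂ E] {f : E → ℝ} {p : E}
    (hf : ContDiffAt ℝ 2 f p) (X : E) :
    complexHessian (fun x => - f x) p X = - complexHessian f p X := by
  rw [complexHessian_eq_of_hasJet hf.neg (hasJet_line hf X).neg
    (hasJet_line hf (Complex.I • X)).neg, complexHessian]
  ring

lemma hasDerivAt_mul_of_continuousAt {h : ℝ → ℝ} (hh : ContinuousAt h 0) :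
    HasDerivAt (fun δ => δ * h δ) (h 0) 0 := by
  rw [hasDerivAt_iff_tendsto_slope_zero]
  refine (hh.tendsto.mono_left nhdsWithin_le_nhds).congr' ?_
  filter_upwards [self_mem_nhdsWithin] with t ht
  have : t ≠ 0 := ht
  simp; field_simp

section NormalExpansion

variable {R : ℂ × ℂ → ℝ} {ζ : ℂ}

lemma hasDerivAt_normal_fderiv (hR : ContDiffAt ℝ 2 R (0, ζ)) (v : ℂ) :
    HasDerivAt (fun δ : ℝ => fderiv ℝ R (δ, ζ) (0, v))
      (fderiv ℝ (fun ξ : ℂ => fderiv ℝ R (0, ξ) (1, 0)) ζ v) 0 := by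
  have hsymm : fderiv ℝ (fderiv ℝ R) (0, ζ) (1, 0) (0, v) =
      fderiv ℝ (fderiv ℝ R) (0, ζ) (0, v) (1, 0) :=
    (hR.isSymmSndFDerivAt (by simp)).eq _ _
  have hd : ∀ w, DifferentiableAt ℝ (fun x => fderiv ℝ R x w) (0, ζ) := fun w =>
    ((hR.fderiv_right (m := 1) (by norm_num)).clm_apply contDiffAt_const).differentiableAt
      (by simp)
  have h1 : HasFDerivAt (fun ξ : ℂ => ((0 : ℂ), ξ)) (ContinuousLinearMap.inr ℝ ℂ ℂ) ζ :=
    (ContinuousLinearMap.inr ℝ ℂ ℂ).hasFDerivAt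
  have h2 := ((hd (1, 0)).hasFDerivAt.comp ζ h1).fderiv
  have h3 : HasDerivAt (fun δ : ℝ => ((δ : ℂ), ζ)) (1, 0) 0 :=
    (Complex.ofRealCLM.hasDerivAt (x := 0)).prodMk (hasDerivAt_const _ _)
  simp only [Function.comp_def] at h2
  rw [h2]
  have h4 := HasFDerivAt.comp_hasDerivAt_of_eq (0 : ℝ) (hd (0, v)).hasFDerivAt h3 (by simp)
  refine h4.congr_deriv ?_
  change fderiv ℝ (fun x => fderiv ℝ R x (0, v)) (0, ζ) (1, 0) =
    fderiv ℝ (fun x => fderiv ℝ R x (1, 0)) (0, ζ) (0, v)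
  rw [fderiv_fderiv_apply hR, fderiv_fderiv_apply hR, hsymm]

lemma hasDerivAt_normal_snd (hR : ContDiffAt ℝ 3 R (0, ζ)) (v : ℂ) :
    HasDerivAt (fun δ : ℝ => fderiv ℝ (fderiv ℝ R) (δ, ζ) (0, v) (0, v))
      (fderiv ℝ (fderiv ℝ (fun ξ : ℂ => fderiv ℝ R (0, ξ) (1, 0))) ζ v v) 0 := by
  have hR2 : ∀ᶠ q in 𝓝 ((0 : ℂ), ζ), ContDiffAt ℝ 2 R q := 
    (hR.of_le (by norm_num)).eventually (by simp)
  have hg : ∀ w, ContDiffAt ℝ 2 (fun x => fderiv ℝ R x w) (0, ζ) := fun w =>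
    (hR.fderiv_right (m := 2) (by norm_num)).clm_apply contDiffAt_const
  have hcont : ContinuousAt (fun δ : ℝ => ((δ : ℂ), ζ)) 0 := by fun_prop
  have h0 : (fun δ : ℝ => fderiv ℝ (fderiv ℝ R) (δ, ζ) (0, v) (0, v)) =ᶠ[𝓝 0]
      fun δ : ℝ => fderiv ℝ (fun x => fderiv ℝ R x (0, v)) (δ, ζ) (0, v) := by
    filter_upwards [hcont.eventually (by simpa using hR2)] with δ h
    rw [fderiv_fderiv_apply h]
  refine HasDerivAt.congr_of_eventuallyEq ?_ h0
  refine (hasDerivAt_normal_fderiv (hg (0, v)) v).congr_deriv ?_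
  have hc2 : ContinuousAt (fun ξ : ℂ => ((0 : ℂ), ξ)) ζ := by fun_prop
  have h1 : (fun ξ : ℂ => fderiv ℝ (fun x => fderiv ℝ R x (0, v)) (0, ξ) (1, 0)) =ᶠ[𝓝 ζ]
      fun ξ : ℂ => fderiv ℝ (fun ξ : ℂ => fderiv ℝ R (0, ξ) (1, 0)) ξ v := by
    filter_upwards [hc2.eventually hR2] with ξ h
    rw [← (hasDerivAt_normal_fderiv h v).deriv]
    symm
    have hd : DifferentiableAt ℝ (fun x => fderiv ℝ R x (0, v)) (0, ξ) :=
      ((h.fderiv_right (m := 1) (by norm_num)).clm_apply contDiffAt_const).differentiableAt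
        (by simp)
    have h3 : HasDerivAt (fun δ : ℝ => ((δ : ℂ), ξ)) (1, 0) 0 :=
      (Complex.ofRealCLM.hasDerivAt (x := 0)).prodMk (hasDerivAt_const _ _)
    exact (HasFDerivAt.comp_hasDerivAt_of_eq (0 : ℝ) hd.hasFDerivAt h3 (by simp)).deriv
  rw [h1.fderiv_eq, fderiv_fderiv_apply]
  exact (hg (1, 0)).comp ζ (g := fun x => fderiv ℝ R x (1, 0)) (f := fun ξ : ℂ => ((0 : ℂ), ξ))
    (by fun_prop)

lemma normal_expansion (hR : ContDiffAt ℝ 3 R (0, ζ)) (h0 : ∀ᶠ ξ in 𝓝 ζ, R (0, ξ) = 0)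
    (hM : ∀ᶠ ξ in 𝓝 ζ, ∀ u : ℂ, fderiv ℝ R (0, ξ) (u, 0) = fderiv ℝ R (0, ξ) (1, 0) * u.re)
    {u : ℝ → ℂ} (hu : ContinuousAt u 0) (v : ℂ) :
    fderiv ℝ R (0, ζ) (0, v) = 0 ∧ fderiv ℝ (fderiv ℝ R) (0, ζ) (0, v) (0, v) = 0 ∧
    HasDerivAt (fun δ : ℝ => fderiv ℝ R (δ, ζ) (δ * u δ, v))
      (fderiv ℝ (fun ξ : ℂ => fderiv ℝ R (0, ξ) (1, 0)) ζ v +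
        fderiv ℝ R (0, ζ) (1, 0) * (u 0).re) 0 ∧
    HasDerivAt (fun δ : ℝ => fderiv ℝ (fderiv ℝ R) (δ, ζ) (δ * u δ, v) (δ * u δ, v))
      (fderiv ℝ (fderiv ℝ (fun ξ : ℂ => fderiv ℝ R (0, ξ) (1, 0))) ζ v v +
        2 * ((u 0).re * fderiv ℝ (fun ξ : ℂ => fderiv ℝ R (0, ξ) (1, 0)) ζ v)) 0 := by
  have hR2 : ContDiffAt ℝ 2 R (0, ζ) := hR.of_le (by norm_num)
  have hjet : HasJet (fun s : ℝ => R ((0, ζ) + s • ((0 : ℂ), v))) 0 0 0 0 := by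
    refine (HasJet.const 0 0).congr ?_
    have hc : Filter.Tendsto (fun s : ℝ => ζ + s • v) (𝓝 0) (𝓝 ζ) := by
      have : Continuous (fun s : ℝ => ζ + s • v) := by fun_prop
      simpa using this.tendsto 0
    filter_upwards [hc.eventually h0] with s hs
    simpa using hs.symm
  have e1 := (hasJet_line hR2 (0, v)).unique_fst hjet
  have e2 := (hasJet_line hR2 (0, v)).unique_snd hjet
  have hsplit : ∀ δ : ℝ, (((δ : ℂ) * u δ, v) : ℂ × ℂ) = (0, v) + δ • (u δ, 0) := fun δ => by
    simp
  have hline : ContinuousAt (fun δ : ℝ => ((δ : ℂ), ζ)) 0 := by fun_prop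
  have hul : ContinuousAt (fun δ : ℝ => (u δ, (0 : ℂ))) 0 := hu.prodMk continuousAt_const
  have c1 : ContinuousAt (fun δ : ℝ => fderiv ℝ R (δ, ζ)) 0 :=
    ContinuousAt.comp_of_eq (hR2.fderiv_right (m := 1) (by norm_num)).continuousAt hline (by simp)
  have c2 : ContinuousAt (fun δ : ℝ => fderiv ℝ (fderiv ℝ R) (δ, ζ)) 0 :=
    ContinuousAt.comp_of_eq ((hR2.fderiv_right (m := 1) (by norm_num)).fderiv_right (m := 0)
      (by norm_num)).continuousAt hline (by simp)
  have hsymm := (hR2.isSymmSndFDerivAt (by simp)).eq (u 0, 0) (0, v)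
  refine ⟨e1, e2, ?_, ?_⟩
  · have h := (hasDerivAt_normal_fderiv hR2 v).add
      (hasDerivAt_mul_of_continuousAt (c1.clm_apply hul))
    simp only [Complex.ofReal_zero] at h
    rw [hM.self_of_nhds (u 0)] at h
    refine h.congr_of_eventuallyEq (Filter.Eventually.of_forall fun δ => ?_)
    simp only [hsplit, map_add, map_smul, smul_eq_mul]
    rfl
  · have hmix : fderiv ℝ (fderiv ℝ R) (0, ζ) (0, v) (u 0, 0) =
        (u 0).re * fderiv ℝ (fun ξ : ℂ => fderiv ℝ R (0, ξ) (1, 0)) ζ v := by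
      rw [← fderiv_fderiv_apply hR2]
      have hd : DifferentiableAt ℝ (fun x => fderiv ℝ R x (u 0, 0)) (0, ζ) :=
        ((hR2.fderiv_right (m := 1) (by norm_num)).clm_apply contDiffAt_const).differentiableAt
          (by simp)
      have hd1 : DifferentiableAt ℝ (fun x => fderiv ℝ R x (1, 0)) (0, ζ) :=
        ((hR2.fderiv_right (m := 1) (by norm_num)).clm_apply contDiffAt_const).differentiableAt
          (by simp)
      have hi : HasFDerivAt (fun ξ : ℂ => ((0 : ℂ), ξ)) (ContinuousLinearMap.inr ℝ ℂ ℂ) ζ :=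
        (ContinuousLinearMap.inr ℝ ℂ ℂ).hasFDerivAt
      have k1 := (hd.hasFDerivAt.comp ζ hi)
      have k2 := (hd1.hasFDerivAt.comp ζ hi).mul_const (u 0).re
      have k3 := k2.congr_of_eventuallyEq (f₁ := (fun x => fderiv ℝ R x (u 0, 0)) ∘
        (fun ξ : ℂ => ((0 : ℂ), ξ))) (by
          filter_upwards [hM] with ξ h using h (u 0))
      have k4 := congrArg (fun L => L v) (k1.unique k3)
      have k5 := (hd1.hasFDerivAt.comp ζ hi).fderiv
      simp only [Function.comp_def] at k5
      rw [k5]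
      simpa using k4
    have h := (hasDerivAt_normal_snd hR v).add
      (hasDerivAt_mul_of_continuousAt
        (((c2.clm_apply (continuousAt_const (y := ((0 : ℂ), v)))).clm_apply hul).add
        (((c2.clm_apply hul).clm_apply (continuousAt_const (y := ((0 : ℂ), v)))).add
          (continuousAt_id.mul ((c2.clm_apply hul).clm_apply hul)))))
    refine (h.congr_of_eventuallyEq (Filter.Eventually.of_forall fun δ => ?_)).congr_deriv ?_
    · simp only [hsplit, map_add, map_smul, smul_eq_mul, add_apply,
        smul_apply, Pi.add_apply, Pi.mul_apply, id]
      ring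
    · simp only [Pi.add_apply, Pi.mul_apply, id, Complex.ofReal_zero, zero_mul, add_zero]
      rw [hsymm, hmix]; ring

end NormalExpansion

section NormalLimit

variable {R : ℂ × ℂ → ℝ} {ζ : ℂ}

lemma hasDerivAt_normal (hR : ContDiffAt ℝ 3 R (0, ζ)) :
    HasDerivAt (fun δ : ℝ => R (δ, ζ)) (fderiv ℝ R (0, ζ) (1, 0)) 0 := by
  have h3 : HasDerivAt (fun δ : ℝ => ((δ : ℂ), ζ)) (1, 0) 0 :=
    (Complex.ofRealCLM.hasDerivAt (x := 0)).prodMk (hasDerivAt_const _ _)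
  exact HasFDerivAt.comp_hasDerivAt_of_eq (0 : ℝ)
    (hR.differentiableAt (by norm_num)).hasFDerivAt h3 (by simp)

lemma hasDerivAt_normal_complexHessian (hR : ContDiffAt ℝ 3 R (0, ζ))
    (h0 : ∀ᶠ ξ in 𝓝 ζ, R (0, ξ) = 0)
    (hM : ∀ᶠ ξ in 𝓝 ζ, ∀ u : ℂ, fderiv ℝ R (0, ξ) (u, 0) = fderiv ℝ R (0, ξ) (1, 0) * u.re)
    {κ : ℝ → ℂ} (hκ : ContinuousAt κ 0) :
    complexHessian R (0, ζ) (0, 1) = 0 ∧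
    HasDerivAt (fun δ : ℝ => fderiv ℝ R (δ, ζ) (δ * κ δ, 1))
      (fderiv ℝ (fun ξ : ℂ => fderiv ℝ R (0, ξ) (1, 0)) ζ 1 +
        fderiv ℝ R (0, ζ) (1, 0) * (κ 0).re) 0 ∧
    HasDerivAt (fun δ : ℝ => fderiv ℝ R (δ, ζ) (Complex.I • ((δ : ℂ) * κ δ, (1 : ℂ))))
      (fderiv ℝ (fun ξ : ℂ => fderiv ℝ R (0, ξ) (1, 0)) ζ Complex.I -
        fderiv ℝ R (0, ζ) (1, 0) * (κ 0).im) 0 ∧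
    HasDerivAt (fun δ : ℝ => complexHessian R (δ, ζ) (δ * κ δ, 1))
      (complexHessian (fun ξ : ℂ => fderiv ℝ R (0, ξ) (1, 0)) ζ 1 +
        2 * ((κ 0).re * fderiv ℝ (fun ξ : ℂ => fderiv ℝ R (0, ξ) (1, 0)) ζ 1 -
          (κ 0).im * fderiv ℝ (fun ξ : ℂ => fderiv ℝ R (0, ξ) (1, 0)) ζ Complex.I)) 0 := by
  have hκI : ContinuousAt (fun δ => Complex.I * κ δ) 0 := continuousAt_const.mul hκ
  obtain ⟨-, a2, a3, a4⟩ := normal_expansion hR h0 hM hκ 1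
  obtain ⟨-, b2, b3, b4⟩ := normal_expansion hR h0 hM hκI Complex.I
  have hI : ∀ δ : ℝ, Complex.I • ((δ : ℂ) * κ δ, (1 : ℂ)) =
      ((δ : ℂ) * (Complex.I * κ δ), Complex.I) := fun δ => by
    simp [Prod.ext_iff]; ring
  refine ⟨?_, a3, ?_, ?_⟩
  · simp only [complexHessian, Prod.smul_mk, smul_eq_mul, mul_zero, mul_one, a2, b2, add_zero]
  · simp only [hI]
    refine b3.congr_deriv ?_
    simp; ring
  · simp only [complexHessian, hI, smul_eq_mul, mul_one]
    refine (a4.add b4).congr_deriv ?_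
    simp; ring

lemma tendsto_normal_quotient (hR : ContDiffAt ℝ 3 R (0, ζ)) (h0 : ∀ᶠ ξ in 𝓝 ζ, R (0, ξ) = 0)
    (hM : ∀ᶠ ξ in 𝓝 ζ, ∀ u : ℂ, fderiv ℝ R (0, ξ) (u, 0) = fderiv ℝ R (0, ξ) (1, 0) * u.re)
    (hpos : 0 < fderiv ℝ R (0, ζ) (1, 0)) {η : ℝ} (hη : η ≠ 1) :
    ∃ X : ℝ → ℂ × ℂ, Filter.Tendsto (fun δ : ℝ => (δ ^ 2)⁻¹ *
      (R (δ, ζ) * complexHessian R (δ, ζ) (X δ) + (η - 1) *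
        (fderiv ℝ R (δ, ζ) (X δ) ^ 2 + fderiv ℝ R (δ, ζ) (Complex.I • X δ) ^ 2))) (𝓝[≠] 0)
      (𝓝 (fderiv ℝ R (0, ζ) (1, 0) *
        complexHessian (fun ξ : ℂ => fderiv ℝ R (0, ξ) (1, 0)) ζ 1 + (η / (1 - η) - 1) *
        (fderiv ℝ (fun ξ : ℂ => fderiv ℝ R (0, ξ) (1, 0)) ζ 1 ^ 2 +
        fderiv ℝ (fun ξ : ℂ => fderiv ℝ R (0, ξ) (1, 0)) ζ Complex.I ^ 2))) := by
  set M : ℂ → ℝ := fun ξ => fderiv ℝ R (0, ξ) (1, 0) with hMdef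
  have hMζ : fderiv ℝ R (0, ζ) (1, 0) = M ζ := rfl
  set κ : ℂ := ⟨η * fderiv ℝ M ζ 1 / ((1 - η) * M ζ), -(η * fderiv ℝ M ζ Complex.I / ((1 - η) * M ζ))⟩
  obtain ⟨z3, a1, a2, a3⟩ := hasDerivAt_normal_complexHessian hR h0 hM
    (continuousAt_const (y := κ))
  obtain ⟨z1, -⟩ := normal_expansion hR h0 hM (continuousAt_const (y := κ)) 1
  obtain ⟨z2, -⟩ := normal_expansion hR h0 hM (continuousAt_const (y := κ)) Complex.I
  refine ⟨fun δ => (δ * κ, 1), ?_⟩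
  have t0 := hasDerivAt_iff_tendsto_slope_zero.mp (hasDerivAt_normal hR)
  have t1 := hasDerivAt_iff_tendsto_slope_zero.mp a1
  have t2 := hasDerivAt_iff_tendsto_slope_zero.mp a2
  have t3 := hasDerivAt_iff_tendsto_slope_zero.mp a3
  simp only [zero_add, Complex.ofReal_zero, zero_mul, h0.self_of_nhds, sub_zero, z3, z1, z2,
    Prod.smul_mk, smul_eq_mul, mul_zero, mul_one] at t0 t1 t2 t3
  have ht := (t0.mul t3).add (((t1.pow 2).add (t2.pow 2)).const_mul (η - 1))
  rw [hMζ] at ht hpos ⊢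
  have h1η : 1 - η ≠ 0 := sub_ne_zero.mpr hη.symm
  convert ht.congr' ?_ using 2
  · simp only [κ]
    field_simp
    ring
  · filter_upwards [self_mem_nhdsWithin] with δ hδ
    have : δ ≠ 0 := hδ
    simp only [Prod.smul_mk, smul_eq_mul, mul_one]
    field_simp

lemma normal_limit_tangential (hR : ContDiffAt ℝ 3 R (0, ζ)) (h0 : ∀ᶠ ξ in 𝓝 ζ, R (0, ξ) = 0)
    (hM : ∀ᶠ ξ in 𝓝 ζ, ∀ u : ℂ, fderiv ℝ R (0, ξ) (u, 0) = fderiv ℝ R (0, ξ) (1, 0) * u.re)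
    (hpos : 0 < fderiv ℝ R (0, ζ) (1, 0))
    (hpsh : ∀ᶠ δ : ℝ in 𝓝[<] 0, ∀ X : ℂ × ℂ, fderiv ℝ R (δ, ζ) X = 0 →
      fderiv ℝ R (δ, ζ) (Complex.I • X) = 0 → complexHessian R (δ, ζ) X ≤ 0) :
    0 ≤ fderiv ℝ R (0, ζ) (1, 0) *
        complexHessian (fun ξ : ℂ => fderiv ℝ R (0, ξ) (1, 0)) ζ 1 - 2 *
        (fderiv ℝ (fun ξ : ℂ => fderiv ℝ R (0, ξ) (1, 0)) ζ 1 ^ 2 +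
        fderiv ℝ (fun ξ : ℂ => fderiv ℝ R (0, ξ) (1, 0)) ζ Complex.I ^ 2) := by
  have hR2 : ContDiffAt ℝ 2 R (0, ζ) := hR.of_le (by norm_num)
  set M : ℂ → ℝ := fun ξ => fderiv ℝ R (0, ξ) (1, 0) with hMdef
  have hMζ : fderiv ℝ R (0, ζ) (1, 0) = M ζ := rfl
  have hline : ContinuousAt (fun δ : ℝ => ((δ : ℂ), ζ)) 0 := by fun_prop
  have c1 : ContinuousAt (fun δ : ℝ => fderiv ℝ R (δ, ζ)) 0 :=
    ContinuousAt.comp_of_eq (hR2.fderiv_right (m := 1) (by norm_num)).continuousAt hline (by simp)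
  have cx := c1.clm_apply (continuousAt_const (y := ((1 : ℂ), (0 : ℂ))))
  have cy := c1.clm_apply (continuousAt_const (y := (Complex.I, (0 : ℂ))))
  have da := hasDerivAt_normal_fderiv hR2 1
  have db := hasDerivAt_normal_fderiv hR2 Complex.I
  have ca := continuousAt_dslope_same.mpr da.differentiableAt
  have cb := continuousAt_dslope_same.mpr db.differentiableAt
  set a := dslope (fun δ : ℝ => fderiv ℝ R (δ, ζ) (0, 1)) 0 with ha
  set b := dslope (fun δ : ℝ => fderiv ℝ R (δ, ζ) (0, Complex.I)) 0 with hb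
  set p := fun δ : ℝ => fderiv ℝ R (δ, ζ) (1, 0) with hp
  set q := fun δ : ℝ => fderiv ℝ R (δ, ζ) (Complex.I, 0) with hq
  have hp0 : p 0 = M ζ := by simp [hp, hMdef]
  have hq0 : q 0 = 0 := by simp [hq, hM.self_of_nhds Complex.I]
  have ha0 : a 0 = fderiv ℝ M ζ 1 := by rw [ha, dslope_same, da.deriv]
  have hb0 : b 0 = fderiv ℝ M ζ Complex.I := by rw [hb, dslope_same, db.deriv]
  have hD : ∀ᶠ δ in 𝓝 0, 0 < p δ ^ 2 + q δ ^ 2 := by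
    refine ((cx.pow 2).add (cy.pow 2)).eventually (lt_mem_nhds ?_)
    change 0 < p 0 ^ 2 + q 0 ^ 2
    rw [hp0]; rw [hMζ] at hpos; positivity
  set κr : ℝ → ℝ := fun δ => -(a δ * p δ + b δ * q δ) / (p δ ^ 2 + q δ ^ 2)
  set κi : ℝ → ℝ := fun δ => (b δ * p δ - a δ * q δ) / (p δ ^ 2 + q δ ^ 2)
  have hκr : ContinuousAt κr 0 := ((ca.mul cx).add (cb.mul cy)).neg.div
    ((cx.pow 2).add (cy.pow 2)) hD.self_of_nhds.ne'
  have hκi : ContinuousAt κi 0 := ((cb.mul cx).sub (ca.mul cy)).div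
    ((cx.pow 2).add (cy.pow 2)) hD.self_of_nhds.ne'
  set κ : ℝ → ℂ := fun δ => (κr δ : ℂ) + κi δ * Complex.I
  have hκ : ContinuousAt κ 0 :=
    (Complex.continuous_ofReal.continuousAt.comp hκr).add
      ((Complex.continuous_ofReal.continuousAt.comp hκi).mul continuousAt_const)
  obtain ⟨z3, -, -, a3⟩ := hasDerivAt_normal_complexHessian hR h0 hM hκ
  obtain ⟨z1, -⟩ := normal_expansion hR h0 hM hκ 1
  obtain ⟨z2, -⟩ := normal_expansion hR h0 hM hκ Complex.I
  have ea : ∀ δ : ℝ, fderiv ℝ R (δ, ζ) (0, 1) = δ * a δ := fun δ => by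
    have := sub_smul_dslope (fun δ : ℝ => fderiv ℝ R (δ, ζ) (0, 1)) 0 δ
    simpa [z1] using this.symm
  have eb : ∀ δ : ℝ, fderiv ℝ R (δ, ζ) (0, Complex.I) = δ * b δ := fun δ => by
    have := sub_smul_dslope (fun δ : ℝ => fderiv ℝ R (δ, ζ) (0, Complex.I)) 0 δ
    simpa [z2] using this.symm
  have hlim := hasDerivAt_iff_tendsto_slope_zero.mp a3
  have hfin := ge_of_tendsto (hlim.mono_left (nhdsLT_le_nhdsNE 0))
    (b := 0) (by
      filter_upwards [hpsh, nhdsWithin_le_nhds hD, self_mem_nhdsWithin] with δ h1 h2 h3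
      have h3 : δ < 0 := h3
      have k := h1 (δ * κ δ, 1) ?_ ?_
      · simp only [zero_add, Complex.ofReal_zero, zero_mul, z3, sub_zero, smul_eq_mul]
        exact mul_nonneg_of_nonpos_of_nonpos (inv_neg''.mpr h3).le k
      · have : (((δ : ℂ) * κ δ, 1) : ℂ × ℂ) = (δ * κr δ) • ((1 : ℂ), (0 : ℂ)) +
            (δ * κi δ) • (Complex.I, (0 : ℂ)) + (0, 1) := by
          simp [κ]; ring
        rw [this, map_add, map_add, map_smul, map_smul, ea]
        change δ * κr δ * p δ + δ * κi δ * q δ + _ = 0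
        simp only [κr, κi]
        field_simp; ring
      · have : Complex.I • (((δ : ℂ) * κ δ, 1) : ℂ × ℂ) = -(δ * κi δ) • ((1 : ℂ), (0 : ℂ)) +
            (δ * κr δ) • (Complex.I, (0 : ℂ)) + (0, Complex.I) := by
          simp [κ]; ring_nf; simp; ring
        rw [this, map_add, map_add, map_smul, map_smul, eb]
        change -(δ * κi δ) * p δ + δ * κr δ * q δ + _ = 0
        simp only [κr, κi]
        field_simp; ring)
  have hMne : M ζ ≠ 0 := hpos.ne'
  have hr0 : (κ 0).re = - fderiv ℝ M ζ 1 / M ζ := by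
    have : (κ 0).re = κr 0 := by simp [κ]
    rw [this]; simp only [κr, hp0, hq0, ha0, hb0]; field_simp; ring_nf
  have hi0 : (κ 0).im = fderiv ℝ M ζ Complex.I / M ζ := by
    have : (κ 0).im = κi 0 := by simp [κ]
    rw [this]; simp only [κi, hp0, hq0, ha0, hb0]; field_simp; ring_nf
  rw [hr0, hi0] at hfin
  rw [hMζ] at hpos ⊢
  have := mul_nonneg hpos.le hfin
  refine this.trans_eq ?_
  field_simp
  ring

end NormalLimit

namespace IsWormFunction

variable {φ : ℝ → ℝ} {β : ℝ}

lemma eq_zero_iff (hφ : IsWormFunction φ β) (t : ℝ) : φ t = 0 ↔ |t| ≤ β - Real.pi / 2 := by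
  rw [abs_le, ← Set.mem_Icc, ← hφ.zeroSet]; rfl

lemma exists_abs_le (hφ : IsWormFunction φ β) : ∃ a > 0, ∀ t, φ t ≤ 1 → |t| ≤ a := by
  obtain ⟨a, ha, h⟩ := hφ.large
  exact ⟨a, ha, fun t ht => not_lt.mp fun h' => absurd (h t h') ht.not_gt⟩

end IsWormFunction

lemma wormRho_expand (φ : ℝ → ℝ) (p : Fin 2 → ℂ) :
    wormRho φ p = Complex.normSq (p 0) -
      2 * (p 0 * Complex.exp (-(Complex.I * (Real.log (Complex.normSq (p 1)) : ℂ)))).re +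
      φ (Real.log (Complex.normSq (p 1))) := by
  rw [wormRho]
  generalize Real.log (Complex.normSq (p 1)) = t
  rw [Complex.normSq_sub, ← Complex.exp_conj]
  have h : Complex.normSq (Complex.exp (Complex.I * t)) = 1 := by
    rw [Complex.normSq_eq_norm_sq, Complex.norm_exp]; simp
  rw [h]
  simp only [map_mul, Complex.conj_I, Complex.conj_ofReal, neg_mul]
  ring

lemma log_normSq_mul_exp {w : ℂ} (hw : w ≠ 0) (ζ : ℂ) :
    Real.log (Complex.normSq (w * Complex.exp (ζ / 2))) = Real.log (Complex.normSq w) + ζ.re := by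
  rw [map_mul, Real.log_mul (by simpa using hw) (by simp), Complex.normSq_eq_norm_sq (Complex.exp _),
    Complex.norm_exp, ← Real.exp_nat_mul, Real.log_exp]
  simp
  ring

lemma wormRho_exp (φ : ℝ → ℝ) {w : ℂ} (hw : w ≠ 0) (z ζ : ℂ) :
    wormRho φ ![z * Complex.exp (Complex.I * Real.log (Complex.normSq w)) *
        Complex.exp (Complex.I * ζ), w * Complex.exp (ζ / 2)] =
      Complex.normSq z * Real.exp (-2 * ζ.im) - 2 * z.re * Real.exp (-ζ.im) +
        φ (Real.log (Complex.normSq w) + ζ.re) := by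
  rw [wormRho_expand]
  simp only [Matrix.cons_val_zero, Matrix.cons_val_one]
  rw [log_normSq_mul_exp hw]
  generalize Real.log (Complex.normSq w) = L
  have h1 : z * Complex.exp (Complex.I * L) * Complex.exp (Complex.I * ζ) *
      Complex.exp (-(Complex.I * ((L + ζ.re : ℝ) : ℂ))) = z * ((Real.exp (-ζ.im) : ℝ) : ℂ) := by
    rw [mul_assoc, mul_assoc, ← Complex.exp_add, ← Complex.exp_add, Complex.ofReal_exp]
    congr 2
    conv_lhs => rw [← Complex.re_add_im ζ]
    push_cast
    ring_nf
    rw [Complex.I_sq]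
    simp
  rw [h1, map_mul, map_mul, Complex.normSq_eq_norm_sq (Complex.exp _), Complex.norm_exp,
    Complex.normSq_eq_norm_sq (Complex.exp _), Complex.norm_exp]
  simp only [Complex.mul_re, Complex.I_re, Complex.I_im, Complex.ofReal_re, Complex.ofReal_im]
  rw [← Real.exp_nat_mul, ← Real.exp_nat_mul]
  simp
  ring

lemma contDiffAt_log_normSq {p : Fin 2 → ℂ} (hp : p 1 ≠ 0) :
    ContDiffAt ℝ (⊤ : ℕ∞) (fun p : Fin 2 → ℂ => Real.log (Complex.normSq (p 1))) p := by
  refine ContDiffAt.log ?_ (by simpa using hp)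
  simp only [Complex.normSq_apply]
  have h1 : ContDiffAt ℝ (⊤ : ℕ∞) (fun p : Fin 2 → ℂ => (p 1).re) p :=
    Complex.reCLM.contDiff.contDiffAt.comp p (contDiff_apply ℝ ℂ (1 : Fin 2)).contDiffAt
  have h2 : ContDiffAt ℝ (⊤ : ℕ∞) (fun p : Fin 2 → ℂ => (p 1).im) p :=
    Complex.imCLM.contDiff.contDiffAt.comp p (contDiff_apply ℝ ℂ (1 : Fin 2)).contDiffAt
  exact (h1.mul h1).add (h2.mul h2)

lemma contDiffAt_normSq {E : Type*} [NormedAddCommGroup E] [NormedSpace ℝ E] {f : E → ℂ} {p : E}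
    {n : WithTop ℕ∞} (hf : ContDiffAt ℝ n f p) :
    ContDiffAt ℝ n (fun x => Complex.normSq (f x)) p := by
  simp only [Complex.normSq_apply]
  have h1 : ContDiffAt ℝ n (fun x => (f x).re) p := Complex.reCLM.contDiff.contDiffAt.comp p hf
  have h2 : ContDiffAt ℝ n (fun x => (f x).im) p := Complex.imCLM.contDiff.contDiffAt.comp p hf
  exact (h1.mul h1).add (h2.mul h2)

lemma contDiffAt_wormRho {φ : ℝ → ℝ} (hφ : ContDiff ℝ (⊤ : ℕ∞) φ) {p : Fin 2 → ℂ}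
    (hp : p 1 ≠ 0) : ContDiffAt ℝ (⊤ : ℕ∞) (wormRho φ) p := by
  have h0 := contDiffAt_log_normSq hp
  have h1 : ContDiffAt ℝ (⊤ : ℕ∞)
      (fun p : Fin 2 → ℂ => (Real.log (Complex.normSq (p 1)) : ℂ)) p :=
    Complex.ofRealCLM.contDiff.contDiffAt.comp p h0
  have h2 : ContDiffAt ℝ (⊤ : ℕ∞) (fun p : Fin 2 → ℂ => p 0) p :=
    (contDiff_apply ℝ ℂ (0 : Fin 2)).contDiffAt
  exact (contDiffAt_normSq (h2.sub (contDiffAt_const.mul h1).cexp)).sub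
    (contDiffAt_const.sub (hφ.contDiffAt.comp p h0))

section WormDomain

variable {φ : ℝ → ℝ} {β : ℝ}

lemma isOpen_snd_ne_zero : IsOpen {p : Fin 2 → ℂ | p 1 ≠ 0} :=
  isOpen_ne_fun (continuous_apply 1) continuous_const

lemma continuousOn_wormRho (hφ : IsWormFunction φ β) :
    ContinuousOn (wormRho φ) {p : Fin 2 → ℂ | p 1 ≠ 0} := fun _ hp =>
  (contDiffAt_wormRho hφ.smooth hp).continuousAt.continuousWithinAt

lemma isOpen_wormDomain (hφ : IsWormFunction φ β) : IsOpen (wormDomain φ) :=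
  (continuousOn_wormRho hφ).isOpen_inter_preimage isOpen_snd_ne_zero isOpen_Iio

lemma phi_lt_one_of_wormRho_neg {p : Fin 2 → ℂ} (h : wormRho φ p < 0) :
    φ (Real.log (Complex.normSq (p 1))) < 1 := by
  rw [wormRho] at h
  have := Complex.normSq_nonneg
    (p 0 - Complex.exp (Complex.I * (Real.log (Complex.normSq (p 1)) : ℂ)))
  linarith

/-- A compact set containing the closure of the worm domain on which `w` does not vanish. -/
lemma exists_closed_superset (hφ : IsWormFunction φ β) : ∃ a > 0,
    ∀ p ∈ closure (wormDomain φ), p 1 ≠ 0 ∧ wormRho φ p ≤ 0 ∧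
      |Real.log (Complex.normSq (p 1))| ≤ a := by
  obtain ⟨a, ha, h⟩ := hφ.exists_abs_le
  refine ⟨a, ha, ?_⟩
  set K : Set (Fin 2 → ℂ) := {p | Real.exp (-a) ≤ Complex.normSq (p 1) ∧
    Complex.normSq (p 1) ≤ Real.exp a}
  have hc : Continuous fun p : Fin 2 → ℂ => Complex.normSq (p 1) :=
    Complex.continuous_normSq.comp (continuous_apply 1)
  have hK : IsClosed K := (isClosed_le continuous_const hc).inter (isClosed_le hc continuous_const)
  have hK0 : ∀ p ∈ K, p 1 ≠ 0 := fun p hp h0 => by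
    have := hp.1
    rw [h0, map_zero] at this
    exact absurd this (Real.exp_pos _).not_ge
  have hK2 : IsClosed (K ∩ wormRho φ ⁻¹' Set.Iic 0) :=
    ((continuousOn_wormRho hφ).mono hK0).preimage_isClosed_of_isClosed hK isClosed_Iic
  have hsub : wormDomain φ ⊆ K ∩ wormRho φ ⁻¹' Set.Iic 0 := fun p hp => by
    have hp0 : 0 < Complex.normSq (p 1) := Complex.normSq_pos.mpr hp.1
    have ht := abs_le.mp (h _ (phi_lt_one_of_wormRho_neg hp.2).le)
    exact ⟨⟨(Real.le_log_iff_exp_le hp0).mp ht.1, (Real.log_le_iff_le_exp hp0).mp ht.2⟩, hp.2.le⟩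
  intro p hp
  obtain ⟨h1, h2⟩ := hK2.closure_subset_iff.mpr hsub hp
  have hp0 : 0 < Complex.normSq (p 1) := Complex.normSq_pos.mpr (hK0 p h1)
  exact ⟨hK0 p h1, h2, abs_le.mpr ⟨(Real.le_log_iff_exp_le hp0).mpr h1.1,
    (Real.log_le_iff_le_exp hp0).mpr h1.2⟩⟩

lemma frontier_wormDomain_subset (hφ : IsWormFunction φ β) {p : Fin 2 → ℂ}
    (hp : p ∈ frontier (wormDomain φ)) : p 1 ≠ 0 ∧ wormRho φ p = 0 := by
  obtain ⟨a, -, h⟩ := exists_closed_superset hφ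
  obtain ⟨h1, h2, -⟩ := h p (frontier_subset_closure hp)
  refine ⟨h1, h2.antisymm (not_lt.mp fun h3 => ?_)⟩
  rw [(isOpen_wormDomain hφ).frontier_eq] at hp
  exact hp.2 ⟨h1, h3⟩

/-- Coordinates on the worm domain in which `log |w|² = Re ζ` along the core annulus. -/
def wormMap (q : ℂ × ℂ) : Fin 2 → ℂ := ![q.1 * Complex.exp (Complex.I * q.2), Complex.exp (q.2 / 2)]

lemma wormRho_wormMap (φ : ℝ → ℝ) (q : ℂ × ℂ) :
    wormRho φ (wormMap q) = Complex.normSq q.1 * Real.exp (-2 * q.2.im) -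
      2 * q.1.re * Real.exp (-q.2.im) + φ q.2.re := by
  simpa [wormMap] using wormRho_exp φ one_ne_zero q.1 q.2

lemma wormMap_snd_ne_zero (q : ℂ × ℂ) : wormMap q 1 ≠ 0 := Complex.exp_ne_zero _

lemma contDiff_wormMap : ContDiff ℂ (⊤ : ℕ∞) wormMap := by
  rw [contDiff_pi]
  intro i
  fin_cases i
  · exact contDiff_fst.mul (contDiff_const.mul contDiff_snd).cexp
  · exact (contDiff_snd.div_const 2).cexp

lemma surjective_fderiv_wormMap (ζ : ℂ) : Function.Surjective (fderiv ℂ wormMap (0, ζ)) := by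
  intro X
  have hd : HasFDerivAt wormMap (fderiv ℂ wormMap (0, ζ)) (0, ζ) :=
    ((contDiff_wormMap.contDiffAt).differentiableAt (by simp)).hasFDerivAt
  rw [hasFDerivAt_pi'] at hd
  have h0 := (hd 0).unique
    (((hasFDerivAt_fst (𝕜 := ℂ) (p := ((0 : ℂ), ζ))).mul
      ((hasFDerivAt_snd (𝕜 := ℂ) (p := ((0 : ℂ), ζ))).const_mul Complex.I).cexp))
  have h1 := (hd 1).unique
    (((hasFDerivAt_snd (𝕜 := ℂ) (p := ((0 : ℂ), ζ))).mul_const (2⁻¹ : ℂ)).cexp)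
  refine ⟨(X 0 * (Complex.exp (Complex.I * ζ))⁻¹, 2 * (X 1 * (Complex.exp (ζ * 2⁻¹))⁻¹)), ?_⟩
  funext i
  fin_cases i
  · have := congrArg (fun L => L (X 0 * (Complex.exp (Complex.I * ζ))⁻¹,
      2 * (X 1 * (Complex.exp (ζ * 2⁻¹))⁻¹))) h0
    simp at this
    simp [this]
    field_simp
  · have := congrArg (fun L => L (X 0 * (Complex.exp (Complex.I * ζ))⁻¹,
      2 * (X 1 * (Complex.exp (ζ * 2⁻¹))⁻¹))) h1
    simp at this
    simp [this]
    field_simp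

end WormDomain

lemma two_le_smooth : (2 : WithTop ℕ∞) ≤ ((⊤ : ℕ∞) : WithTop ℕ∞) :=
  WithTop.coe_le_coe.mpr (le_top : (2 : ℕ∞) ≤ ⊤)

lemma three_le_smooth : (3 : WithTop ℕ∞) ≤ ((⊤ : ℕ∞) : WithTop ℕ∞) :=
  WithTop.coe_le_coe.mpr (le_top : (3 : ℕ∞) ≤ ⊤)

section Necessity

variable {φ : ℝ → ℝ} {β : ℝ} {V : Set (Fin 2 → ℂ)} {r : (Fin 2 → ℂ) → ℝ}

lemma IsDefFn.contDiffAt {n : ℕ} {Ω V : Set (Fin n → ℂ)} {r : (Fin n → ℂ) → ℝ}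
    (h : IsDefFn Ω V r) {p : Fin n → ℂ} (hp : p ∈ V) : ContDiffAt ℝ (⊤ : ℕ∞) r p :=
  h.smooth.contDiffAt (h.isOpen.mem_nhds hp)

lemma IsDefFn.eq_zero_of_mem_frontier {n : ℕ} {Ω V : Set (Fin n → ℂ)} {r : (Fin n → ℂ) → ℝ}
    (h : IsDefFn Ω V r) (hΩ : IsOpen Ω) {p : Fin n → ℂ} (hp : p ∈ frontier Ω) : r p = 0 := by
  have hV : p ∈ V := h.subset (frontier_subset_closure hp)
  refine le_antisymm ?_ (not_lt.mp fun hr => ?_)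
  · have hc : ContinuousWithinAt r Ω p := (h.contDiffAt hV).continuousAt.continuousWithinAt
    have := mem_closure_iff_nhdsWithin_neBot.mp (frontier_subset_closure hp)
    refine le_of_tendsto hc.tendsto ?_
    filter_upwards [self_mem_nhdsWithin] with x hx
    rw [h.eq] at hx
    exact hx.2.le
  · rw [hΩ.frontier_eq] at hp
    refine hp.2 ?_
    rw [h.eq]
    exact ⟨hV, hr⟩

lemma wormMap_mem_wormDomain (hφ : IsWormFunction φ β) {ζ : ℂ} (hζ : |ζ.re| ≤ β - Real.pi / 2)
    {ξ : ℂ} (hξ : 0 < ξ.re) :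
    ∀ᶠ s : ℝ in 𝓝[>] 0, wormMap (s • ξ, ζ) ∈ wormDomain φ := by
  have hc : ContinuousAt (fun s : ℝ => s * Complex.normSq ξ * Real.exp (-2 * ζ.im)) 0 := by
    fun_prop
  have := hc.tendsto.eventually_lt_const (u := 2 * ξ.re * Real.exp (-ζ.im)) (by simp; positivity)
  filter_upwards [nhdsWithin_le_nhds this, self_mem_nhdsWithin] with s hs hs0
  have hs0 : 0 < s := hs0
  refine ⟨wormMap_snd_ne_zero _, ?_⟩
  rw [wormRho_wormMap, (hφ.eq_zero_iff _).mpr hζ]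
  have := mul_lt_mul_of_pos_left hs hs0
  simp
  ring_nf at this ⊢
  linarith

lemma wormMap_zero_mem_frontier (hφ : IsWormFunction φ β) {ζ : ℂ}
    (hζ : |ζ.re| ≤ β - Real.pi / 2) : wormMap (0, ζ) ∈ frontier (wormDomain φ) := by
  rw [(isOpen_wormDomain hφ).frontier_eq]
  refine ⟨?_, fun h => ?_⟩
  · have hc : Filter.Tendsto (fun s : ℝ => wormMap (s • (1 : ℂ), ζ)) (𝓝[>] 0)
        (𝓝 (wormMap (0, ζ))) := by
      have : ContinuousAt (fun s : ℝ => wormMap (s • (1 : ℂ), ζ)) 0 :=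
        contDiff_wormMap.continuous.continuousAt.comp (by fun_prop)
      simpa using this.tendsto.mono_left nhdsWithin_le_nhds
    exact mem_closure_of_tendsto hc (wormMap_mem_wormDomain hφ hζ (by simp))
  · have := h.2
    rw [wormRho_wormMap, (hφ.eq_zero_iff _).mpr hζ] at this
    simp at this

lemma wormMap_notMem_closure (hφ : IsWormFunction φ β) {ζ : ℂ} {δ : ℝ} (hδ : δ < 0) :
    wormMap (δ, ζ) ∉ closure (wormDomain φ) := fun h => by
  obtain ⟨a, -, ha⟩ := exists_closed_superset hφ
  have := (ha _ h).2.1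
  rw [wormRho_wormMap] at this
  have h1 := hφ.nonneg ζ.re
  have h2 := mul_pos (neg_pos.mpr hδ) (Real.exp_pos (-ζ.im))
  have h3 := mul_nonneg (Complex.normSq_nonneg δ) (Real.exp_pos (-2 * ζ.im)).le
  simp only [Complex.ofReal_re] at this
  linarith

/-- The sign-reversed pullback of a defining function under `wormMap`. -/
def wormPullback (r : (Fin 2 → ℂ) → ℝ) (q : ℂ × ℂ) : ℝ := - r (wormMap q)

/-- The normal derivative of the pullback along the core annulus. -/
def normalDeriv (r : (Fin 2 → ℂ) → ℝ) (ζ : ℂ) : ℝ := fderiv ℝ (wormPullback r) (0, ζ) (1, 0)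

lemma contDiffAt_wormMap (q : ℂ × ℂ) : ContDiffAt ℝ (⊤ : ℕ∞) wormMap q :=
  (contDiff_wormMap.restrict_scalars ℝ).contDiffAt

lemma contDiffAt_wormPullback {q : ℂ × ℂ} (h : ContDiffAt ℝ (⊤ : ℕ∞) r (wormMap q)) :
    ContDiffAt ℝ (⊤ : ℕ∞) (wormPullback r) q :=
  (h.comp q (contDiffAt_wormMap q)).neg

lemma wormMap_mem (hφ : IsWormFunction φ β) (hr : IsDefFn (wormDomain φ) V r) {ζ : ℂ}
    (hζ : |ζ.re| ≤ β - Real.pi / 2) : wormMap (0, ζ) ∈ V :=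
  hr.subset (frontier_subset_closure (wormMap_zero_mem_frontier hφ hζ))

lemma contDiffAt_wormPullback_core (hφ : IsWormFunction φ β) (hr : IsDefFn (wormDomain φ) V r)
    {ζ : ℂ} (hζ : |ζ.re| ≤ β - Real.pi / 2) :
    ContDiffAt ℝ (⊤ : ℕ∞) (wormPullback r) (0, ζ) :=
  contDiffAt_wormPullback (hr.contDiffAt (wormMap_mem hφ hr hζ))

lemma wormPullback_core (hφ : IsWormFunction φ β) (hr : IsDefFn (wormDomain φ) V r)
    {ζ : ℂ} (hζ : |ζ.re| ≤ β - Real.pi / 2) : wormPullback r (0, ζ) = 0 := by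
  rw [wormPullback, hr.eq_zero_of_mem_frontier (isOpen_wormDomain hφ)
    (wormMap_zero_mem_frontier hφ hζ), neg_zero]

lemma fderiv_wormPullback_nonneg (hφ : IsWormFunction φ β) (hr : IsDefFn (wormDomain φ) V r)
    {ζ : ℂ} (hζ : |ζ.re| ≤ β - Real.pi / 2) {ξ : ℂ} (hξ : 0 < ξ.re) :
    0 ≤ fderiv ℝ (wormPullback r) (0, ζ) (ξ, 0) := by
  have hd := (contDiffAt_wormPullback_core hφ hr hζ).differentiableAt (by simp)
  have h := (hasJet_line ((contDiffAt_wormPullback_core hφ hr hζ).of_le two_le_smooth) (ξ, 0)).hasDerivAt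
  rw [hasDerivAt_iff_tendsto_slope_zero] at h
  refine ge_of_tendsto (h.mono_left (nhdsGT_le_nhdsNE 0)) ?_
  filter_upwards [wormMap_mem_wormDomain hφ hζ hξ, self_mem_nhdsWithin] with s hs hs0
  rw [hr.eq] at hs
  have h1 : wormPullback r ((0, ζ) + s • (ξ, 0)) = - r (wormMap (s • ξ, ζ)) := by
    simp [wormPullback]
  simp only [zero_add, zero_smul, add_zero]
  rw [h1, wormPullback_core hφ hr hζ]
  have hs0 : 0 < s := hs0
  have := hs.2
  simp only [sub_zero, smul_eq_mul]
  exact mul_nonneg (inv_pos.mpr hs0).le (by linarith)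

lemma fderiv_wormPullback_normal (hφ : IsWormFunction φ β) (hr : IsDefFn (wormDomain φ) V r)
    {ζ : ℂ} (hζ : |ζ.re| ≤ β - Real.pi / 2) (u : ℂ) :
    fderiv ℝ (wormPullback r) (0, ζ) (u, 0) = normalDeriv r ζ * u.re := by
  set L := fderiv ℝ (wormPullback r) (0, ζ) with hL
  have hsplit : ∀ u : ℂ, L (u, 0) = u.re * L (1, 0) + u.im * L (Complex.I, 0) := fun u => by
    have : (u, (0 : ℂ)) = u.re • ((1 : ℂ), (0 : ℂ)) + u.im • (Complex.I, (0 : ℂ)) := by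
      simp [Complex.re_add_im]
    rw [this, map_add, map_smul, map_smul]; rfl
  have hI : L (Complex.I, 0) = 0 := by
    by_contra hne
    have key : ∀ y : ℝ, 0 ≤ L (1, 0) + y * L (Complex.I, 0) := fun y => by
      have := fderiv_wormPullback_nonneg hφ hr hζ (ξ := ⟨1, y⟩) (by simp)
      rw [← hL, hsplit] at this
      simpa using this
    have := key (-(L (1, 0) + 1) / L (Complex.I, 0))
    rw [div_mul_cancel₀ _ hne] at this
    linarith
  rw [hsplit, hI, normalDeriv, ← hL]; ring

lemma fderiv_wormPullback_tangential (hφ : IsWormFunction φ β) (hβ : Real.pi / 2 < β)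
    (hr : IsDefFn (wormDomain φ) V r) {ζ : ℂ} (hζ : |ζ.re| ≤ β - Real.pi / 2) (v : ℂ) :
    fderiv ℝ (wormPullback r) (0, ζ) (0, v) = 0 := by
  have hint : ∀ ζ : ℂ, |ζ.re| < β - Real.pi / 2 →
      fderiv ℝ (wormPullback r) (0, ζ) (0, v) = 0 := by
    intro ζ h
    refine (hasJet_line ((contDiffAt_wormPullback_core hφ hr h.le).of_le two_le_smooth) (0, v)).unique_fst ((HasJet.const 0 0).congr ?_)
    have hc : ContinuousAt (fun s : ℝ => |(ζ + s • v).re|) 0 :=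
      (continuous_abs.comp (Complex.continuous_re.comp (by fun_prop))).continuousAt
    filter_upwards [hc.tendsto.eventually_lt_const (u := β - Real.pi / 2) (by simpa using h)]
      with s hs
    simpa using (wormPullback_core hφ hr hs.le).symm
  have hcont : ContinuousAt (fun s : ℝ => fderiv ℝ (wormPullback r) (0, s • ζ) (0, v)) 1 := by
    have h1 : ContinuousAt (fun q => fderiv ℝ (wormPullback r) q) (0, ζ) :=
      ((contDiffAt_wormPullback_core hφ hr hζ).fderiv_right (m := 0) (by
        exact_mod_cast le_top)).continuousAt
    refine ContinuousAt.clm_apply (ContinuousAt.comp_of_eq h1 (by fun_prop) (by simp))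
      continuousAt_const
  have h2 := hcont.tendsto.mono_left (nhdsWithin_le_nhds (s := Set.Iio 1))
  rw [one_smul] at h2
  refine tendsto_nhds_unique h2 (tendsto_const_nhds.congr' ?_)
  have h0 : ∀ᶠ s : ℝ in 𝓝[<] 1, 0 < s := nhdsWithin_le_nhds (lt_mem_nhds one_pos)
  filter_upwards [h0, self_mem_nhdsWithin] with s hs hs1
  have hs1 : s < 1 := hs1
  refine (hint _ ?_).symm
  rw [Complex.smul_re, smul_eq_mul, abs_mul, abs_of_pos hs]
  have : 0 < β - Real.pi / 2 := by linarith
  nlinarith [abs_nonneg ζ.re]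

lemma normalDeriv_pos (hφ : IsWormFunction φ β) (hβ : Real.pi / 2 < β)
    (hr : IsDefFn (wormDomain φ) V r) {ζ : ℂ} (hζ : |ζ.re| ≤ β - Real.pi / 2) :
    0 < normalDeriv r ζ := by
  refine lt_of_le_of_ne (fderiv_wormPullback_nonneg hφ hr hζ (by simp)) fun h0 => ?_
  refine hr.grad_ne _ (wormMap_zero_mem_frontier hφ hζ) ?_
  have hd : DifferentiableAt ℝ (fun x => - r x) (wormMap (0, ζ)) :=
    ((hr.contDiffAt (wormMap_mem hφ hr hζ)).differentiableAt (by simp)).neg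
  ext X
  obtain ⟨Y, rfl⟩ := surjective_fderiv_wormMap ζ X
  have h1 := fderiv_comp_holomorphic (contDiff_wormMap.contDiffAt.differentiableAt (by simp)) hd Y
  have h2 : fderiv ℝ (wormPullback r) (0, ζ) Y = 0 := by
    have : Y = (Y.1, 0) + (0, Y.2) := by simp
    rw [this, map_add, fderiv_wormPullback_normal hφ hr hζ,
      fderiv_wormPullback_tangential hφ hβ hr hζ, ← h0]
    simp
  have h3 := h1.symm.trans h2
  rw [fderiv_fun_neg] at h3
  simpa using h3

lemma normalDeriv_add_period (hφ : IsWormFunction φ β) (hr : IsDefFn (wormDomain φ) V r) {ζ : ℂ}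
    (hζ : |ζ.re| ≤ β - Real.pi / 2) :
    Real.exp (ζ + (4 * Real.pi : ℝ) * Complex.I).im *
      normalDeriv r (ζ + (4 * Real.pi : ℝ) * Complex.I) = Real.exp ζ.im * normalDeriv r ζ := by
  set ζ' := ζ + (4 * Real.pi : ℝ) * Complex.I with hζ'
  have hre : ζ'.re = ζ.re := by simp [hζ']
  have him : ζ'.im = ζ.im + 4 * Real.pi := by simp [hζ']
  set ℓ := Real.exp (-(4 * Real.pi)) with hℓ
  have hmap : ∀ s : ℝ, wormMap (s, ζ') = wormMap (((ℓ * s : ℝ) : ℂ), ζ) := by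
    intro s
    have e1 : Complex.exp (Complex.I * ζ') = ℓ * Complex.exp (Complex.I * ζ) := by
      rw [hℓ, Complex.ofReal_exp, ← Complex.exp_add]
      congr 1
      rw [hζ', mul_add, mul_left_comm, Complex.I_mul_I]; push_cast; ring
    have e2 : Complex.exp (ζ' / 2) = Complex.exp (ζ / 2) := by
      rw [show ζ' / 2 = ζ / 2 + 2 * Real.pi * Complex.I by rw [hζ']; push_cast; ring,
        Complex.exp_periodic]
    simp only [wormMap, e1, e2]
    push_cast
    congr 1
    ring
  have d1 := (hasJet_line ((contDiffAt_wormPullback_core hφ hr (ζ := ζ')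
    (by rwa [hre])).of_le two_le_smooth) (1, 0)).hasDerivAt
  have d2 := (hasJet_line ((contDiffAt_wormPullback_core hφ hr hζ).of_le two_le_smooth) (1, 0)).hasDerivAt
  have d3 := HasDerivAt.comp_of_eq (0 : ℝ) d2 ((hasDerivAt_id (0 : ℝ)).const_mul ℓ) (by simp)
  have : (fun s : ℝ => wormPullback r ((0, ζ') + s • (1, 0))) =
      (fun s : ℝ => wormPullback r ((0, ζ) + s • (1, 0))) ∘ fun s => ℓ * id s := by
    funext s
    have := hmap s
    simp [wormPullback, this]
  rw [this] at d1
  have h := d1.unique d3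
  rw [him, Real.exp_add, normalDeriv, normalDeriv, h, hℓ, mul_one, mul_assoc,
    mul_left_comm (Real.exp (4 * Real.pi)), ← Real.exp_add]
  simp

end Necessity

section Bounds

variable {φ : ℝ → ℝ} {β : ℝ} {V : Set (Fin 2 → ℂ)} {r : (Fin 2 → ℂ) → ℝ}

/-- The differential inequality satisfied by the normal derivative bounds the core annulus. -/
lemma beta_lt_of_ineq (hφ : IsWormFunction φ β) (hβ : Real.pi / 2 < β)
    (hr : IsDefFn (wormDomain φ) V r) {e : ℝ} (he : e ≠ 0)
    (h : ∀ ζ : ℂ, |ζ.re| < β - Real.pi / 2 → e * (normalDeriv r ζ *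
      complexHessian (normalDeriv r) ζ 1 + (e - 1) * (fderiv ℝ (normalDeriv r) ζ 1 ^ 2 +
        fderiv ℝ (normalDeriv r) ζ Complex.I ^ 2)) ≤ 0) :
    β - Real.pi / 2 < Real.pi / (2 * |e|) := by
  by_contra! hc
  refine no_supersolution_on_strip he hc (fun ζ hζ => ?_)
    (fun ζ hζ => normalDeriv_pos hφ hβ hr hζ) (fun ζ hζ => normalDeriv_add_period hφ hr hζ) h
  have h1 : ContDiffAt ℝ 2 (fun q => fderiv ℝ (wormPullback r) q (1, 0)) (0, ζ) :=
    (((contDiffAt_wormPullback_core hφ hr hζ).of_le three_le_smooth).fderiv_right (m := 2)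
      (by norm_num)).clm_apply contDiffAt_const
  exact h1.comp ζ (by fun_prop : ContDiffAt ℝ 2 (fun ξ : ℂ => ((0 : ℂ), ξ)) ζ)

lemma core_package (hφ : IsWormFunction φ β) (hβ : Real.pi / 2 < β)
    (hr : IsDefFn (wormDomain φ) V r) {ζ : ℂ} (hζ : |ζ.re| < β - Real.pi / 2) :
    ContDiffAt ℝ 3 (wormPullback r) (0, ζ) ∧ (∀ᶠ ξ in 𝓝 ζ, wormPullback r (0, ξ) = 0) ∧
    (∀ᶠ ξ in 𝓝 ζ, ∀ u : ℂ, fderiv ℝ (wormPullback r) (0, ξ) (u, 0) =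
      fderiv ℝ (wormPullback r) (0, ξ) (1, 0) * u.re) ∧
    0 < fderiv ℝ (wormPullback r) (0, ζ) (1, 0) := by
  have hn : ∀ᶠ ξ : ℂ in 𝓝 ζ, |ξ.re| < β - Real.pi / 2 :=
    (continuous_abs.comp Complex.continuous_re).continuousAt.eventually_lt_const hζ
  refine ⟨(contDiffAt_wormPullback_core hφ hr hζ.le).of_le three_le_smooth, ?_, ?_,
    normalDeriv_pos hφ hβ hr hζ.le⟩
  · filter_upwards [hn] with ξ h using wormPullback_core hφ hr h.le
  · filter_upwards [hn] with ξ h using fun u => fderiv_wormPullback_normal hφ hr h.le u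

lemma complexHessian_wormPullback_rpow {q : ℂ × ℂ} {η σ : ℝ}
    (hs : ContDiffAt ℝ (⊤ : ℕ∞) r (wormMap q)) (hq : 0 < σ * r (wormMap q)) (X : ℂ × ℂ) :
    complexHessian (fun p => (σ * r p) ^ η) (wormMap q) (fderiv ℂ wormMap q X) =
      η * (σ * r (wormMap q)) ^ (η - 2) * (σ ^ 2 *
        (wormPullback r q * complexHessian (wormPullback r) q X + (η - 1) *
        (fderiv ℝ (wormPullback r) q X ^ 2 +
          fderiv ℝ (wormPullback r) q (Complex.I • X) ^ 2))) := by
  have hf : ContDiffAt ℝ 2 (fun p => (σ * r p) ^ η) (wormMap q) :=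
    (contDiffAt_const.mul (hs.of_le two_le_smooth)).rpow_const_of_ne hq.ne'
  have hR : ContDiffAt ℝ 2 (wormPullback r) q :=
    (contDiffAt_wormPullback hs).of_le two_le_smooth
  rw [← complexHessian_comp_holomorphic (contDiff_wormMap.contDiffAt.of_le two_le_smooth) hf]
  have e : (fun x => (fun p => (σ * r p) ^ η) (wormMap x)) =
      fun x => ((-σ) * wormPullback r x) ^ η := by
    funext x; simp [wormPullback]
  have hval : (-σ) * wormPullback r q = σ * r (wormMap q) := by simp [wormPullback]
  have hc : ContDiffAt ℝ 2 (fun x => (-σ) * wormPullback r x) q := contDiffAt_const.mul hR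
  rw [e, complexHessian_rpow hc (by rw [hval]; exact hq), hval,
    complexHessian_eq_of_hasJet hc ((hasJet_line hR X).const_mul (-σ))
      ((hasJet_line hR (Complex.I • X)).const_mul (-σ)),
    (hasJet_line hc X).unique_fst ((hasJet_line hR X).const_mul (-σ)),
    (hasJet_line hc (Complex.I • X)).unique_fst ((hasJet_line hR (Complex.I • X)).const_mul (-σ)),
    complexHessian]
  simp only [wormPullback]
  ring

lemma levi_re_nonneg_of_strictPSHOn {n : ℕ} {f : (Fin n → ℂ) → ℝ} {S : Set (Fin n → ℂ)}
    (h : StrictPSHOn f S) {z : Fin n → ℂ} (hz : z ∈ S) (X : Fin n → ℂ) :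
    0 ≤ (levi f X X z).re := by
  by_cases hX : X = 0
  · simp [levi, hX]
  · exact (h z hz X hX).le

lemma dfExp_bound (hφ : IsWormFunction φ β) (hβ : Real.pi / 2 < β)
    (hr : IsDefFn (wormDomain φ) V r) {η : ℝ} (hη : η ∈ dfExpSet (wormDomain φ) r) :
    η < Real.pi / (2 * β) := by
  obtain ⟨hη0, hη1, hpsh⟩ := hη
  have h1 : 0 < 1 - η := by linarith
  have he : 0 < η / (1 - η) := by positivity
  have key := beta_lt_of_ineq hφ hβ hr he.ne' (fun ζ hζ => by
    obtain ⟨hR, h0, hM, hpos⟩ := core_package hφ hβ hr hζ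
    obtain ⟨X, hX⟩ := tendsto_normal_quotient hR h0 hM hpos hη1.ne
    refine mul_nonpos_of_nonneg_of_nonpos he.le
      (le_of_tendsto (hX.mono_left (nhdsGT_le_nhdsNE 0)) ?_)
    filter_upwards [wormMap_mem_wormDomain hφ hζ.le (ξ := 1) (by simp)] with δ hδ
    replace hδ : wormMap (δ, ζ) ∈ wormDomain φ := by simpa using hδ
    have hδV := hδ
    rw [hr.eq] at hδV
    have hs := hr.contDiffAt hδV.1
    have hneg : 0 < (-1) * r (wormMap (δ, ζ)) := by linarith [hδV.2]
    have hf : ContDiffAt ℝ 2 (fun p => ((-1) * r p) ^ η) (wormMap (δ, ζ)) :=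
      (contDiffAt_const.mul (hs.of_le two_le_smooth)).rpow_const_of_ne hneg.ne'
    have hl := levi_re_nonneg_of_strictPSHOn hpsh hδ (fderiv ℂ wormMap (δ, ζ) (X δ))
    have e : (fun z => -(-r z) ^ η) = fun z => - ((-1) * r z) ^ η := by
      funext z; rw [neg_one_mul]
    rw [e, levi_re_eq hf.neg, complexHessian_neg hf, complexHessian_wormPullback_rpow hs hneg] at hl
    have hP : 0 < η * ((-1) * r (wormMap (δ, ζ))) ^ (η - 2) :=
      mul_pos hη0 (Real.rpow_pos_of_pos hneg _)
    refine mul_nonpos_of_nonneg_of_nonpos (by positivity) ?_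
    by_contra! hcon
    have := mul_pos hP hcon
    linarith)
  have hβ0 : 0 < β := by linarith [Real.pi_pos]
  rw [abs_of_pos he, lt_div_iff₀ (by positivity)] at key
  rw [lt_div_iff₀ (by positivity)]
  have h2 : η / (1 - η) * (1 - η) = η := div_mul_cancel₀ _ h1.ne'
  nlinarith [mul_lt_mul_of_pos_right key h1]

lemma eventually_wormMap_mem (hφ : IsWormFunction φ β) (hr : IsDefFn (wormDomain φ) V r)
    {ζ : ℂ} (hζ : |ζ.re| ≤ β - Real.pi / 2) {W : Set (Fin 2 → ℂ)} (hW : W ∈ 𝓝 (wormMap (0, ζ))) :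
    ∀ᶠ δ : ℝ in 𝓝[<] 0, wormMap (δ, ζ) ∈ V ∧ wormMap (δ, ζ) ∈ W ∧
      wormMap (δ, ζ) ∉ closure (wormDomain φ) ∧ 0 ≤ r (wormMap (δ, ζ)) := by
  have hc : ContinuousAt (fun δ : ℝ => wormMap (δ, ζ)) 0 :=
    contDiff_wormMap.continuous.continuousAt.comp (by fun_prop)
  have h1 : V ∈ 𝓝 (wormMap (((0 : ℝ) : ℂ), ζ)) := by
    simpa using hr.isOpen.mem_nhds (wormMap_mem hφ hr hζ)
  have h2 : W ∈ 𝓝 (wormMap (((0 : ℝ) : ℂ), ζ)) := by simpa using hW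
  filter_upwards [nhdsWithin_le_nhds (hc.eventually h1), nhdsWithin_le_nhds (hc.eventually h2),
    self_mem_nhdsWithin] with δ k1 k2 k3
  have k4 := wormMap_notMem_closure hφ (ζ := ζ) k3
  refine ⟨k1, k2, k4, not_lt.mp fun h => k4 (subset_closure ?_)⟩
  rw [hr.eq]
  exact ⟨k1, h⟩

lemma eventually_pos (hφ : IsWormFunction φ β) (hβ : Real.pi / 2 < β)
    (hr : IsDefFn (wormDomain φ) V r) {ζ : ℂ} (hζ : |ζ.re| < β - Real.pi / 2) :
    ∀ᶠ δ : ℝ in 𝓝[<] 0, 0 < r (wormMap (δ, ζ)) := by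
  obtain ⟨hR, h0, -, hpos⟩ := core_package hφ hβ hr hζ
  have h := hasDerivAt_iff_tendsto_slope_zero.mp (hasDerivAt_normal hR)
  filter_upwards [(h.mono_left (nhdsLT_le_nhdsNE 0)).eventually (lt_mem_nhds hpos),
    self_mem_nhdsWithin] with δ h1 h2
  have h2 : δ < 0 := h2
  have h3 := h0.self_of_nhds
  simp only [zero_add, Complex.ofReal_zero, h3, sub_zero, smul_eq_mul] at h1
  simp only [wormPullback] at h1
  by_contra! h4
  have := mul_nonpos_of_nonpos_of_nonneg (inv_lt_zero.mpr h2).le (neg_nonneg.mpr h4)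
  linarith

lemma steinExp_bound (hφ : IsWormFunction φ β) (hβ : Real.pi / 2 < β)
    (hr : IsDefFn (wormDomain φ) V r) {η : ℝ} (hη : η ∈ steinExpSet (wormDomain φ) r) :
    β < Real.pi ∧ Real.pi / (2 * (Real.pi - β)) < η := by
  obtain ⟨hη1, W, hWo, hW, hpsh⟩ := hη
  have h1 : 0 < η - 1 := by linarith
  have hη0 : 0 < η := by linarith
  have he' : 1 - η < 0 := by linarith
  have he : η / (1 - η) < 0 := div_neg_of_pos_of_neg hη0 he'
  have key := beta_lt_of_ineq hφ hβ hr he.ne (fun ζ hζ => by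
    obtain ⟨hR, h0, hM, hpos⟩ := core_package hφ hβ hr hζ
    obtain ⟨X, hX⟩ := tendsto_normal_quotient hR h0 hM hpos hη1.ne'
    refine mul_nonpos_of_nonpos_of_nonneg he.le
      (ge_of_tendsto (hX.mono_left (nhdsLT_le_nhdsNE 0)) ?_)
    filter_upwards [eventually_wormMap_mem hφ hr hζ.le
      (hWo.mem_nhds (hW (wormMap_zero_mem_frontier hφ hζ.le))), eventually_pos hφ hβ hr hζ]
      with δ ⟨k1, k2, k3, _⟩ k4
    have hs := hr.contDiffAt k1
    have hpos : 0 < 1 * r (wormMap (δ, ζ)) := by linarith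
    have hf : ContDiffAt ℝ 2 (fun p => (1 * r p) ^ η) (wormMap (δ, ζ)) :=
      (contDiffAt_const.mul (hs.of_le two_le_smooth)).rpow_const_of_ne hpos.ne'
    have hl := levi_re_nonneg_of_strictPSHOn hpsh ⟨k3, k2⟩ (fderiv ℂ wormMap (δ, ζ) (X δ))
    have e : (fun z => r z ^ η) = fun z => (1 * r z) ^ η := by
      funext z; rw [one_mul]
    rw [e, levi_re_eq hf, complexHessian_wormPullback_rpow hs hpos] at hl
    have hP : 0 < η * (1 * r (wormMap (δ, ζ))) ^ (η - 2) :=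
      mul_pos hη0 (Real.rpow_pos_of_pos hpos _)
    refine mul_nonneg (by positivity) ?_
    by_contra! hcon
    have := mul_neg_of_pos_of_neg hP hcon
    linarith)
  have hπ := Real.pi_pos
  rw [abs_of_neg he, ← div_neg, neg_sub, lt_div_iff₀ (by positivity)] at key
  have h2 : η / (η - 1) * (η - 1) = η := div_mul_cancel₀ _ h1.ne'
  have key2 : (2 * β - Real.pi) * η < Real.pi * (η - 1) := by
    nlinarith [mul_lt_mul_of_pos_right key h1]
  have hlt : β < Real.pi := by
    by_contra! h
    nlinarith
  refine ⟨hlt, ?_⟩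
  rw [div_lt_iff₀ (by linarith)]
  nlinarith

lemma lt_pi_of_hasStrongSteinBasis (hφ : IsWormFunction φ β) (hβ : Real.pi / 2 < β)
    (h : HasStrongSteinBasis (wormDomain φ)) : β < Real.pi := by
  obtain ⟨V, r, hr, ε₀, hε₀, -, hpc⟩ := h
  have key := beta_lt_of_ineq hφ hβ hr (e := -1) (by norm_num) (fun ζ hζ => by
    obtain ⟨hR, h0, hM, hpos⟩ := core_package hφ hβ hr hζ
    have := normal_limit_tangential hR h0 hM hpos ?_
    · change 0 ≤ normalDeriv r ζ * complexHessian (normalDeriv r) ζ 1 - 2 *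
        (fderiv ℝ (normalDeriv r) ζ 1 ^ 2 + fderiv ℝ (normalDeriv r) ζ Complex.I ^ 2) at this
      linarith
    · have hcore := wormMap_mem hφ hr hζ.le
      have hW : {p | r p < ε₀} ∈ 𝓝 (wormMap (0, ζ)) := by
        refine (hr.contDiffAt hcore).continuousAt.eventually_lt_const ?_
        rwa [hr.eq_zero_of_mem_frontier (isOpen_wormDomain hφ)
          (wormMap_zero_mem_frontier hφ hζ.le)]
      filter_upwards [eventually_wormMap_mem hφ hr hζ.le hW] with δ ⟨k1, k2, _, k4⟩ X hX1 hX2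
      have hs := hr.contDiffAt k1
      have hs2 := hs.of_le two_le_smooth
      have hΦ : ContDiffAt ℂ 2 wormMap ((δ : ℂ), ζ) :=
        contDiff_wormMap.contDiffAt.of_le two_le_smooth
      have hd : ∀ Y, fderiv ℝ (wormPullback r) (δ, ζ) Y =
          - fderiv ℝ r (wormMap (δ, ζ)) (fderiv ℂ wormMap (δ, ζ) Y) := fun Y => by
        have := fderiv_comp_holomorphic (f := fun p => - r p) (hΦ.differentiableAt (by simp))
          (hs2.neg.differentiableAt (by simp)) Y
        rw [fderiv_fun_neg (f := r)] at this
        exact this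
      rw [hd, neg_eq_zero] at hX1 hX2
      rw [map_smul] at hX2
      have hl := hpc _ k4 k2 _ k1 rfl (fderiv ℂ wormMap (δ, ζ) X)
        ((dirDeriv_cplx_eq_zero_iff (hs2.differentiableAt (by simp)) _).mpr ⟨hX1, hX2⟩)
      rw [levi_re_eq hs2] at hl
      have hH := complexHessian_comp_holomorphic (f := fun p => - r p) hΦ hs2.neg X
      rw [complexHessian_neg hs2] at hH
      change complexHessian (fun q => - r (wormMap q)) _ _ ≤ 0
      rw [hH]
      linarith)
  norm_num at key
  linarith

end Bounds

namespace HasJet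

lemma cos {f : ℝ → ℝ} {x a b c : ℝ} (h : HasJet f x a b c) :
    HasJet (fun s => Real.cos (f s)) x (Real.cos a) (-Real.sin a * b)
      (-Real.cos a * b ^ 2 + -Real.sin a * c) :=
  HasJet.comp ⟨rfl, fun y => -Real.sin y,
    Filter.Eventually.of_forall fun y => Real.hasDerivAt_cos y, rfl,
    (Real.hasDerivAt_sin a).neg⟩ h

/-- Second-order jet of a geometric mean with weights `1 - η` and `η`. -/
lemma rpow_mul_rpow {A S : ℝ → ℝ} {x a₀ a₁ a₂ s₀ s₁ s₂ : ℝ} (hA : HasJet A x a₀ a₁ a₂)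
    (hS : HasJet S x s₀ s₁ s₂) (ha : 0 < a₀) (hs : 0 < s₀) (η : ℝ) :
    HasJet (fun s => A s ^ (1 - η) * S s ^ η) x (a₀ ^ (1 - η) * s₀ ^ η)
      (a₀ ^ (1 - η) * s₀ ^ η * ((1 - η) * a₁ / a₀ + η * s₁ / s₀))
      (a₀ ^ (1 - η) * s₀ ^ η * ((1 - η) * a₂ / a₀ + η * s₂ / s₀ -
        η * (1 - η) * (a₁ / a₀ - s₁ / s₀) ^ 2)) := by
  have e1 : ∀ (y p : ℝ), 0 < y → y ^ (p - 1) = y ^ p / y := fun y p hy => by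
    rw [Real.rpow_sub_one hy.ne']
  have e2 : ∀ (y p : ℝ), 0 < y → y ^ (p - 2) = y ^ p / y ^ 2 := fun y p hy => by
    rw [Real.rpow_sub hy, Real.rpow_two]
  refine ((hA.rpow ha (1 - η)).mul (hS.rpow hs η)).congr_vals rfl ?_ ?_
  · rw [e1 _ _ ha, e1 _ _ hs]
    field_simp
  · rw [e1 _ _ ha, e1 _ _ hs, e2 _ _ ha, e2 _ _ hs]
    field_simp
    ring

end HasJet

namespace IsWormFunction

variable {φ : ℝ → ℝ} {β : ℝ}

lemma contDiff_deriv_deriv {f : ℝ → ℝ} (hf : ContDiff ℝ (⊤ : ℕ∞) f) :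
    ContDiff ℝ (⊤ : ℕ∞) (deriv (deriv f)) := by
  have h := hf.iterate_deriv 2
  simpa using h

lemma deriv_deriv_nonneg (hφ : IsWormFunction φ β) (t : ℝ) : 0 ≤ deriv (deriv φ) t := by
  have hd : Differentiable ℝ φ := hφ.smooth.differentiable (by simp)
  have : Monotone (deriv φ) :=
    monotoneOn_univ.mp (hφ.convex.monotoneOn_deriv fun x _ => hd x)
  exact this.deriv_nonneg

lemma le_of_abs_le (hφ : IsWormFunction φ β) {s t : ℝ} (h : |s| ≤ |t|) : φ s ≤ φ t := by
  have he : φ |t| = φ t := by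
    rcases abs_choice t with h | h <;> rw [h]
    exact hφ.even t
  have := hφ.convex.le_max_of_mem_Icc (Set.mem_univ (-|t|)) (Set.mem_univ |t|)
    (Set.mem_Icc.mpr (abs_le.mp h))
  rwa [hφ.even, he, max_self] at this

/-- A positive weight which is a strict supersolution of the oscillator equation on the core. -/
lemma exists_weight (hφ : IsWormFunction φ β) (hβ : Real.pi / 2 < β) {κ : ℝ} (hκ : κ ≠ 0)
    (h : β - Real.pi / 2 < Real.pi / (2 * |κ|)) :
    ∃ k : ℝ → ℝ, ContDiff ℝ (⊤ : ℕ∞) k ∧ (∀ t, 0 < k t) ∧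
      ∀ t, deriv (deriv φ) t + φ t = 0 → deriv (deriv k) t + κ ^ 2 * k t < 0 := by
  have hc : 0 < β - Real.pi / 2 := by linarith
  have hκ' : 0 < |κ| := abs_pos.mpr hκ
  have h1 : |κ| < Real.pi / (2 * (β - Real.pi / 2)) := by
    rw [lt_div_iff₀ (by positivity)] at h ⊢
    linarith
  obtain ⟨κ₀, h2, h3⟩ := exists_between h1
  have hκ₀ : 0 < κ₀ := hκ'.trans h2
  have h4 : β - Real.pi / 2 < Real.pi / (2 * κ₀) := by
    rw [lt_div_iff₀ (by positivity)] at h3 ⊢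
    linarith
  obtain ⟨t₀, h5, h6⟩ := exists_between h4
  have ht₀ : 0 < t₀ := hc.trans h5
  have hm : 0 < φ t₀ := (hφ.nonneg t₀).lt_of_ne' fun h0 => by
    have := (le_abs_self _).trans ((hφ.eq_zero_iff t₀).mp h0)
    linarith
  have hcos : ∀ t, |t| ≤ t₀ → 0 < Real.cos (κ₀ * t) := fun t ht => by
    have h7 : |κ₀ * t| < Real.pi / 2 := by
      rw [abs_mul, abs_of_pos hκ₀]
      rw [lt_div_iff₀ (by positivity)] at h6
      nlinarith
    exact Real.cos_pos_of_mem_Ioo (Set.mem_Ioo.mpr (abs_lt.mp h7))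
  refine ⟨fun t => Real.cos (κ₀ * t) + 2 / φ t₀ * φ t, ?_, fun t => ?_, fun t ht => ?_⟩
  · exact (Real.contDiff_cos.comp (contDiff_const.mul contDiff_id)).add
      (contDiff_const.mul hφ.smooth)
  · rcases le_total |t| t₀ with ht | ht
    · have := hφ.nonneg t
      have := hcos t ht
      positivity
    · have h7 : φ t₀ ≤ φ t := hφ.le_of_abs_le (by rwa [abs_of_pos ht₀])
      have h8 : 2 ≤ 2 / φ t₀ * φ t := by
        rw [div_mul_eq_mul_div, le_div_iff₀ hm]
        linarith
      have := Real.neg_one_le_cos (κ₀ * t)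
      linarith
  · have h7 := hφ.nonneg t
    have h8 := hφ.deriv_deriv_nonneg t
    have h9 : φ t = 0 := by linarith
    have h10 : deriv (deriv φ) t = 0 := by linarith
    have hjet := (((HasJet.linear 0 κ₀ t).cos).add
      ((HasJet.of_contDiffAt (x := t) (hφ.smooth.contDiffAt.of_le
        (WithTop.coe_le_coe.mpr (le_top : (2 : ℕ∞) ≤ ⊤)))).const_mul (2 / φ t₀))).congr
      (g := fun t => Real.cos (κ₀ * t) + 2 / φ t₀ * φ t) (by simp)
    rw [hjet.deriv_deriv_eq, h10]
    have hcore := (hφ.eq_zero_iff t).mp h9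
    have hpos := hcos t (hcore.trans h5.le)
    have hκκ : κ ^ 2 < κ₀ ^ 2 := by
      rw [← sq_abs κ]
      exact pow_lt_pow_left₀ h2 hκ'.le (by norm_num)
    simp only [zero_add, h9]
    nlinarith [mul_pos (sub_pos.mpr hκκ) hpos]

end IsWormFunction

/-- A nonnegative perturbation divided by a small parameter restores positivity on a compact. -/
lemma exists_pos_add_div {a : ℝ} {f ψ : ℝ → ℝ} (hf : Continuous f) (hψ : Continuous ψ)
    (h0 : ∀ t, 0 ≤ ψ t) (h : ∀ t, ψ t = 0 → 0 < f t) :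
    ∃ ε > 0, ∀ t, |t| ≤ a → ∀ S, 0 < S → S < ε → 0 < f t + ψ t / S := by
  by_cases hne : (Set.Icc (-a) a ∩ {t | f t ≤ 0}).Nonempty
  · have hK : IsCompact (Set.Icc (-a) a ∩ {t | f t ≤ 0}) :=
      isCompact_Icc.inter_right (isClosed_le hf continuous_const)
    obtain ⟨t₁, ht₁, hmin⟩ := hK.exists_isMinOn hne hψ.continuousOn
    obtain ⟨t₂, ht₂, hmin₂⟩ := hK.exists_isMinOn hne hf.continuousOn
    have hm : 0 < ψ t₁ := (h0 t₁).lt_of_ne' fun h' => absurd (h _ h') ht₁.2.not_gt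
    have hB : f t₂ ≤ 0 := ht₂.2
    refine ⟨ψ t₁ / (1 - f t₂), by apply div_pos hm; linarith, fun t ht S hS hSε => ?_⟩
    rcases lt_or_ge 0 (f t) with hft | hft
    · have := div_nonneg (h0 t) hS.le
      linarith
    · have hmem : t ∈ Set.Icc (-a) a ∩ {t | f t ≤ 0} := ⟨Set.mem_Icc.mpr (abs_le.mp ht), hft⟩
      have k1 : ψ t₁ ≤ ψ t := hmin hmem
      have k2 : f t₂ ≤ f t := hmin₂ hmem
      rw [lt_div_iff₀ (by linarith)] at hSε
      have k3 : 1 - f t₂ < ψ t / S := by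
        rw [lt_div_iff₀ hS]
        linarith
      linarith
  · refine ⟨1, one_pos, fun t ht S hS _ => ?_⟩
    have hft : 0 < f t := by
      by_contra! hft
      exact hne ⟨t, Set.mem_Icc.mpr (abs_le.mp ht), hft⟩
    have := div_nonneg (h0 t) hS.le
    linarith

section Curve

/-- The logarithm `log |w|²` at the point `p = (z, w)`. -/
def logHeight (p : Fin 2 → ℂ) : ℝ := Real.log (Complex.normSq (p 1))

/-- The first coordinate rotated back by the angle `log |w|²`. -/
def unrotated (p : Fin 2 → ℂ) : ℂ := p 0 * Complex.exp (-(Complex.I * logHeight p))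

/-- Holomorphic curves through `p` adapted to the rotating discs of the worm domain. -/
def adaptedCurve (p : Fin 2 → ℂ) (a b s : ℂ) : Fin 2 → ℂ :=
  ![(unrotated p + a * s) * Complex.exp (Complex.I * logHeight p) * Complex.exp (Complex.I * (b * s)),
    p 1 * Complex.exp (b * s / 2)]

variable {φ : ℝ → ℝ} {p : Fin 2 → ℂ} {a b : ℂ}

lemma unrotated_mul_exp (p : Fin 2 → ℂ) :
    unrotated p * Complex.exp (Complex.I * logHeight p) = p 0 := by
  rw [unrotated, mul_assoc, ← Complex.exp_add]
  simp

lemma adaptedCurve_zero (p : Fin 2 → ℂ) (a b : ℂ) : adaptedCurve p a b 0 = p := by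
  funext i
  fin_cases i
  · simp [adaptedCurve, unrotated_mul_exp]
  · simp [adaptedCurve]

lemma adaptedCurve_mul_I (p : Fin 2 → ℂ) (a b s : ℂ) :
    adaptedCurve p a b (s * Complex.I) = adaptedCurve p (a * Complex.I) (b * Complex.I) s := by
  simp only [adaptedCurve]
  ring_nf

lemma contDiff_adaptedCurve (p : Fin 2 → ℂ) (a b : ℂ) : ContDiff ℂ 2 (adaptedCurve p a b) := by
  rw [contDiff_pi]
  intro i
  fin_cases i
  · exact ((contDiff_const.add (contDiff_const.mul contDiff_id)).mul contDiff_const).mul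
      (contDiff_const.mul (contDiff_const.mul contDiff_id)).cexp
  · exact contDiff_const.mul ((contDiff_const.mul contDiff_id).div_const 2).cexp

lemma exists_adaptedCurve (hp : p 1 ≠ 0) (X : Fin 2 → ℂ) :
    ∃ a b : ℂ, HasDerivAt (adaptedCurve p a b) X 0 ∧ (a = 0 → b = 0 → X = 0) := by
  have he : Complex.exp (Complex.I * logHeight p) ≠ 0 := Complex.exp_ne_zero _
  refine ⟨X 0 * (Complex.exp (Complex.I * logHeight p))⁻¹ -
    Complex.I * (2 * X 1 / p 1) * unrotated p, 2 * X 1 / p 1, ?_, fun ha hb => ?_⟩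
  · rw [hasDerivAt_pi]
    intro i
    have h1 : ∀ c : ℂ, HasDerivAt (fun s : ℂ => c * s) c 0 := fun c => by
      simpa using (hasDerivAt_id (0 : ℂ)).const_mul c
    fin_cases i
    · have := (((h1 (X 0 * (Complex.exp (Complex.I * logHeight p))⁻¹ -
        Complex.I * (2 * X 1 / p 1) * unrotated p)).const_add (unrotated p)).mul_const
        (Complex.exp (Complex.I * logHeight p))).mul
        ((h1 (2 * X 1 / p 1)).const_mul Complex.I).cexp
      refine this.congr_deriv ?_
      simp
      field_simp
      ring
    · have := (((h1 (2 * X 1 / p 1)).div_const 2).cexp).const_mul (p 1)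
      refine this.congr_deriv ?_
      simp
      field_simp
  · have hX1 : X 1 = 0 := by simpa [hp] using hb
    rw [hX1] at ha
    have hX0 : X 0 = 0 := by simpa using ha
    funext i
    fin_cases i
    · exact hX0
    · exact hX1

lemma logHeight_adaptedCurve (hp : p 1 ≠ 0) (a b : ℂ) (s : ℝ) :
    logHeight (adaptedCurve p a b s) = logHeight p + b.re * s := by
  simp only [logHeight, adaptedCurve, Matrix.cons_val_one, Matrix.cons_val_zero]
  rw [log_normSq_mul_exp hp]
  simp

/-- The defining function of the worm domain along an adapted curve, up to an exponential factor. -/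
def curveRho (φ : ℝ → ℝ) (p : Fin 2 → ℂ) (a b : ℂ) (s : ℝ) : ℝ :=
  (((unrotated p).re + a.re * s) * ((unrotated p).re + a.re * s) +
    ((unrotated p).im + a.im * s) * ((unrotated p).im + a.im * s)) * Real.exp (0 + -b.im * s) -
    2 * ((unrotated p).re + a.re * s) + φ (logHeight p + b.re * s) * Real.exp (0 + b.im * s)

lemma wormRho_adaptedCurve (φ : ℝ → ℝ) (hp : p 1 ≠ 0) (a b : ℂ) (s : ℝ) :
    wormRho φ (adaptedCurve p a b s) = Real.exp (-(b.im * s)) * curveRho φ p a b s := by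
  rw [adaptedCurve, logHeight, wormRho_exp φ hp, curveRho, Complex.normSq_apply]
  have e1 : Real.exp (-2 * (b * s).im) = Real.exp (-(b.im * s)) * Real.exp (0 + -b.im * s) := by
    rw [← Real.exp_add]; congr 1; simp; ring
  have e2 : Real.exp (0 + b.im * s) = (Real.exp (-(b.im * s)))⁻¹ := by
    rw [← Real.exp_neg]; simp
  have e3 : Real.exp (-(b * s).im) = Real.exp (-(b.im * s)) := by simp
  rw [e1, e2, e3]
  have := Real.exp_ne_zero (-(b.im * s))
  simp [logHeight]
  field_simp

/-- The Levi form of the worm domain in adapted coordinates. -/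
def curveLevi (φ : ℝ → ℝ) (p : Fin 2 → ℂ) (a b : ℂ) : ℝ :=
  Complex.normSq (2 * a + Complex.I * b * unrotated p) +
    (deriv (deriv φ) (logHeight p) + φ (logHeight p)) * Complex.normSq b

lemma hasJet_curveRho (hφ : ContDiff ℝ (⊤ : ℕ∞) φ) (hp : p 1 ≠ 0) (a b : ℂ) :
    ∃ u₁ u₂ v₁ v₂ : ℝ, HasJet (curveRho φ p a b) 0 (wormRho φ p) u₁ u₂ ∧
      HasJet (curveRho φ p (a * Complex.I) (b * Complex.I)) 0 (wormRho φ p) v₁ v₂ ∧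
      u₂ + v₂ = curveLevi φ p a b := by
  have hj : ∀ a b : ℂ, HasJet (curveRho φ p a b) 0 (wormRho φ p) _ _ := fun a b => by
    have h1 := HasJet.linear (unrotated p).re a.re 0
    have h2 := HasJet.linear (unrotated p).im a.im 0
    have h3 := HasJet.of_contDiffAt (f := φ) (x := logHeight p + b.re * 0)
      (hφ.contDiffAt.of_le two_le_smooth)
    have := (((((h1.mul h1).add (h2.mul h2)).mul (HasJet.linear 0 (-b.im) 0).exp).sub
      (h1.const_mul 2)).add
      ((h3.comp (HasJet.linear (logHeight p) b.re 0)).mul (HasJet.linear 0 b.im 0).exp))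
    refine this.congr_vals ?_ rfl rfl
    have h0 := wormRho_adaptedCurve φ hp a b 0
    simp only [Complex.ofReal_zero, adaptedCurve_zero, curveRho] at h0
    rw [h0]
    simp
  refine ⟨_, _, _, _, hj a b, hj _ _, ?_⟩
  simp [curveLevi, Complex.normSq_apply]
  ring

end Curve

section Weight

variable {φ k : ℝ → ℝ} {p : Fin 2 → ℂ} {a b : ℂ}

/-- The weighted function `ρ · k(log |w|²)^((1 - η) / η)`. -/
def weightedRho (φ k : ℝ → ℝ) (η : ℝ) (p : Fin 2 → ℂ) : ℝ :=
  wormRho φ p * k (logHeight p) ^ ((1 - η) / η)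

lemma contDiffAt_weightedRho (hφ : ContDiff ℝ (⊤ : ℕ∞) φ) (hk : ContDiff ℝ (⊤ : ℕ∞) k)
    (hk0 : ∀ t, 0 < k t) (η : ℝ) (hp : p 1 ≠ 0) :
    ContDiffAt ℝ (⊤ : ℕ∞) (weightedRho φ k η) p :=
  (contDiffAt_wormRho hφ hp).mul ((hk.contDiffAt.comp p (contDiffAt_log_normSq hp)).rpow_const_of_ne
    (hk0 _).ne')

/-- The weight along an adapted curve, up to an exponential factor. -/
def curveWeight (k : ℝ → ℝ) (κ : ℝ) (p : Fin 2 → ℂ) (b : ℂ) (s : ℝ) : ℝ :=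
  k (logHeight p + b.re * s) * Real.exp (0 + -(κ * b.im) * s)

lemma hasJet_curveWeight (hk : ContDiff ℝ (⊤ : ℕ∞) k) (κ : ℝ) (p : Fin 2 → ℂ) (b : ℂ) :
    ∃ u₁ u₂ v₁ v₂ : ℝ, HasJet (curveWeight k κ p b) 0 (k (logHeight p)) u₁ u₂ ∧
      HasJet (curveWeight k κ p (b * Complex.I)) 0 (k (logHeight p)) v₁ v₂ ∧
      u₂ + v₂ = (deriv (deriv k) (logHeight p) + κ ^ 2 * k (logHeight p)) * Complex.normSq b := by
  have hj : ∀ b : ℂ, HasJet (curveWeight k κ p b) 0 (k (logHeight p)) _ _ := fun b => by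
    have h3 := HasJet.of_contDiffAt (f := k) (x := logHeight p + b.re * 0)
      (hk.contDiffAt.of_le two_le_smooth)
    exact ((h3.comp (HasJet.linear (logHeight p) b.re 0)).mul
      (HasJet.linear 0 (-(κ * b.im)) 0).exp).congr_vals (by simp) rfl rfl
  refine ⟨_, _, _, _, hj b, hj _, ?_⟩
  simp [Complex.normSq_apply]
  ring

lemma curveWeight_pos (hk0 : ∀ t, 0 < k t) (κ : ℝ) (p : Fin 2 → ℂ) (b : ℂ) (s : ℝ) :
    0 < curveWeight k κ p b s :=
  mul_pos (hk0 _) (Real.exp_pos _)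

lemma weightedRho_adaptedCurve (hk0 : ∀ t, 0 < k t) {η : ℝ} (hη0 : η ≠ 0) (hη1 : 1 - η ≠ 0)
    (hp : p 1 ≠ 0) (a b : ℂ) (s : ℝ) :
    weightedRho φ k η (adaptedCurve p a b s) =
      curveWeight k (η / (1 - η)) p b s ^ ((1 - η) / η) * curveRho φ p a b s := by
  rw [weightedRho, wormRho_adaptedCurve φ hp, logHeight_adaptedCurve hp, curveWeight,
    Real.mul_rpow (hk0 _).le (Real.exp_pos _).le, ← Real.exp_mul]
  have : (0 + -(η / (1 - η) * b.im) * s) * ((1 - η) / η) = -(b.im * s) := by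
    field_simp
    ring
  rw [this]
  ring

lemma weightedRho_rpow_adaptedCurve (hk0 : ∀ t, 0 < k t) {η : ℝ} (hη0 : η ≠ 0)
    (hη1 : 1 - η ≠ 0) (hp : p 1 ≠ 0) (a b : ℂ) {σ s : ℝ} (hs : 0 < σ * curveRho φ p a b s) :
    (σ * weightedRho φ k η (adaptedCurve p a b s)) ^ η =
      curveWeight k (η / (1 - η)) p b s ^ (1 - η) * (σ * curveRho φ p a b s) ^ η := by
  have hA := curveWeight_pos hk0 (η / (1 - η)) p b s
  rw [weightedRho_adaptedCurve hk0 hη0 hη1 hp, mul_left_comm,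
    Real.mul_rpow (Real.rpow_nonneg hA.le _) hs.le, ← Real.rpow_mul hA.le, div_mul_cancel₀ _ hη0]

lemma HasJet.eventually_mul_pos {f : ℝ → ℝ} {x u v w σ : ℝ} (h : HasJet f x u v w)
    (hs : 0 < σ * u) : ∀ᶠ s in 𝓝 x, 0 < σ * f s := by
  have hc : ContinuousAt (fun s => σ * f s) x := h.hasDerivAt.continuousAt.const_mul σ
  exact hc.eventually (lt_mem_nhds (by simpa only [h.1] using hs))

/-- The complex Hessian of a power of the weighted defining function in adapted coordinates. -/
lemma complexHessian_weightedRho_rpow (hφ : ContDiff ℝ (⊤ : ℕ∞) φ) (hk : ContDiff ℝ (⊤ : ℕ∞) k)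
    (hk0 : ∀ t, 0 < k t) {η σ : ℝ} (hη0 : η ≠ 0) (hη1 : 1 - η ≠ 0) (hp : p 1 ≠ 0)
    (hs : 0 < σ * wormRho φ p) {X : Fin 2 → ℂ} (hX : HasDerivAt (adaptedCurve p a b) X 0) :
    ∃ e ≥ 0, complexHessian (fun q => (σ * weightedRho φ k η q) ^ η) p X =
      (σ * weightedRho φ k η p) ^ η * ((1 - η) * (deriv (deriv k) (logHeight p) + (η / (1 - η)) ^ 2 * k (logHeight p)) /
        k (logHeight p) * Complex.normSq b + η * curveLevi φ p a b / wormRho φ p -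
        η * (1 - η) * e) := by
  have hq := Real.rpow_pos_of_pos (hk0 (logHeight p)) ((1 - η) / η)
  have hpos : 0 < σ * weightedRho φ k η p := by
    rw [weightedRho, ← mul_assoc]
    exact mul_pos hs hq
  have hf : ContDiffAt ℝ 2 (fun q => (σ * weightedRho φ k η q) ^ η) (adaptedCurve p a b 0) := by
    rw [adaptedCurve_zero]
    exact (contDiffAt_const.mul ((contDiffAt_weightedRho hφ hk hk0 η hp).of_le
      two_le_smooth)).rpow_const_of_ne hpos.ne'
  obtain ⟨s₁, s₂, s₁', s₂', hS, hS', hSS⟩ := hasJet_curveRho hφ hp a b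
  obtain ⟨a₁, a₂, a₁', a₂', hA, hA', hAA⟩ := hasJet_curveWeight hk (η / (1 - η)) p b
  have hJ := ((hA.rpow_mul_rpow (hS.const_mul σ) (hk0 _) hs η)).congr
    (g := fun s : ℝ => (σ * weightedRho φ k η (adaptedCurve p a b s)) ^ η) (by
      filter_upwards [hS.eventually_mul_pos hs] with s h
      exact (weightedRho_rpow_adaptedCurve hk0 hη0 hη1 hp a b h).symm)
  have hJ' := ((hA'.rpow_mul_rpow (hS'.const_mul σ) (hk0 _) hs η)).congr
    (g := fun s : ℝ => (σ * weightedRho φ k η (adaptedCurve p a b (s * Complex.I))) ^ η) (by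
      filter_upwards [hS'.eventually_mul_pos hs] with s h
      rw [adaptedCurve_mul_I]
      exact (weightedRho_rpow_adaptedCurve hk0 hη0 hη1 hp _ _ h).symm)
  have hH := (complexHessian_curve (contDiff_adaptedCurve p a b).contDiffAt hX hf hJ hJ').1
  rw [adaptedCurve_zero] at hH
  have hσ : σ ≠ 0 := fun h => by simp [h] at hs
  have hρ : wormRho φ p ≠ 0 := fun h => by simp [h] at hs
  have hkne := (hk0 (logHeight p)).ne'
  have hval : (σ * weightedRho φ k η p) ^ η =
      k (logHeight p) ^ (1 - η) * (σ * wormRho φ p) ^ η := by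
    have := hJ.1
    simpa only [Complex.ofReal_zero, adaptedCurve_zero] using this
  refine ⟨(a₁ / k (logHeight p) - σ * s₁ / (σ * wormRho φ p)) ^ 2 +
      (a₁' / k (logHeight p) - σ * s₁' / (σ * wormRho φ p)) ^ 2, by positivity, ?_⟩
  have hk2 : (1 - η) * (deriv (deriv k) (logHeight p) + (η / (1 - η)) ^ 2 * k (logHeight p)) /
      k (logHeight p) * Complex.normSq b = (1 - η) * (a₂ + a₂') / k (logHeight p) := by
    rw [hAA]; ring
  rw [hH, hval, ← hSS, hk2, mul_div_mul_left _ _ hσ,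
    mul_div_mul_left _ _ hσ, show η * (σ * s₂) / (σ * wormRho φ p) = η * s₂ / wormRho φ p by
      field_simp, show η * (σ * s₂') / (σ * wormRho φ p) = η * s₂' / wormRho φ p by field_simp]
  ring

/-- The complex Hessian of a function of `log |w|²` in adapted coordinates. -/
lemma complexHessian_comp_logHeight {f : ℝ → ℝ} (hf : ContDiff ℝ (⊤ : ℕ∞) f) (hp : p 1 ≠ 0)
    {X : Fin 2 → ℂ} (hX : HasDerivAt (adaptedCurve p a b) X 0) :
    complexHessian (fun q => f (logHeight q)) p X =
        deriv (deriv f) (logHeight p) * Complex.normSq b ∧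
      fderiv ℝ (fun q => f (logHeight q)) p X ^ 2 +
        fderiv ℝ (fun q => f (logHeight q)) p (Complex.I • X) ^ 2 =
        deriv f (logHeight p) ^ 2 * Complex.normSq b := by
  have hF : ContDiffAt ℝ 2 (fun q => f (logHeight q)) (adaptedCurve p a b 0) := by
    rw [adaptedCurve_zero]
    exact (hf.contDiffAt.comp p (contDiffAt_log_normSq hp)).of_le two_le_smooth
  have hj : ∀ a b : ℂ, HasJet (fun s : ℝ => f (logHeight (adaptedCurve p a b s))) 0
      (f (logHeight p)) (deriv f (logHeight p) * b.re)
      (deriv (deriv f) (logHeight p) * b.re ^ 2) := fun a b => by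
    have h3 := HasJet.of_contDiffAt (f := f) (x := logHeight p + b.re * 0)
      (hf.contDiffAt.of_le two_le_smooth)
    refine ((h3.comp (HasJet.linear (logHeight p) b.re 0)).congr
      (g := fun s : ℝ => f (logHeight (adaptedCurve p a b s))) ?_).congr_vals
      (by simp) (by simp) (by simp)
    exact Filter.Eventually.of_forall fun s => by
      simp only [logHeight_adaptedCurve hp]
  have hj' := (hj (a * Complex.I) (b * Complex.I)).congr
    (g := fun s : ℝ => f (logHeight (adaptedCurve p a b (s * Complex.I))))
    (Filter.Eventually.of_forall fun s => by simp only [adaptedCurve_mul_I])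
  obtain ⟨h1, h2, h3⟩ := complexHessian_curve (contDiff_adaptedCurve p a b).contDiffAt hX hF
    (hj a b) hj'
  rw [adaptedCurve_zero] at h1 h2 h3
  rw [h1, h2, h3]
  simp only [Complex.normSq_apply, Complex.mul_re, Complex.I_re, Complex.I_im]
  constructor <;> ring

end Weight

section DefiningFunctions

variable {φ : ℝ → ℝ} {β : ℝ} {p : Fin 2 → ℂ}

lemma hasDerivAt_wormRho_adaptedCurve (hφ : ContDiff ℝ (⊤ : ℕ∞) φ) (hp : p 1 ≠ 0) (a : ℂ) (b : ℝ) :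
    HasDerivAt (fun s : ℝ => wormRho φ (adaptedCurve p a b s))
      (2 * (a.re * (unrotated p).re + a.im * (unrotated p).im) - 2 * a.re +
        deriv φ (logHeight p) * b) 0 := by
  have h3 := HasJet.of_contDiffAt (f := φ) (x := logHeight p + b * 0)
    (hφ.contDiffAt.of_le two_le_smooth)
  have h1 := HasJet.linear (unrotated p).re a.re 0
  have h2 := HasJet.linear (unrotated p).im a.im 0
  have := ((((h1.mul h1).add (h2.mul h2)).sub (h1.const_mul 2)).add
    (h3.comp (HasJet.linear (logHeight p) b 0))).congr
    (g := fun s : ℝ => wormRho φ (adaptedCurve p a b s)) (Filter.Eventually.of_forall fun s => by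
      simp only [wormRho_adaptedCurve φ hp, curveRho]
      simp)
  refine this.hasDerivAt.congr_deriv ?_
  simp
  ring

lemma fderiv_wormRho_ne_zero (hφ : IsWormFunction φ β) (hp : p 1 ≠ 0) (h0 : wormRho φ p = 0) :
    fderiv ℝ (wormRho φ) p ≠ 0 := by
  intro hd
  have hz : ∀ (a : ℂ) (b : ℝ), 2 * (a.re * (unrotated p).re + a.im * (unrotated p).im) -
      2 * a.re + deriv φ (logHeight p) * b = 0 := fun a b => by
    refine (hasDerivAt_wormRho_adaptedCurve hφ.smooth hp a b).unique ?_
    have h1 : HasFDerivAt (wormRho φ) (0 : (Fin 2 → ℂ) →L[ℝ] ℝ)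
        (adaptedCurve p a b (((0 : ℝ)) : ℂ)) := by
      rw [Complex.ofReal_zero, adaptedCurve_zero, ← hd]
      exact ((contDiffAt_wormRho hφ.smooth hp).differentiableAt (by simp)).hasFDerivAt
    have h2 : ContDiff ℝ 2 (fun s : ℝ => adaptedCurve p a b s) :=
      ((contDiff_adaptedCurve p a b).restrict_scalars ℝ).comp Complex.ofRealCLM.contDiff
    simpa [Function.comp_def] using h1.comp_hasDerivAt (0 : ℝ) (h2.differentiable (by simp) 0).hasDerivAt
  have h1 := hz 1 0
  have h2 := hz Complex.I 0
  have h3 := hz 0 1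
  simp at h1 h2 h3
  have hre : (unrotated p).re = 1 := by linarith
  have hρ := wormRho_adaptedCurve φ hp 0 0 0
  simp only [Complex.ofReal_zero, adaptedCurve_zero, curveRho, h0, hre, h2] at hρ
  simp at hρ
  exact hφ.deriv_ne _ (by linarith) h3

lemma wormRho_pos_of_notMem_closure (hφ : IsWormFunction φ β) (hp : p 1 ≠ 0)
    (h : p ∉ closure (wormDomain φ)) : 0 < wormRho φ p := by
  have hev : ∀ᶠ q in 𝓝 p, 0 ≤ wormRho φ q := by
    filter_upwards [isClosed_closure.isOpen_compl.mem_nhds h,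
      isOpen_snd_ne_zero.mem_nhds hp] with q h1 h2
    exact not_lt.mp fun h3 => h1 (subset_closure ⟨h2, h3⟩)
  refine hev.self_of_nhds.lt_of_ne' fun h0 => fderiv_wormRho_ne_zero hφ hp h0 ?_
  refine IsLocalMin.fderiv_eq_zero ?_
  filter_upwards [hev] with q hq
  rwa [h0]

/-- A positive smooth multiple of the standard defining function is a defining function. -/
lemma isDefFn_mul (hφ : IsWormFunction φ β) {V : Set (Fin 2 → ℂ)} {E : (Fin 2 → ℂ) → ℝ}
    (hV : IsOpen V) (hsub : closure (wormDomain φ) ⊆ V) (hne : ∀ p ∈ V, p 1 ≠ 0)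
    (hE : ∀ p ∈ V, ContDiffAt ℝ (⊤ : ℕ∞) E p) (hpos : ∀ p ∈ V, 0 < E p) :
    IsDefFn (wormDomain φ) V (fun p => wormRho φ p * E p) where
  isOpen := hV
  subset := hsub
  smooth p hp := ((contDiffAt_wormRho hφ.smooth (hne p hp)).mul (hE p hp)).contDiffWithinAt
  eq := by
    ext p
    refine ⟨fun h => ?_, fun h => ⟨hne p h.1, ?_⟩⟩
    · have hp := hsub (subset_closure h)
      exact ⟨hp, mul_neg_of_neg_of_pos h.2 (hpos p hp)⟩
    · exact (neg_iff_pos_of_mul_neg h.2).mpr (hpos p h.1)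
  grad_ne p hp := by
    have hpV := hsub (frontier_subset_closure hp)
    have h0 := (frontier_wormDomain_subset hφ hp).2
    rw [fderiv_fun_mul ((contDiffAt_wormRho hφ.smooth (hne p hpV)).differentiableAt (by simp))
      ((hE p hpV).differentiableAt (by simp)), h0, zero_smul, zero_add]
    exact smul_ne_zero (hpos p hpV).ne' (fderiv_wormRho_ne_zero hφ (hne p hpV) h0)

lemma curveLevi_ge (p : Fin 2 → ℂ) (a b : ℂ) :
    (deriv (deriv φ) (logHeight p) + φ (logHeight p)) * Complex.normSq b ≤ curveLevi φ p a b := by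
  have := Complex.normSq_nonneg (2 * a + Complex.I * b * unrotated p)
  rw [curveLevi]
  linarith

lemma curveLevi_nonneg (hφ : IsWormFunction φ β) (p : Fin 2 → ℂ) (a b : ℂ) :
    0 ≤ curveLevi φ p a b := by
  have h1 := hφ.nonneg (logHeight p)
  have h2 := hφ.deriv_deriv_nonneg (logHeight p)
  have h3 := Complex.normSq_nonneg b
  exact (mul_nonneg (by linarith) h3).trans (curveLevi_ge p a b)

lemma curveLevi_pos {a b : ℂ} (p : Fin 2 → ℂ) (hb : b = 0) (ha : a ≠ 0) :
    0 < curveLevi φ p a b := by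
  rw [curveLevi, hb]
  simpa using ha

lemma add_curveLevi_div_pos {a b : ℂ} {f S : ℝ} (hS : 0 < S) (hab : ¬ (a = 0 ∧ b = 0))
    (h : 0 < f + (deriv (deriv φ) (logHeight p) + φ (logHeight p)) / S) :
    0 < f * Complex.normSq b + curveLevi φ p a b / S := by
  by_cases hb : b = 0
  · have := div_pos (curveLevi_pos (φ := φ) p hb fun ha => hab ⟨ha, hb⟩) hS
    simpa [hb] using this
  · have h1 := mul_pos h (Complex.normSq_pos.mpr hb)
    have h2 := div_le_div_of_nonneg_right (curveLevi_ge (φ := φ) p a b) hS.le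
    rw [add_mul, div_mul_eq_mul_div] at h1
    linarith

end DefiningFunctions

section Outside

variable {φ k : ℝ → ℝ} {β : ℝ}

/-- A neighbourhood of the closed worm domain. -/
def wormNhd (φ : ℝ → ℝ) (a ε : ℝ) : Set (Fin 2 → ℂ) :=
  {p | p 1 ≠ 0} ∩ {p | |logHeight p| < a ∧ wormRho φ p < ε}

lemma isOpen_wormNhd (hφ : IsWormFunction φ β) (a ε : ℝ) : IsOpen (wormNhd φ a ε) := by
  have h1 : ContinuousOn (fun p : Fin 2 → ℂ => |logHeight p|) {p | p 1 ≠ 0} := fun p hp =>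
    ((contDiffAt_log_normSq hp).continuousAt.abs).continuousWithinAt
  exact (h1.prodMk (continuousOn_wormRho hφ)).isOpen_inter_preimage isOpen_snd_ne_zero
    (isOpen_Iio.prod isOpen_Iio : IsOpen (Set.Iio a ×ˢ Set.Iio ε))

/-- The coefficient measuring how strictly the weight is a supersolution. -/
def weightDefect (k : ℝ → ℝ) (η t : ℝ) : ℝ :=
  |1 - η| / η * (-(deriv (deriv k) t + (η / (1 - η)) ^ 2 * k t) / k t)

lemma exists_weight_eps (hφ : IsWormFunction φ β) (hβ : Real.pi / 2 < β) {η : ℝ} (hη0 : 0 < η)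
    (hη1 : 1 - η ≠ 0) (h : β - Real.pi / 2 < Real.pi / (2 * |η / (1 - η)|)) (a : ℝ) :
    ∃ k : ℝ → ℝ, ContDiff ℝ (⊤ : ℕ∞) k ∧ (∀ t, 0 < k t) ∧ Continuous (weightDefect k η) ∧
      ∃ ε > 0, ∀ t, |t| ≤ a → ∀ S, 0 < S → S < ε →
        0 < weightDefect k η t + (deriv (deriv φ) t + φ t) / S := by
  obtain ⟨k, hk, hk0, hneg⟩ := hφ.exists_weight hβ (div_ne_zero hη0.ne' hη1) h
  have hc : Continuous (weightDefect k η) :=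
    continuous_const.mul ((((IsWormFunction.contDiff_deriv_deriv hk).continuous.add
      (continuous_const.mul hk.continuous)).neg).div hk.continuous fun t => (hk0 t).ne')
  refine ⟨k, hk, hk0, hc, exists_pos_add_div hc
    ((IsWormFunction.contDiff_deriv_deriv hφ.smooth).continuous.add hφ.smooth.continuous)
    (fun t => add_nonneg (hφ.deriv_deriv_nonneg t) (hφ.nonneg t)) fun t ht => ?_⟩
  have h1 := hneg t ht
  have h2 : 0 < |1 - η| := abs_pos.mpr hη1
  exact mul_pos (div_pos h2 hη0) (div_pos (by linarith) (hk0 t))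

lemma abs_exponent_bound {η : ℝ} (hβ : β < Real.pi) (hη : Real.pi / (2 * (Real.pi - β)) < η)
    (hη1 : 1 < η) : β - Real.pi / 2 < Real.pi / (2 * |η / (1 - η)|) := by
  have h1 : 0 < η - 1 := by linarith
  have h2 : |η / (1 - η)| = η / (η - 1) := by
    rw [abs_of_neg (div_neg_of_pos_of_neg (by linarith) (by linarith)), ← div_neg, neg_sub]
  rw [div_lt_iff₀ (by linarith)] at hη
  rw [h2, lt_div_iff₀ (by positivity), ← mul_div_assoc, ← mul_div_assoc, div_lt_iff₀ h1]
  linarith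

lemma complexHessian_weightedRho_rpow_pos (hφ : IsWormFunction φ β)
    (hk : ContDiff ℝ (⊤ : ℕ∞) k) (hk0 : ∀ t, 0 < k t) {η ε a : ℝ} (hη : 1 < η)
    (hε : ∀ t, |t| ≤ a → ∀ S, 0 < S → S < ε →
      0 < weightDefect k η t + (deriv (deriv φ) t + φ t) / S) {p : Fin 2 → ℂ}
    (hp : p ∈ wormNhd φ a ε) (hρ : 0 < wormRho φ p) {X : Fin 2 → ℂ} (hX : X ≠ 0) :
    0 < complexHessian (fun q => weightedRho φ k η q ^ η) p X := by
  obtain ⟨hp1, hp2, hp3⟩ := hp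
  obtain ⟨a, b, hab, h0⟩ := exists_adaptedCurve hp1 X
  obtain ⟨e, he, hH⟩ := complexHessian_weightedRho_rpow hφ.smooth hk hk0 (σ := 1)
    (by linarith : η ≠ 0) (by linarith : 1 - η ≠ 0) hp1 (by linarith) hab
  simp only [one_mul] at hH
  rw [hH]
  have hpos : 0 < weightedRho φ k η p := mul_pos hρ (Real.rpow_pos_of_pos (hk0 _) _)
  refine mul_pos (Real.rpow_pos_of_pos hpos η) ?_
  have hN := add_curveLevi_div_pos (φ := φ) (p := p) hρ (fun h => hX (h0 h.1 h.2))
    (hε _ hp2.le _ hρ hp3)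
  have hη0 : 0 < η := by linarith
  have hκ := (hk0 (logHeight p)).ne'
  rw [weightDefect, abs_of_neg (by linarith : 1 - η < 0)] at hN
  have e1 := mul_pos hη0 hN
  have e2 : 0 ≤ η * (η - 1) * e := by
    have : 0 ≤ η - 1 := by linarith
    positivity
  generalize deriv (deriv k) (logHeight p) + (η / (1 - η)) ^ 2 * k (logHeight p) = D at *
  have e3 : η * (-(1 - η) / η * (-D / k (logHeight p)) * Complex.normSq b +
      curveLevi φ p a b / wormRho φ p) = (1 - η) * D / k (logHeight p) * Complex.normSq b +
      η * curveLevi φ p a b / wormRho φ p := by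
    field_simp
  rw [e3] at e1
  linarith

lemma notMem_closure_pos (hφ : IsWormFunction φ β) {a ε : ℝ} {p : Fin 2 → ℂ}
    (hp : p ∈ (closure (wormDomain φ))ᶜ ∩ wormNhd φ a ε) : 0 < wormRho φ p :=
  wormRho_pos_of_notMem_closure hφ hp.2.1 hp.1

lemma exists_mem_steinExpSet (hφ : IsWormFunction φ β) (hβ : Real.pi / 2 < β)
    (hβ' : β < Real.pi) {η : ℝ} (hη : Real.pi / (2 * (Real.pi - β)) < η) :
    ∃ V r, IsDefFn (wormDomain φ) V r ∧ η ∈ steinExpSet (wormDomain φ) r := by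
  have hη1 : 1 < η := by
    refine lt_trans ?_ hη
    rw [lt_div_iff₀ (by linarith)]
    linarith
  obtain ⟨a, ha, hcl⟩ := exists_closed_superset hφ
  obtain ⟨k, hk, hk0, -, ε, hε0, hε⟩ := exists_weight_eps hφ hβ (by linarith : 0 < η)
    (by linarith : 1 - η ≠ 0) (abs_exponent_bound hβ' hη hη1) (a + 1)
  refine ⟨{p | p 1 ≠ 0}, weightedRho φ k η, ?_, hη1, wormNhd φ (a + 1) ε,
    isOpen_wormNhd hφ _ _, fun p hp => ?_, fun p hp X hX => ?_⟩
  · exact isDefFn_mul hφ isOpen_snd_ne_zero (fun p hp => (hcl p hp).1) (fun p hp => hp)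
      (fun p hp => (hk.contDiffAt.comp p (contDiffAt_log_normSq hp)).rpow_const_of_ne
        (hk0 _).ne') (fun p _ => Real.rpow_pos_of_pos (hk0 _) _)
  · have := hcl p (frontier_subset_closure hp)
    have h3 : |logHeight p| ≤ a := this.2.2
    exact ⟨this.1, by linarith, by linarith [this.2.1]⟩
  · have hρ := notMem_closure_pos hφ hp
    have hpos : 0 < weightedRho φ k η p := mul_pos hρ (Real.rpow_pos_of_pos (hk0 _) _)
    have hf : ContDiffAt ℝ 2 (fun q => weightedRho φ k η q ^ η) p :=
      ((contDiffAt_weightedRho hφ.smooth hk hk0 η hp.2.1).of_le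
        two_le_smooth).rpow_const_of_ne hpos.ne'
    rw [levi_re_eq hf]
    exact div_pos (complexHessian_weightedRho_rpow_pos hφ hk hk0 hη1 hε hp.2 hρ hX) (by norm_num)

lemma complexHessian_weightedRho_nonneg_of_eq_zero (hφ : IsWormFunction φ β)
    (hk : ContDiff ℝ (⊤ : ℕ∞) k) (hk0 : ∀ t, 0 < k t) {η : ℝ} (hη0 : η ≠ 0) (hη1 : 1 - η ≠ 0)
    {p : Fin 2 → ℂ} (hp : p 1 ≠ 0) (hρ : wormRho φ p = 0) {X : Fin 2 → ℂ}
    (hX : fderiv ℝ (weightedRho φ k η) p X = 0)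
    (hX' : fderiv ℝ (weightedRho φ k η) p (Complex.I • X) = 0) :
    0 ≤ complexHessian (weightedRho φ k η) p X := by
  obtain ⟨a, b, hab, -⟩ := exists_adaptedCurve hp X
  have hf : ContDiffAt ℝ 2 (weightedRho φ k η) (adaptedCurve p a b 0) := by
    rw [adaptedCurve_zero]
    exact (contDiffAt_weightedRho hφ.smooth hk hk0 η hp).of_le two_le_smooth
  obtain ⟨s₁, s₂, s₁', s₂', hS, hS', hSS⟩ := hasJet_curveRho hφ.smooth hp a b
  obtain ⟨a₁, a₂, a₁', a₂', hA, hA', -⟩ := hasJet_curveWeight hk (η / (1 - η)) p b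
  have hJ := ((hA.rpow (hk0 _) ((1 - η) / η)).mul hS).congr
    (g := fun s : ℝ => weightedRho φ k η (adaptedCurve p a b s))
    (Filter.Eventually.of_forall fun s =>
      (weightedRho_adaptedCurve hk0 hη0 hη1 hp a b s).symm)
  have hJ' := ((hA'.rpow (hk0 _) ((1 - η) / η)).mul hS').congr
    (g := fun s : ℝ => weightedRho φ k η (adaptedCurve p a b (s * Complex.I)))
    (Filter.Eventually.of_forall fun s => by
      simp only [adaptedCurve_mul_I]
      exact (weightedRho_adaptedCurve hk0 hη0 hη1 hp _ _ s).symm)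
  obtain ⟨h1, h2, h3⟩ := complexHessian_curve (contDiff_adaptedCurve p a b).contDiffAt hab hf hJ hJ'
  rw [adaptedCurve_zero] at h1 h2 h3
  have hq := Real.rpow_pos_of_pos (hk0 (logHeight p)) ((1 - η) / η)
  rw [hX, hρ] at h2
  rw [hX', hρ] at h3
  have h4 : s₁ = 0 := by simpa [hq.ne'] using h2.symm
  have h5 : s₁' = 0 := by simpa [hq.ne'] using h3.symm
  rw [h1, hρ, h4, h5]
  simp only [mul_zero, zero_add, add_zero, ← mul_add, hSS]
  exact mul_nonneg hq.le (curveLevi_nonneg hφ p a b)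

lemma hasStrongSteinBasis_of_lt_pi (hφ : IsWormFunction φ β) (hβ : Real.pi / 2 < β)
    (hβ' : β < Real.pi) : HasStrongSteinBasis (wormDomain φ) := by
  obtain ⟨η, hη⟩ := exists_gt (Real.pi / (2 * (Real.pi - β)))
  have hη1 : 1 < η := by
    refine lt_trans ?_ hη
    rw [lt_div_iff₀ (by linarith)]
    linarith
  obtain ⟨a, ha, hcl⟩ := exists_closed_superset hφ
  obtain ⟨k, hk, hk0, -, ε, hε0, hε⟩ := exists_weight_eps hφ hβ (by linarith : 0 < η)
    (by linarith : 1 - η ≠ 0) (abs_exponent_bound hβ' hη hη1) (a + 1)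
  have hW := isOpen_wormNhd hφ (a + 1) ε
  have hsm : ∀ p ∈ wormNhd φ (a + 1) ε, ContDiffAt ℝ (⊤ : ℕ∞) (weightedRho φ k η) p :=
    fun p hp => contDiffAt_weightedRho hφ.smooth hk hk0 η hp.1
  have hq : ∀ p, 0 < k (logHeight p) ^ ((1 - η) / η) := fun p => Real.rpow_pos_of_pos (hk0 _) _
  have hE : ∀ p ∈ {p : Fin 2 → ℂ | p 1 ≠ 0},
      ContDiffAt ℝ (⊤ : ℕ∞) (fun p => k (logHeight p) ^ ((1 - η) / η)) p := fun p hp =>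
    (hk.contDiffAt.comp p (contDiffAt_log_normSq hp)).rpow_const_of_ne (hk0 _).ne'
  have hdef := isDefFn_mul hφ isOpen_snd_ne_zero (fun p hp => (hcl p hp).1) (fun p hp => hp) hE
    (fun p _ => hq p)
  set V := (wormNhd φ (a + 1) ε ∩ weightedRho φ k η ⁻¹' Set.Iio 0) ∪
    (wormNhd φ (a + 1) ε ∩ (fderiv ℝ (weightedRho φ k η)) ⁻¹' {0}ᶜ) with hVdef
  have hVW : V ⊆ wormNhd φ (a + 1) ε := Set.union_subset Set.inter_subset_left Set.inter_subset_left
  have hV : IsOpen V := by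
    refine IsOpen.union (ContinuousOn.isOpen_inter_preimage (fun p hp => ?_) hW isOpen_Iio)
      (ContinuousOn.isOpen_inter_preimage (fun p hp => ?_) hW isOpen_compl_singleton)
    · exact (hsm p hp).continuousAt.continuousWithinAt
    · exact (((hsm p hp).of_le two_le_smooth).fderiv_right (m := 1)
        (by norm_num)).continuousAt.continuousWithinAt
  have hclV : closure (wormDomain φ) ⊆ V := fun p hp => by
    obtain ⟨h1, h2, h3⟩ := hcl p hp
    have h3 : |logHeight p| ≤ a := h3
    have hpW : p ∈ wormNhd φ (a + 1) ε := ⟨h1, by linarith, by linarith⟩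
    by_cases hpo : p ∈ wormDomain φ
    · exact Or.inl ⟨hpW, mul_neg_of_neg_of_pos hpo.2 (hq p)⟩
    · refine Or.inr ⟨hpW, hdef.grad_ne p ?_⟩
      rw [(isOpen_wormDomain hφ).frontier_eq]
      exact ⟨hp, hpo⟩
  refine ⟨V, weightedRho φ k η, isDefFn_mul hφ hV hclV (fun p hp => (hVW hp).1)
    (fun p hp => hE p (hVW hp).1) (fun p _ => hq p), 1, one_pos, fun p hp h0 _ => ?_,
    fun δ hδ _ p hp hpδ X hX => ?_⟩
  · rcases hp with hp | hp
    · exact absurd hp.2 h0.not_gt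
    · exact hp.2
  · have hpW := hVW hp
    have hs2 := (hsm p hpW).of_le two_le_smooth
    obtain ⟨hX1, hX2⟩ := (dirDeriv_cplx_eq_zero_iff (hs2.differentiableAt (by simp)) X).mp hX
    rw [levi_re_eq hs2]
    refine div_nonneg ?_ (by norm_num)
    have hge : 0 ≤ weightedRho φ k η p := by rw [hpδ]; exact hδ
    rcases hge.eq_or_lt with h0 | hpos
    · refine complexHessian_weightedRho_nonneg_of_eq_zero hφ hk hk0 (by linarith) (by linarith)
        hpW.1 ?_ hX1 hX2
      exact (mul_eq_zero.mp h0.symm).resolve_right (hq p).ne'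
    · have hρ : 0 < wormRho φ p := (pos_iff_pos_of_mul_pos hpos).mpr (hq p)
      by_cases hX0 : X = 0
      · simp [complexHessian, hX0]
      · have := complexHessian_weightedRho_rpow_pos hφ hk hk0 hη1 hε hpW hρ hX0
        rw [complexHessian_rpow hs2 hpos, hX1, hX2] at this
        have hP : 0 < η * weightedRho φ k η p ^ (η - 2) :=
          mul_pos (by linarith) (Real.rpow_pos_of_pos hpos _)
        have h3 := (pos_iff_pos_of_mul_pos this).mp hP
        simp only [ne_eq, OfNat.ofNat_ne_zero, not_false_eq_true, zero_pow, add_zero,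
          mul_zero] at h3
        exact ((pos_iff_pos_of_mul_pos h3).mp hpos).le

end Outside

section Inside

variable {φ k : ℝ → ℝ} {β : ℝ}

lemma sq_add_le_mul_div {T Q : ℝ} (hT : 0 < T) (hQ : 0 < Q) (x y : ℝ) :
    (x + y) ^ 2 ≤ (T + Q) * (x ^ 2 / T + y ^ 2 / Q) := by
  have : (T + Q) * (x ^ 2 / T + y ^ 2 / Q) - (x + y) ^ 2 = (Q * x - T * y) ^ 2 / (T * Q) := by
    field_simp
    ring
  have h2 : 0 ≤ (Q * x - T * y) ^ 2 / (T * Q) := by positivity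
  linarith

/-- The negative power `-η` of a sum is strictly superharmonic on a complex line as soon as the sum
of the defects of the two terms is positive. -/
lemma complexHessian_add_rpow_neg {E : Type*} [NormedAddCommGroup E] [NormedSpace ℂ E]
    {T Q : E → ℝ} {p X : E} {η n m : ℝ} (hη : 0 < η) (hT : ContDiffAt ℝ 2 T p)
    (hQ : ContDiffAt ℝ 2 Q p) (hTp : 0 < T p) (hQp : 0 < Q p)
    (hn : complexHessian T p X = n +
      (η + 1) * (fderiv ℝ T p X ^ 2 + fderiv ℝ T p (Complex.I • X) ^ 2) / T p)
    (hm : m + (η + 1) * (fderiv ℝ Q p X ^ 2 + fderiv ℝ Q p (Complex.I • X) ^ 2) / Q p ≤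
      complexHessian Q p X) (hnm : 0 < n + m) :
    complexHessian (fun q => (T q + Q q) ^ (-η)) p X < 0 := by
  have hsum : 0 < T p + Q p := add_pos hTp hQp
  have hH : complexHessian (fun q => T q + Q q) p X = complexHessian T p X + complexHessian Q p X := by
    rw [complexHessian_eq_of_hasJet (hT.add hQ) ((hasJet_line hT X).add (hasJet_line hQ X))
      ((hasJet_line hT (Complex.I • X)).add (hasJet_line hQ (Complex.I • X))), complexHessian,
      complexHessian]
    ring
  have hd : ∀ Y, fderiv ℝ (fun q => T q + Q q) p Y = fderiv ℝ T p Y + fderiv ℝ Q p Y := fun Y => by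
    rw [fderiv_fun_add (hT.differentiableAt (by simp)) (hQ.differentiableAt (by simp))]
    rfl
  rw [complexHessian_rpow (hT.add hQ) hsum, hH, hd, hd]
  have hP := Real.rpow_pos_of_pos hsum (-η - 2)
  have h1 := sq_add_le_mul_div hTp hQp (fderiv ℝ T p X) (fderiv ℝ Q p X)
  have h2 := sq_add_le_mul_div hTp hQp (fderiv ℝ T p (Complex.I • X))
    (fderiv ℝ Q p (Complex.I • X))
  have h3 : (T p + Q p) * (n + m + (η + 1) * (fderiv ℝ T p X ^ 2 / T p + fderiv ℝ Q p X ^ 2 / Q p +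
      (fderiv ℝ T p (Complex.I • X) ^ 2 / T p + fderiv ℝ Q p (Complex.I • X) ^ 2 / Q p))) ≤
      (T p + Q p) * (complexHessian T p X + complexHessian Q p X) := by
    refine mul_le_mul_of_nonneg_left ?_ hsum.le
    rw [hn]
    refine le_trans (le_of_eq ?_) (add_le_add_right hm _)
    ring
  have h4 : 0 < (T p + Q p) * (n + m) := mul_pos hsum hnm
  have h5 := mul_le_mul_of_nonneg_left (add_le_add h1 h2) (by linarith : 0 ≤ η + 1)
  rw [neg_mul, neg_mul, neg_lt_zero]
  refine mul_pos (mul_pos hη hP) ?_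
  nlinarith

/-- The patching term added to the reciprocal of the weighted defining function. -/
def patchTerm (C δ : ℝ) (t : ℝ) : ℝ := C * (1 + δ * t ^ 2)

lemma hasJet_patchTerm (C δ t : ℝ) :
    HasJet (patchTerm C δ) t (patchTerm C δ t) (C * (2 * δ * t)) (C * (2 * δ)) := by
  have h := HasJet.linear 0 1 t
  refine ((((HasJet.const 1 t).add ((h.mul h).const_mul δ)).const_mul C).congr
    (Filter.Eventually.of_forall fun s => ?_)).congr_vals ?_ ?_ ?_
  · simp only [patchTerm]; ring
  · simp only [patchTerm]; ring
  · ring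
  · ring

lemma contDiff_patchTerm (C δ : ℝ) : ContDiff ℝ (⊤ : ℕ∞) (patchTerm C δ) :=
  contDiff_const.mul (contDiff_const.add (contDiff_const.mul (contDiff_id.pow 2)))

lemma patchTerm_pos {C δ : ℝ} (hC : 0 < C) (hδ : 0 < δ) (t : ℝ) : 0 < patchTerm C δ t := by
  unfold patchTerm
  positivity

lemma patchTerm_defect {C δ η a t : ℝ} (hC : 0 < C) (hδ : 0 < δ) (hη : η < 1)
    (ht : |t| ≤ a) (ha : 8 * δ * a ^ 2 ≤ 1) :
    C * δ + (η + 1) * (deriv (patchTerm C δ) t) ^ 2 / patchTerm C δ t ≤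
      deriv (deriv (patchTerm C δ)) t := by
  rw [(hasJet_patchTerm C δ t).deriv_deriv_eq, (hasJet_patchTerm C δ t).deriv_eq]
  have h1 : t ^ 2 ≤ a ^ 2 := sq_le_sq.mpr (ht.trans (le_abs_self a))
  have h2 : (η + 1) * (C * (2 * δ * t)) ^ 2 / patchTerm C δ t ≤ C * δ := by
    rw [div_le_iff₀ (patchTerm_pos hC hδ t), patchTerm]
    have h3 : 8 * δ * t ^ 2 ≤ 1 := by nlinarith
    have h4 : (η + 1) * (4 * δ * t ^ 2) ≤ 1 := by
      have : 0 ≤ δ * t ^ 2 := by positivity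
      nlinarith
    have h5 : 0 ≤ δ * t ^ 2 := by positivity
    have h6 : 0 ≤ C ^ 2 * δ := by positivity
    have h7 : (η + 1) * (C * (2 * δ * t)) ^ 2 = C ^ 2 * δ * ((η + 1) * (4 * δ * t ^ 2)) := by ring
    rw [h7]
    nlinarith [mul_le_mul_of_nonneg_left (h4.trans (le_add_of_nonneg_right h5)) h6]
  linarith

lemma complexHessian_inv_weightedRho (hφ : IsWormFunction φ β)
    (hk : ContDiff ℝ (⊤ : ℕ∞) k) (hk0 : ∀ t, 0 < k t) {η : ℝ} (hη0 : 0 < η) (hη1 : η < 1)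
    {p : Fin 2 → ℂ} (hp : p ∈ wormDomain φ) {X : Fin 2 → ℂ} {a b : ℂ}
    (hab : HasDerivAt (adaptedCurve p a b) X 0) :
    ∃ e ≥ 0, complexHessian (fun q => (-weightedRho φ k η q)⁻¹) p X =
      (-weightedRho φ k η p)⁻¹ * (weightDefect k η (logHeight p) * Complex.normSq b +
        curveLevi φ p a b / (-wormRho φ p) + e) +
      (η + 1) * (fderiv ℝ (fun q => (-weightedRho φ k η q)⁻¹) p X ^ 2 +
        fderiv ℝ (fun q => (-weightedRho φ k η q)⁻¹) p (Complex.I • X) ^ 2) /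
        (-weightedRho φ k η p)⁻¹ := by
  have hs : 0 < (-1) * wormRho φ p := by linarith [hp.2]
  obtain ⟨e, he, hH⟩ := complexHessian_weightedRho_rpow hφ.smooth hk hk0 (σ := -1)
    hη0.ne' (by linarith : 1 - η ≠ 0) hp.1 hs hab
  simp only [neg_one_mul] at hH hs
  have hR : 0 < -weightedRho φ k η p := by
    have := mul_pos hs (Real.rpow_pos_of_pos (hk0 (logHeight p)) ((1 - η) / η))
    rw [weightedRho]
    linarith
  have hcd := (contDiffAt_weightedRho hφ.smooth hk hk0 η hp.1).of_le two_le_smooth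
  have hT : ContDiffAt ℝ 2 (fun q => (-weightedRho φ k η q)⁻¹) p := hcd.neg.inv hR.ne'
  have hTp := inv_pos.mpr hR
  have hrp := complexHessian_rpow hT hTp (-η) X
  have hev : (fun q => ((-weightedRho φ k η q)⁻¹) ^ (-η)) =ᶠ[𝓝 p]
      fun q => (-weightedRho φ k η q) ^ η := by
    filter_upwards [hcd.neg.continuousAt.eventually (lt_mem_nhds hR)] with q hq
    rw [Real.rpow_neg (inv_pos.mpr hq).le, Real.inv_rpow hq.le, inv_inv]
  have hcongr : complexHessian (fun q => ((-weightedRho φ k η q)⁻¹) ^ (-η)) p X =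
      complexHessian (fun q => (-weightedRho φ k η q) ^ η) p X := by
    rw [complexHessian, complexHessian, hev.fderiv.fderiv_eq]
  rw [hcongr, hH] at hrp
  have hpow : (-weightedRho φ k η p) ^ η = (-weightedRho φ k η p)⁻¹ ^ (-η - 2) *
      (-weightedRho φ k η p)⁻¹ ^ 2 := by
    have hv : (-weightedRho φ k η p)⁻¹ ^ (-η) = (-weightedRho φ k η p) ^ η := hev.self_of_nhds
    rw [← Real.rpow_natCast, ← Real.rpow_add hTp, ← hv]
    norm_num
  have hP := Real.rpow_pos_of_pos hTp (-η - 2)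
  rw [hpow] at hrp
  refine ⟨(1 - η) * e, mul_nonneg (by linarith) he, ?_⟩
  rw [weightDefect, abs_of_pos (by linarith : 0 < 1 - η)]
  generalize (-weightedRho φ k η p)⁻¹ ^ (-η - 2) = P at hrp hP
  generalize (-weightedRho φ k η p)⁻¹ = T at *
  generalize fderiv ℝ (fun q => (-weightedRho φ k η q)⁻¹) p X ^ 2 +
    fderiv ℝ (fun q => (-weightedRho φ k η q)⁻¹) p (Complex.I • X) ^ 2 = G at *
  generalize complexHessian (fun q => (-weightedRho φ k η q)⁻¹) p X = H at *
  generalize deriv (deriv k) (logHeight p) + (η / (1 - η)) ^ 2 * k (logHeight p) = D at *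
  have h1 : P * (T ^ 2 * ((1 - η) * D / k (logHeight p) * Complex.normSq b +
      η * curveLevi φ p a b / wormRho φ p - η * (1 - η) * e) + η * (T * H + (-η - 1) * G)) = 0 := by
    linear_combination hrp
  have h2 := (mul_eq_zero.mp h1).resolve_left hP.ne'
  have hρ : wormRho φ p ≠ 0 := by linarith [hp.2]
  have hkne := (hk0 (logHeight p)).ne'
  have hTne := hTp.ne'
  have hηne := hη0.ne'
  have h3 : η * T * (H - (T * ((1 - η) / η * (-D / k (logHeight p)) * Complex.normSq b +
      curveLevi φ p a b / (-wormRho φ p) + (1 - η) * e) + (η + 1) * G / T)) = 0 := by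
    rw [← h2, div_neg]
    field_simp
    ring
  have h4 := (mul_eq_zero.mp h3).resolve_left (mul_pos hη0 hTp).ne'
  linarith

lemma exists_mem_dfExpSet (hφ : IsWormFunction φ β) (hβ : Real.pi / 2 < β) {η : ℝ} (hη0 : 0 < η)
    (hη : η < Real.pi / (2 * β)) :
    ∃ V r, IsDefFn (wormDomain φ) V r ∧ η ∈ dfExpSet (wormDomain φ) r := by
  have hπ := Real.pi_pos
  have hβ0 : 0 < β := by linarith
  rw [lt_div_iff₀ (by linarith)] at hη
  have hη1 : η < 1 := by nlinarith
  have hη1' : 0 < 1 - η := by linarith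
  obtain ⟨a, ha, hcl⟩ := exists_closed_superset hφ
  obtain ⟨k, hk, hk0, hwc, ε, hε0, hε⟩ := exists_weight_eps hφ hβ hη0 hη1'.ne' (by
    rw [abs_of_pos (by positivity), lt_div_iff₀ (by positivity), ← mul_div_assoc,
      ← mul_div_assoc, div_lt_iff₀ hη1']
    linarith) a
  obtain ⟨δ, hδ, hδa⟩ : ∃ δ > 0, 8 * δ * a ^ 2 ≤ 1 :=
    ⟨1 / (8 * a ^ 2), by positivity, by field_simp; exact le_refl _⟩
  have hq : ∀ t, 0 < k t ^ ((1 - η) / η) := fun t => Real.rpow_pos_of_pos (hk0 _) _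
  have hqc : Continuous fun t => |weightDefect k η t| / k t ^ ((1 - η) / η) :=
    hwc.abs.div (hk.continuous.rpow_const fun t => Or.inl (hk0 t).ne') fun t => (hq t).ne'
  obtain ⟨B, hB⟩ := (isCompact_Icc (a := -a) (b := a)).bddAbove_image hqc.continuousOn
  have hB' : ∀ t, |t| ≤ a → |weightDefect k η t| / k t ^ ((1 - η) / η) ≤ B := fun t ht =>
    hB (Set.mem_image_of_mem _ (Set.mem_Icc.mpr (abs_le.mp ht)))
  have hB0 : 0 ≤ B := (div_nonneg (abs_nonneg _) (hq 0).le).trans (hB' 0 (by simpa using ha.le))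
  set C := (B / ε + 1) / δ with hC
  have hC0 : 0 < C := by positivity
  have hCδ : C * δ = B / ε + 1 := div_mul_cancel₀ _ hδ.ne'
  have hQ0 : ∀ t, 0 < patchTerm C δ t := patchTerm_pos hC0 hδ
  have hsm : ∀ p ∈ {p : Fin 2 → ℂ | p 1 ≠ 0}, ContDiffAt ℝ (⊤ : ℕ∞)
      (fun p => 1 - weightedRho φ k η p * patchTerm C δ (logHeight p)) p := fun p hp =>
    contDiffAt_const.sub ((contDiffAt_weightedRho hφ.smooth hk hk0 η hp).mul
      ((contDiff_patchTerm C δ).contDiffAt.comp p (contDiffAt_log_normSq hp)))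
  have hEs : ∀ p ∈ {p : Fin 2 → ℂ | p 1 ≠ 0},
      ContDiffAt ℝ (⊤ : ℕ∞) (fun p => k (logHeight p) ^ ((1 - η) / η)) p := fun p hp =>
    (hk.contDiffAt.comp p (contDiffAt_log_normSq hp)).rpow_const_of_ne (hk0 _).ne'
  have hV : IsOpen ({p : Fin 2 → ℂ | p 1 ≠ 0} ∩
      (fun p => 1 - weightedRho φ k η p * patchTerm C δ (logHeight p)) ⁻¹' Set.Ioi 0) :=
    ContinuousOn.isOpen_inter_preimage
      (fun p hp => (hsm p hp).continuousAt.continuousWithinAt) isOpen_snd_ne_zero isOpen_Ioi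
  refine ⟨_, fun p => wormRho φ p * (k (logHeight p) ^ ((1 - η) / η) /
    (1 - weightedRho φ k η p * patchTerm C δ (logHeight p))), isDefFn_mul hφ hV (fun p hp => ?_)
    (fun p hp => hp.1) (fun p hp => (hEs p hp.1).div (hsm p hp.1) (ne_of_gt hp.2))
    (fun p hp => div_pos (hq _) hp.2), hη0, hη1, fun p hp X hX => ?_⟩
  · obtain ⟨h1, h2, -⟩ := hcl p hp
    refine ⟨h1, ?_⟩
    have h3 : weightedRho φ k η p ≤ 0 := mul_nonpos_of_nonpos_of_nonneg h2 (hq _).le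
    have h4 := mul_nonpos_of_nonpos_of_nonneg h3 (hQ0 (logHeight p)).le
    change 0 < 1 - weightedRho φ k η p * patchTerm C δ (logHeight p)
    linarith
  · have hcd := (contDiffAt_weightedRho hφ.smooth hk hk0 η hp.1).of_le two_le_smooth
    have hSp : 0 < -wormRho φ p := by linarith [hp.2]
    have hRneg : ∀ q ∈ wormDomain φ, 0 < -weightedRho φ k η q := fun q hq' => by
      have := mul_neg_of_neg_of_pos hq'.2 (hq (logHeight q))
      rw [weightedRho]
      linarith
    have hR := hRneg p hp
    have hTc : ContDiffAt ℝ 2 (fun q => (-weightedRho φ k η q)⁻¹) p := hcd.neg.inv hR.ne'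
    have hQc : ContDiffAt ℝ 2 (fun q => patchTerm C δ (logHeight q)) p :=
      ((contDiff_patchTerm C δ).contDiffAt.comp p (contDiffAt_log_normSq hp.1)).of_le two_le_smooth
    have hTp := inv_pos.mpr hR
    have hev : (fun z => -((-(wormRho φ z * (k (logHeight z) ^ ((1 - η) / η) /
        (1 - weightedRho φ k η z * patchTerm C δ (logHeight z))))) ^ η)) =ᶠ[𝓝 p]
        fun q => -(((-weightedRho φ k η q)⁻¹ + patchTerm C δ (logHeight q)) ^ (-η)) := by
      filter_upwards [(isOpen_wormDomain hφ).mem_nhds hp] with q hq'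
      have h1 := hRneg q hq'
      have h2 := hQ0 (logHeight q)
      have h3 : (-weightedRho φ k η q)⁻¹ + patchTerm C δ (logHeight q) =
          (-(wormRho φ q * (k (logHeight q) ^ ((1 - η) / η) /
        (1 - weightedRho φ k η q * patchTerm C δ (logHeight q)))))⁻¹ := by
        rw [← mul_div_assoc, ← neg_div, inv_div]
        change _ = _ / (-weightedRho φ k η q)
        have h1' := (neg_pos.mp h1).ne
        field_simp
        ring
      have h4 : 0 < (-(wormRho φ q * (k (logHeight q) ^ ((1 - η) / η) /
        (1 - weightedRho φ k η q * patchTerm C δ (logHeight q)))))⁻¹ := by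
        rw [← h3]
        exact add_pos (inv_pos.mpr h1) h2
      rw [h3, Real.rpow_neg h4.le, ← Real.inv_rpow h4.le, inv_inv]
    have hFc : ContDiffAt ℝ 2
        (fun q => ((-weightedRho φ k η q)⁻¹ + patchTerm C δ (logHeight q)) ^ (-η)) p :=
      (hTc.add hQc).rpow_const_of_ne (add_pos hTp (hQ0 _)).ne'
    rw [levi_re_eq (hFc.neg.congr_of_eventuallyEq hev), complexHessian, hev.fderiv.fderiv_eq,
      ← complexHessian, complexHessian_neg hFc]
    refine div_pos (neg_pos.mpr ?_) (by norm_num)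
    obtain ⟨a', b, hab, h0⟩ := exists_adaptedCurve hp.1 X
    obtain ⟨e, he, hH⟩ := complexHessian_inv_weightedRho hφ hk hk0 hη0 hη1 hp hab
    obtain ⟨hq1, hq2⟩ := complexHessian_comp_logHeight (contDiff_patchTerm C δ) hp.1 hab
    have ht : |logHeight p| ≤ a := (hcl p (subset_closure hp)).2.2
    refine complexHessian_add_rpow_neg (m := C * δ * Complex.normSq b) hη0 hTc hQc hTp (hQ0 _) hH
      ?_ ?_
    · rw [hq1, hq2]
      refine le_trans (le_of_eq ?_) (mul_le_mul_of_nonneg_right (patchTerm_defect hC0 hδ hη1 ht hδa)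
        (Complex.normSq_nonneg b))
      ring
    · have hb := Complex.normSq_nonneg b
      have hL := curveLevi_nonneg hφ p a' b
      by_cases hcase : -wormRho φ p < ε ∨ b = 0
      · have hN : 0 < weightDefect k η (logHeight p) * Complex.normSq b +
            curveLevi φ p a' b / (-wormRho φ p) := by
          rcases hcase with hcase | hcase
          · exact add_curveLevi_div_pos hSp (fun h => hX (h0 h.1 h.2)) (hε _ ht _ hSp hcase)
          · have := div_pos (curveLevi_pos (φ := φ) p hcase fun h => hX (h0 h hcase)) hSp
            simpa [hcase] using this
        have h1 := mul_pos hTp (add_pos_of_pos_of_nonneg hN he)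
        have h2 : 0 ≤ C * δ * Complex.normSq b := by positivity
        linarith
      · push Not at hcase
        obtain ⟨hge, hb0⟩ := hcase
        have hbp := Complex.normSq_pos.mpr hb0
        have h1 : (-weightedRho φ k η p)⁻¹ * |weightDefect k η (logHeight p)| ≤ B / ε := by
          have h2 : -weightedRho φ k η p =
              -wormRho φ p * k (logHeight p) ^ ((1 - η) / η) := by
            rw [weightedRho]; ring
          rw [h2, mul_inv, mul_assoc, inv_mul_eq_div, inv_mul_eq_div]
          exact div_le_div₀ hB0 (hB' _ ht) hε0 hge
        have h2 : -(B / ε) ≤ (-weightedRho φ k η p)⁻¹ * weightDefect k η (logHeight p) := by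
          have := mul_le_mul_of_nonneg_left (neg_abs_le (weightDefect k η (logHeight p))) hTp.le
          linarith
        have h3 : 0 ≤ (-weightedRho φ k η p)⁻¹ * (curveLevi φ p a' b / (-wormRho φ p) + e) :=
          mul_nonneg hTp.le (add_nonneg (div_nonneg hL hSp.le) he)
        have h4 := mul_le_mul_of_nonneg_right h2 hb
        rw [hCδ]
        linarith

end Inside

section Assembly

variable {φ : ℝ → ℝ} {β : ℝ}

lemma dfExp_le (hφ : IsWormFunction φ β) (hβ : Real.pi / 2 < β) {V : Set (Fin 2 → ℂ)}
    {r : (Fin 2 → ℂ) → ℝ} (hr : IsDefFn (wormDomain φ) V r) :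
    dfExp (wormDomain φ) r ≤ Real.pi / (2 * β) := by
  have hπ := Real.pi_pos
  have hβ0 : 0 < β := by linarith
  refine csSup_le (Set.insert_nonempty _ _) ?_
  rintro η (rfl | hη)
  · positivity
  · exact (dfExp_bound hφ hβ hr hη).le

lemma dfIndex_wormDomain (hφ : IsWormFunction φ β) (hβ : Real.pi / 2 < β) :
    dfIndex (wormDomain φ) = Real.pi / (2 * β) := by
  have hπ := Real.pi_pos
  have hβ0 : 0 < β := by linarith
  have hub : ∀ t ∈ {t | ∃ V ρ, IsDefFn (wormDomain φ) V ρ ∧ t = dfExp (wormDomain φ) ρ},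
      t ≤ Real.pi / (2 * β) := by
    rintro t ⟨V, r, hr, rfl⟩
    exact dfExp_le hφ hβ hr
  refine le_antisymm (Real.sSup_le hub (by positivity)) (le_of_forall_lt fun c hc => ?_)
  obtain ⟨η, h1, h2⟩ := exists_between (max_lt hc (by positivity : 0 < Real.pi / (2 * β)))
  obtain ⟨V, r, hr, hη⟩ := exists_mem_dfExpSet hφ hβ ((le_max_right _ _).trans_lt h1) h2
  have h3 : η ≤ dfExp (wormDomain φ) r := by
    refine le_csSup ⟨Real.pi / (2 * β), ?_⟩ (Set.mem_insert_of_mem _ hη)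
    rintro x (rfl | hx)
    · positivity
    · exact (dfExp_bound hφ hβ hr hx).le
  exact ((le_max_left _ _).trans_lt h1).trans_le (h3.trans (le_csSup ⟨_, hub⟩ ⟨V, r, hr, rfl⟩))

lemma steinIndex_wormDomain (hφ : IsWormFunction φ β) (hβ : Real.pi / 2 < β) (hβ' : β < Real.pi) :
    steinIndex (wormDomain φ) = ENNReal.ofReal (Real.pi / (2 * (Real.pi - β))) := by
  refine le_antisymm (ENNReal.le_of_forall_pos_le_add fun ε hε _ => ?_) ?_
  · obtain ⟨V, r, hr, hη⟩ := exists_mem_steinExpSet hφ hβ hβ'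
      (lt_add_of_pos_right (Real.pi / (2 * (Real.pi - β))) (NNReal.coe_pos.mpr hε))
    have h : steinIndex (wormDomain φ) ≤ steinExp (wormDomain φ) r :=
      (iInf_le _ V).trans ((iInf_le _ r).trans (iInf_le _ hr))
    refine h.trans ((sInf_le (Set.mem_image_of_mem _ hη)).trans ?_)
    exact ENNReal.ofReal_add_le.trans_eq (by rw [ENNReal.ofReal_coe_nnreal])
  · refine le_iInf fun V => le_iInf fun r => le_iInf fun hr => le_sInf ?_
    rintro _ ⟨η, hη, rfl⟩
    exact ENNReal.ofReal_le_ofReal (steinExp_bound hφ hβ hr hη).2.le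

lemma steinIndex_lt_top_iff (hφ : IsWormFunction φ β) (hβ : Real.pi / 2 < β) :
    steinIndex (wormDomain φ) < ⊤ ↔ β < Real.pi := by
  refine ⟨fun h => ?_, fun h => ?_⟩
  · simp only [steinIndex, steinExp, iInf_lt_iff, sInf_lt_iff] at h
    obtain ⟨V, r, hr, _, ⟨η, hη, -⟩, -⟩ := h
    exact (steinExp_bound hφ hβ hr hη).1
  · rw [steinIndex_wormDomain hφ hβ h]
    exact ENNReal.ofReal_lt_top

end Assembly

/-- Theorem 1.1: for the worm domain `Ω_β` the conditions
(1) `1/2 < DF(Ω_β) < 1`, (2) `S(Ω_β)` exists, (3) `cl Ω_β` has a strong Stein neighborhood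
basis, are all equivalent, and each is equivalent to `π/2 < β < π`; moreover if they hold
then `1/DF(Ω_β) + 1/S(Ω_β) = 2`. -/
theorem worm_main_theorem (β : ℝ) (hβ : Real.pi / 2 < β) (φ : ℝ → ℝ)
    (hφ : IsWormFunction φ β) :
    ((1 / 2 < dfIndex (wormDomain φ) ∧ dfIndex (wormDomain φ) < 1) ↔
      steinIndex (wormDomain φ) < ⊤) ∧
    (steinIndex (wormDomain φ) < ⊤ ↔ HasStrongSteinBasis (wormDomain φ)) ∧
    (HasStrongSteinBasis (wormDomain φ) ↔ (Real.pi / 2 < β ∧ β < Real.pi)) ∧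
    ((Real.pi / 2 < β ∧ β < Real.pi) →
      1 / dfIndex (wormDomain φ) + 1 / (steinIndex (wormDomain φ)).toReal = 2) := by
  have hπ := Real.pi_pos
  have hβ0 : 0 < β := by linarith
  have hS := steinIndex_lt_top_iff hφ hβ
  have hH : HasStrongSteinBasis (wormDomain φ) ↔ β < Real.pi :=
    ⟨lt_pi_of_hasStrongSteinBasis hφ hβ, hasStrongSteinBasis_of_lt_pi hφ hβ⟩
  rw [hS, hH, dfIndex_wormDomain hφ hβ, lt_div_iff₀ (by positivity), div_lt_one (by positivity)]
  refine ⟨⟨fun h => by linarith [h.1], fun h => ⟨by linarith, by linarith⟩⟩, Iff.rfl,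
    ⟨fun h => ⟨hβ, h⟩, fun h => h.2⟩, fun h => ?_⟩
  have hβπ : 0 < Real.pi - β := by linarith [h.2]
  rw [steinIndex_wormDomain hφ hβ h.2, ENNReal.toReal_ofReal (by positivity)]
  field_simp
  ring
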